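/- There is a constant c > 0 such that the following holds. Let G be a graph of genus g > 0 (with maximum degree at most 4) and let X be a well-linked set in G. Then G contains an h×h grid minor with an interface S such that h ≥ c·|X|/g and there exist at least h/8 pairwise edge-disjoint paths in G from X to S (each vertex of X and of S being the endpoint of at most one of these paths). -/

import Mathlib

open Finset

/-- Count of occurrences of `e` in a list (classical, no decidability assumptions). -/
noncomputable def ecount {α : Type} (l : List α) (e : α) : ℕ :=
  letI := Classical.decEq α
  l.count e

/-- The reversal permutation on darts of a graph. -/
def dartRev {V : Type} (G : SimpleGraph V) : Equiv.Perm G.Dart :=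
  ⟨SimpleGraph.Dart.symm, SimpleGraph.Dart.symm,
    fun d => SimpleGraph.Dart.symm_symm d, fun d => SimpleGraph.Dart.symm_symm d⟩

/-- The setoid on `α` whose classes are the orbits (cycles) of the permutation `f`. -/
def permOrbitSetoid {α : Type} (f : Equiv.Perm α) : Setoid α :=
  ⟨f.SameCycle, ⟨fun x => Equiv.Perm.SameCycle.refl f x,
    fun h => h.symm, fun h h' => h.trans h'⟩⟩

/-- The number of orbits (cycles, including fixed points) of a permutation. -/
noncomputable def numOrbits {α : Type} (f : Equiv.Perm α) : ℕ :=
  Nat.card (Quotient (permOrbitSetoid f))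

/-- A rotation system (combinatorial embedding into an orientable surface) for the
graph `G`: a permutation of the darts which fixes the tail of each dart and whose
restriction to the darts out of any fixed vertex is a single cycle. -/
structure RotationSystem {V : Type} (G : SimpleGraph V) where
  rot : Equiv.Perm G.Dart
  tail_fixed : ∀ d : G.Dart, (rot d).toProd.1 = d.toProd.1
  vertex_cycle : ∀ d d' : G.Dart, d.toProd.1 = d'.toProd.1 → rot.SameCycle d d'

/-- The number of faces of the embedding described by a rotation system: the number of
orbits of the face permutation (rotation composed with dart reversal). -/
noncomputable def RotationSystem.numFaces {V : Type} {G : SimpleGraph V}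
    (rs : RotationSystem G) : ℕ :=
  numOrbits (rs.rot * dartRev G)

/-- `G` embeds in the orientable surface of genus `g`; combinatorially, `G` has a
rotation system whose Euler characteristic `|V| - |E| + F` is at least
`2·(number of components) - 2g`. -/
def genusLE {V : Type} (G : SimpleGraph V) (g : ℕ) : Prop :=
  ∃ rs : RotationSystem G,
    (2 * Nat.card G.ConnectedComponent : ℤ) - 2 * (g : ℤ) ≤
      (Nat.card V : ℤ) - (G.edgeSet.ncard : ℤ) + (rs.numFaces : ℤ)

/-- The number of edges of `G` with exactly one endpoint in `S`, i.e. `|δ(S)|`. -/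
noncomputable def edgeCut {V : Type} (G : SimpleGraph V) (S : Set V) : ℕ :=
  {e ∈ G.edgeSet | ∃ u v, e = s(u, v) ∧ u ∈ S ∧ v ∉ S}.ncard

/-- `X` is (cut-)well-linked in `G`: `|δ(S)| ≥ |S ∩ X|` whenever `|S ∩ X| ≤ |X|/2`. -/
def WellLinked {V : Type} [DecidableEq V] (G : SimpleGraph V) (X : Finset V) : Prop :=
  ∀ S : Finset V, 2 * (S ∩ X).card ≤ X.card → (S ∩ X).card ≤ edgeCut G ↑S

/-- `S` is routable to `T` in `G`: there are `|S|` pairwise edge-disjoint paths from `S`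
to `T` such that every vertex of `S ∪ T` is an endpoint of at most one of the paths
(paths of length 0 are allowed). -/
def Routable {V : Type} (G : SimpleGraph V) (S T : Finset V) : Prop :=
  ∃ (f : V → V) (P : ∀ s ∈ S, G.Walk s (f s)),
    (∀ s ∈ S, f s ∈ T) ∧
    Set.InjOn f ↑S ∧
    (∀ s ∈ S, ∀ s' ∈ S, f s = s' → s = s') ∧
    ∀ e : Sym2 V, (∑ a ∈ S.attach, ecount (P a.1 a.2).edges e) ≤ 1

/-- The maximum number of pairwise edge-disjoint paths from `A` to `B` in `G` (with
every vertex of `A ∪ B` the endpoint of at most one path). -/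
noncomputable def maxEDPaths {V : Type} (G : SimpleGraph V) (A B : Finset V) : ℕ :=
  sSup {r : ℕ | ∃ A' ⊆ A, A'.card = r ∧ Routable G A' B}

/-- The `h × h` grid graph. -/
def gridGraph (h : ℕ) : SimpleGraph (Fin h × Fin h) :=
  SimpleGraph.fromRel (fun a b =>
    (a.1 = b.1 ∧ (a.2 : ℕ) + 1 = (b.2 : ℕ)) ∨ (a.2 = b.2 ∧ (a.1 : ℕ) + 1 = (b.1 : ℕ)))

/-- An `h × h` grid minor of `G`: pairwise disjoint nonempty connected branch sets,
one per grid vertex, with an edge of `G` between the branch sets of adjacent grid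
vertices. -/
structure GridMinor {V : Type} (G : SimpleGraph V) (h : ℕ) where
  branch : Fin h × Fin h → Finset V
  nonempty : ∀ w, (branch w).Nonempty
  pairwise_disjoint : ∀ w w', w ≠ w' → Disjoint (branch w) (branch w')
  connected : ∀ w, (G.induce (↑(branch w) : Set V)).Connected
  adj : ∀ w w', (gridGraph h).Adj w w' →
    ∃ a ∈ branch w, ∃ b ∈ branch w', G.Adj a b

/-- `S` is an interface of the grid minor `gm`: it consists of one representative from
the branch set of every other (even-indexed) vertex of the first row of the grid. -/
def IsInterface {V : Type} [DecidableEq V] {G : SimpleGraph V} {h : ℕ}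
    (gm : GridMinor G h) (S : Finset V) : Prop :=
  ∃ rep : Fin h → V,
    (∀ j : Fin h,
      rep j ∈ gm.branch (⟨0, Nat.lt_of_le_of_lt (Nat.zero_le _) j.isLt⟩, j)) ∧
    S = (Finset.univ.filter (fun j : Fin h => (j : ℕ) % 2 = 0)).image rep

set_option linter.unusedSectionVars false

namespace ReachGrid

section Menger

open scoped Classical

variable {V : Type} [Fintype V] {G : SimpleGraph V}

/-- The number of signed traversals of a dart by a walk. -/
noncomputable def walkFlow {u v : V} (p : G.Walk u v) (d : G.Dart) : ℤ :=
  (p.darts.count d : ℤ) - (p.darts.count d.symm : ℤ)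

/-- The net outflow of a function on darts at a vertex. -/
noncomputable def outflow (F : G.Dart → ℤ) (v : V) : ℤ :=
  ∑ d : G.Dart with d.fst = v, F d

theorem walkFlow_symm {u v : V} (p : G.Walk u v) (d : G.Dart) :
    walkFlow p d.symm = - walkFlow p d := by
  simp [walkFlow]

theorem outflow_walkFlow {u v : V} (p : G.Walk u v) (x : V) :
    outflow (walkFlow p) x = (if x = u then 1 else 0) - (if x = v then 1 else 0) := by
  induction p with
  | nil => simp [outflow, walkFlow]
  | @cons a b c h p ih =>
    have key : outflow (walkFlow (SimpleGraph.Walk.cons h p)) x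
        = outflow (walkFlow p) x
          + ∑ d : G.Dart with d.fst = x,
            ((if d = ⟨(a, b), h⟩ then (1 : ℤ) else 0)
              - (if d = ⟨(b, a), h.symm⟩ then 1 else 0)) := by
      rw [outflow, outflow, ← Finset.sum_add_distrib]
      refine Finset.sum_congr rfl fun d _ => ?_
      have h2 : ((⟨(a, b), h⟩ : G.Dart) = d.symm) ↔ d = ⟨(b, a), h.symm⟩ := by
        constructor
        · intro h'
          have := congrArg SimpleGraph.Dart.symm h'
          rw [SimpleGraph.Dart.symm_symm] at this
          exact this.symm
        · rintro rfl; rfl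
      simp only [walkFlow, SimpleGraph.Walk.darts_cons, List.count_cons, beq_iff_eq, h2]
      simp only [eq_comm (a := (⟨(a, b), h⟩ : G.Dart))]
      push_cast
      ring
    rw [key, ih, Finset.sum_sub_distrib, Finset.sum_ite_eq', Finset.sum_ite_eq']
    simp only [Finset.mem_filter, Finset.mem_univ, true_and, eq_comm (a := x)]
    ring

theorem walkFlow_of_isPath {u v : V} {p : G.Walk u v} (hp : p.IsPath) (d : G.Dart) :
    walkFlow p d = if d ∈ p.darts then 1 else if d.symm ∈ p.darts then -1 else 0 := by
  have hn : (p.darts.map SimpleGraph.Dart.edge).Nodup := hp.isTrail.edges_nodup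
  have hd : p.darts.Nodup := List.Nodup.of_map _ hn
  have hboth : d ∈ p.darts → d.symm ∉ p.darts := by
    intro h1 h2
    exact d.symm_ne.symm (List.inj_on_of_nodup_map hn h1 h2 (by simp))
  unfold walkFlow
  split_ifs with h1 h2
  · rw [List.count_eq_one_of_mem hd h1, List.count_eq_zero_of_not_mem (hboth h1)]; rfl
  · rw [List.count_eq_one_of_mem hd h2, List.count_eq_zero_of_not_mem h1]; rfl
  · rw [List.count_eq_zero_of_not_mem h2, List.count_eq_zero_of_not_mem h1]; rfl

theorem exists_path_of_reflTransGen (P : G.Dart → Prop) {u v : V}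
    (h : Relation.ReflTransGen (fun a b => ∃ d : G.Dart, d.fst = a ∧ d.snd = b ∧ P d) u v) :
    ∃ p : G.Walk u v, p.IsPath ∧ ∀ d ∈ p.darts, P d := by
  have : ∃ p : G.Walk u v, ∀ d ∈ p.darts, P d := by
    induction h with
    | refl => exact ⟨.nil, by simp⟩
    | tail _ hbc ih =>
      obtain ⟨p, hp⟩ := ih
      obtain ⟨d, rfl, rfl, hd⟩ := hbc
      refine ⟨p.concat d.adj, fun e he => ?_⟩
      rw [SimpleGraph.Walk.darts_concat, List.concat_eq_append, List.mem_append,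
        List.mem_singleton] at he
      rcases he with he | rfl
      · exact hp _ he
      · exact hd
  obtain ⟨p, hp⟩ := this
  exact ⟨p.bypass, p.bypass_isPath, fun d hd => hp d (p.darts_bypass_subset_darts hd)⟩

theorem sum_outflow {F : G.Dart → ℤ} (hF : ∀ d, F d.symm = - F d) (A : Finset V) :
    ∑ v ∈ A, outflow F v = ∑ d : G.Dart with d.fst ∈ A ∧ d.snd ∉ A, F d := by
  have h1 : ∑ v ∈ A, outflow F v = ∑ d : G.Dart with d.fst ∈ A, F d := by
    rw [← Finset.sum_fiberwise_of_maps_to (s := univ.filter fun d : G.Dart => d.fst ∈ A)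
      (t := A) (g := fun d => d.fst) (by simp)]
    refine Finset.sum_congr rfl fun v hv => ?_
    rw [outflow, Finset.filter_filter]
    refine Finset.sum_congr ?_ fun _ _ => rfl
    ext d
    simp only [Finset.mem_filter, Finset.mem_univ, true_and]
    constructor
    · rintro rfl; exact ⟨hv, rfl⟩
    · exact fun h => h.2
  have h2 : ∑ d : G.Dart with d.fst ∈ A ∧ d.snd ∈ A, F d = 0 := by
    have : ∑ d : G.Dart with d.fst ∈ A ∧ d.snd ∈ A, F d
        = ∑ d : G.Dart with d.fst ∈ A ∧ d.snd ∈ A, - F d := by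
      refine Finset.sum_bij (fun d _ => d.symm) ?_ ?_ ?_ ?_
      · intro d hd
        simp only [Finset.mem_filter, Finset.mem_univ, true_and] at hd ⊢
        exact ⟨hd.2, hd.1⟩
      · intro a _ b _ h
        exact SimpleGraph.Dart.symm_involutive.injective h
      · intro d hd
        simp only [Finset.mem_filter, Finset.mem_univ, true_and] at hd
        refine ⟨d.symm, ?_, by simp⟩
        simp only [Finset.mem_filter, Finset.mem_univ, true_and]
        exact ⟨hd.2, hd.1⟩
      · intro d _
        rw [hF]; ring
    rw [Finset.sum_neg_distrib] at this
    omega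
  rw [h1, ← Finset.sum_filter_add_sum_filter_not _ (fun d : G.Dart => d.snd ∈ A),
    Finset.filter_filter, Finset.filter_filter, h2, zero_add]

/-- An integral flow with capacities one from the vertices of `X` to those of `S`. -/
structure UnitFlow (G : SimpleGraph V) (X S : Finset V) where
  val : G.Dart → ℤ
  symm : ∀ d, val d.symm = - val d
  le_one : ∀ d, val d ≤ 1
  out : ∀ v, outflow val v = (if v ∈ X then 1 else 0) - (if v ∈ S then 1 else 0)

theorem UnitFlow.sum_out {X S : Finset V} (F : UnitFlow G X S) (A : Finset V) :
    ((X ∩ A).card : ℤ) - (S ∩ A).card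
      = ∑ d : G.Dart with d.fst ∈ A ∧ d.snd ∉ A, F.val d := by
  rw [← sum_outflow F.symm, Finset.sum_congr rfl fun v _ => F.out v,
    Finset.sum_sub_distrib]
  simp only [Finset.sum_boole, Finset.filter_mem_eq_inter, Finset.inter_comm]

theorem outflow_add (F F' : G.Dart → ℤ) (v : V) :
    outflow (F + F') v = outflow F v + outflow F' v := by
  simp [outflow, Finset.sum_add_distrib]

theorem outflow_sub (F F' : G.Dart → ℤ) (v : V) :
    outflow (F - F') v = outflow F v - outflow F' v := by
  simp [outflow, Finset.sum_sub_distrib]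

/-- A unit flow decomposes into edge-disjoint walks. -/
theorem UnitFlow.exists_walks (n : ℕ) : ∀ {X S : Finset V} (F : UnitFlow G X S), X.card = n →
    ∃ W : ∀ v : V, Σ u, G.Walk v u, (∀ x ∈ X, (W x).1 ∈ S) ∧
      (∀ x ∈ X, ∀ y ∈ X, (W x).1 = (W y).1 → x = y) ∧
      ∀ d : G.Dart, (∑ x ∈ X, (W x).2.edges.count d.edge) ≤ if F.val d = 0 then 0 else 1 := by
  induction n with
  | zero =>
    intro X S F hX
    obtain rfl : X = ∅ := Finset.card_eq_zero.mp hX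
    exact ⟨fun v => ⟨v, .nil⟩, by simp⟩
  | succ n ih =>
    intro X S F hX
    obtain ⟨x, hx⟩ : X.Nonempty := Finset.card_pos.mp (by omega)
    let R := fun a b => ∃ d : G.Dart, d.fst = a ∧ d.snd = b ∧ F.val d = 1
    let A : Finset V := univ.filter fun v => Relation.ReflTransGen R x v
    have hA : ∀ v, v ∈ A ↔ Relation.ReflTransGen R x v := by simp [A]
    obtain ⟨s, hs, hsA⟩ : ∃ s ∈ S, s ∈ A := by
      by_contra! hcon
      have h1 : (S ∩ A) = ∅ := by
        ext v; simp only [Finset.mem_inter, Finset.notMem_empty, iff_false, not_and]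
        exact hcon v
      have h2 := F.sum_out A
      have h3 : 0 < (X ∩ A).card :=
        Finset.card_pos.mpr ⟨x, Finset.mem_inter.mpr ⟨hx, (hA x).2 .refl⟩⟩
      have h4 : ∑ d : G.Dart with d.fst ∈ A ∧ d.snd ∉ A, F.val d ≤ 0 := by
        refine Finset.sum_nonpos fun d hd => ?_
        simp only [Finset.mem_filter, Finset.mem_univ, true_and] at hd
        by_contra hpos
        refine hd.2 ((hA _).2 (((hA _).1 hd.1).tail ⟨d, rfl, rfl, ?_⟩))
        have := F.le_one d
        omega
      rw [h1, Finset.card_empty] at h2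
      omega
    obtain ⟨p, hp, hpd⟩ := exists_path_of_reflTransGen _ ((hA s).1 hsA)
    have hval : ∀ d, F.val d - walkFlow p d =
        if d ∈ p.darts ∨ d.symm ∈ p.darts then 0 else F.val d := by
      intro d
      rw [walkFlow_of_isPath hp]
      by_cases h1 : d ∈ p.darts
      · simp [h1, hpd d h1]
      · by_cases h2 : d.symm ∈ p.darts
        · have := hpd _ h2
          rw [F.symm] at this
          simp [h1, h2]; omega
        · simp [h1, h2]
    let F' : UnitFlow G (X.erase x) (S.erase s) :=
      { val := F.val - walkFlow p
        symm := fun d => by simp only [Pi.sub_apply, F.symm, walkFlow_symm]; ring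
        le_one := fun d => by
          have := F.le_one d
          simp only [Pi.sub_apply]
          rw [hval]; split_ifs <;> omega
        out := fun v => by
          rw [outflow_sub, F.out, outflow_walkFlow]
          simp only [Finset.mem_erase]
          by_cases h1 : v = x <;> by_cases h2 : v = s
          · subst h1; subst h2; simp [hx, hs]
          · subst h1; simp [hx, h2]
          · subst h2; simp [hs, h1]
          · simp [h1, h2] }
    obtain ⟨W, hW1, hW2, hW3⟩ := ih F' (by rw [Finset.card_erase_of_mem hx]; omega)
    have hWne : ∀ y ∈ X, y ≠ x → Function.update W x ⟨s, p⟩ y = W y := fun y _ hy => by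
      rw [Function.update_of_ne hy]
    refine ⟨Function.update W x ⟨s, p⟩, ?_, ?_, ?_⟩
    · intro y hy
      by_cases hyx : y = x
      · subst hyx; simpa using hs
      · rw [hWne y hy hyx]
        exact Finset.mem_of_mem_erase (hW1 y (Finset.mem_erase.mpr ⟨hyx, hy⟩))
    · intro y hy z hz hyz
      by_cases hyx : y = x <;> by_cases hzx : z = x
      · rw [hyx, hzx]
      · exfalso
        rw [hWne z hz hzx] at hyz
        subst hyx
        simp only [Function.update_self] at hyz
        exact Finset.ne_of_mem_erase (hW1 z (Finset.mem_erase.mpr ⟨hzx, hz⟩)) hyz.symm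
      · exfalso
        rw [hWne y hy hyx] at hyz
        subst hzx
        simp only [Function.update_self] at hyz
        exact Finset.ne_of_mem_erase (hW1 y (Finset.mem_erase.mpr ⟨hyx, hy⟩)) hyz
      · rw [hWne y hy hyx, hWne z hz hzx] at hyz
        exact hW2 y (Finset.mem_erase.mpr ⟨hyx, hy⟩) z (Finset.mem_erase.mpr ⟨hzx, hz⟩) hyz
    · intro d
      rw [← Finset.add_sum_erase _ _ hx, Function.update_self,
        Finset.sum_congr rfl fun y hy => by
          rw [hWne y (Finset.mem_of_mem_erase hy) (Finset.ne_of_mem_erase hy)]]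
      have h3 := hW3 d
      have hmem : d.edge ∈ p.edges ↔ d ∈ p.darts ∨ d.symm ∈ p.darts := by
        unfold SimpleGraph.Walk.edges
        rw [List.mem_map]
        constructor
        · rintro ⟨e, he, hed⟩
          rw [SimpleGraph.dart_edge_eq_iff] at hed
          rcases hed with rfl | rfl
          · exact Or.inl he
          · exact Or.inr he
        · rintro (h | h)
          · exact ⟨d, h, rfl⟩
          · exact ⟨_, h, d.edge_symm⟩
      have hF' : F'.val d = if d ∈ p.darts ∨ d.symm ∈ p.darts then 0 else F.val d := hval d
      rw [hF'] at h3
      by_cases hd : d.edge ∈ p.edges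
      · rw [List.count_eq_one_of_mem hp.isTrail.edges_nodup hd]
        have hd' := hmem.1 hd
        have hne : F.val d ≠ 0 := by
          rcases hd' with h | h
          · rw [hpd _ h]; decide
          · have := hpd _ h
            rw [F.symm] at this; omega
        simp only [hd', if_true] at h3
        rw [if_neg hne]
        omega
      · rw [List.count_eq_zero_of_not_mem hd]
        have hd' := fun h => hd (hmem.2 h)
        rw [if_neg hd'] at h3
        omega

/-- The common vertices of the two ends of a unit flow can be dropped. -/
def UnitFlow.sdiff {X S : Finset V} (F : UnitFlow G X S) : UnitFlow G (X \ S) (S \ X) where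
  val := F.val
  symm := F.symm
  le_one := F.le_one
  out v := by
    rw [F.out]
    by_cases h1 : v ∈ X <;> by_cases h2 : v ∈ S <;> simp [h1, h2]

theorem routable_of_unitFlow {X S : Finset V} (F : UnitFlow G X S) : Routable G X S := by
  obtain ⟨W, h1, h2, h3⟩ := F.sdiff.exists_walks _ rfl
  let W' : ∀ v : V, Σ u, G.Walk v u := fun v => if v ∈ S then ⟨v, .nil⟩ else W v
  have hS : ∀ v ∈ S, W' v = ⟨v, .nil⟩ := fun v hv => if_pos hv
  have hN : ∀ v ∉ S, W' v = W v := fun v hv => if_neg hv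
  have hW1 : ∀ x ∈ X, x ∉ S → (W' x).1 ∈ S \ X := fun x hx hxS => by
    rw [hN x hxS]; exact h1 x (Finset.mem_sdiff.mpr ⟨hx, hxS⟩)
  refine ⟨fun v => (W' v).1, fun v _ => (W' v).2, ?_, ?_, ?_, ?_⟩
  · intro x hx
    by_cases hxS : x ∈ S
    · simp only [hS x hxS, hxS]
    · exact (Finset.mem_sdiff.mp (hW1 x hx hxS)).1
  · intro x hx y hy h
    have hx : x ∈ X := hx
    have hy : y ∈ X := hy
    simp only at h
    by_cases hxS : x ∈ S <;> by_cases hyS : y ∈ S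
    · simpa [hS x hxS, hS y hyS] using h
    · have := hW1 y hy hyS
      rw [← h, hS x hxS] at this
      exact absurd hx (Finset.mem_sdiff.mp this).2
    · have := hW1 x hx hxS
      rw [h, hS y hyS] at this
      exact absurd hy (Finset.mem_sdiff.mp this).2
    · rw [hN x hxS, hN y hyS] at h
      exact h2 x (Finset.mem_sdiff.mpr ⟨hx, hxS⟩) y (Finset.mem_sdiff.mpr ⟨hy, hyS⟩) h
  · intro x hx y hy h
    simp only at h
    by_cases hxS : x ∈ S
    · simpa [hS x hxS] using h
    · have := hW1 x hx hxS
      rw [h] at this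
      exact absurd hy (Finset.mem_sdiff.mp this).2
  intro e
  have hsum : ∑ a ∈ X.attach, ecount (W' a.1).2.edges e
      = ∑ x ∈ X \ S, (W x).2.edges.count e := by
    have : ∀ x, ecount (W' x).2.edges e = (W' x).2.edges.count e := fun x => by
      unfold ecount
      congr!
    rw [Finset.sum_attach X fun x => ecount (W' x).2.edges e,
      ← Finset.sum_inter_add_sum_sdiff X S,
      Finset.sum_eq_zero (s := X ∩ S), zero_add]
    · refine Finset.sum_congr rfl fun x hx => ?_
      rw [this, hN x (Finset.mem_sdiff.mp hx).2]
    · intro x hx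
      rw [this, hS x (Finset.mem_inter.mp hx).2]
      rfl
  rw [hsum]
  by_cases he : e ∈ G.edgeSet
  · induction e with
    | _ a b =>
      have := h3 ⟨(a, b), he⟩
      refine this.trans ?_
      split_ifs <;> simp
  · rw [Finset.sum_eq_zero]
    · exact Nat.zero_le _
    · intro x _
      exact List.count_eq_zero_of_not_mem fun h => he ((W x).2.edges_subset_edgeSet h)

theorem routable_mono_right {X S S' : Finset V} (h : Routable G X S) (hS : S ⊆ S') :
    Routable G X S' := by
  obtain ⟨f, P, h1, h2⟩ := h
  exact ⟨f, P, fun s hs => hS (h1 s hs), h2⟩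

/-- Menger's theorem for edge-disjoint paths. -/
theorem exists_routable (X S : Finset V) (r : ℕ)
    (h : ∀ Q : Finset V, r ≤ (X ∩ Q).card +
      (univ.filter fun d : G.Dart => d.fst ∉ Q ∧ d.snd ∈ Q).card + (S \ Q).card) :
    ∃ X' ⊆ X, r ≤ X'.card ∧ Routable G X' S := by
  suffices ∀ n ≤ r, ∃ X' ⊆ X, ∃ S' ⊆ S, X'.card = n ∧ Nonempty (UnitFlow G X' S') by
    obtain ⟨X', hX', S', hS', hc, ⟨F⟩⟩ := this r le_rfl
    exact ⟨X', hX', hc.ge, routable_mono_right (routable_of_unitFlow F) hS'⟩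
  intro n
  induction n with
  | zero =>
    intro _
    refine ⟨∅, by simp, ∅, by simp, rfl, ⟨⟨0, by simp, by simp, by simp [outflow]⟩⟩⟩
  | succ n ih =>
    intro hn
    obtain ⟨X', hX', S', hS', hc, ⟨F⟩⟩ := ih (by omega)
    let R := fun a b => ∃ d : G.Dart, d.fst = a ∧ d.snd = b ∧ F.val d ≤ 0
    let A : Finset V := univ.filter fun v => ∃ x ∈ X \ X', Relation.ReflTransGen R x v
    have hA : ∀ v, v ∈ A ↔ ∃ x ∈ X \ X', Relation.ReflTransGen R x v := by simp [A]
    obtain ⟨s, hs, hsA⟩ : ∃ s ∈ S \ S', s ∈ A := by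
      by_contra! hcon
      have h1 := h Aᶜ
      have h2 := F.sum_out A
      have h4 : ∑ d : G.Dart with d.fst ∈ A ∧ d.snd ∉ A, F.val d
          = (univ.filter fun d : G.Dart => d.fst ∈ A ∧ d.snd ∉ A).card := by
        rw [Finset.card_eq_sum_ones]
        push_cast
        refine Finset.sum_congr rfl fun d hd => ?_
        simp only [Finset.mem_filter, Finset.mem_univ, true_and] at hd
        by_contra hne
        have := F.le_one d
        obtain ⟨x, hx, hxr⟩ := (hA _).1 hd.1
        exact hd.2 ((hA _).2 ⟨x, hx, hxr.tail ⟨d, rfl, rfl, by omega⟩⟩)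
      have h5 : (univ.filter fun d : G.Dart => d.fst ∉ Aᶜ ∧ d.snd ∈ Aᶜ)
          = univ.filter fun d : G.Dart => d.fst ∈ A ∧ d.snd ∉ A := by
        ext d; simp
      have h6 : X ∩ Aᶜ ⊆ X' \ A := by
        intro v hv
        simp only [Finset.mem_inter, Finset.mem_compl, Finset.mem_sdiff] at hv ⊢
        refine ⟨?_, hv.2⟩
        by_contra hv'
        exact hv.2 ((hA _).2 ⟨v, Finset.mem_sdiff.mpr ⟨hv.1, hv'⟩, .refl⟩)
      have h7 : S \ Aᶜ ⊆ S' ∩ A := by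
        intro v hv
        simp only [Finset.mem_inter, Finset.mem_compl, Finset.mem_sdiff, not_not] at hv ⊢
        refine ⟨?_, hv.2⟩
        by_contra hv'
        exact hcon v (Finset.mem_sdiff.mpr ⟨hv.1, hv'⟩) hv.2
      have h8 := Finset.card_le_card h6
      have h9 := Finset.card_le_card h7
      have h10 := Finset.card_sdiff_add_card_inter X' A
      rw [h5] at h1
      rw [h4] at h2
      omega
    obtain ⟨x, hx, hxs⟩ := (hA s).1 hsA
    obtain ⟨p, hp, hpd⟩ := exists_path_of_reflTransGen _ hxs
    rw [Finset.mem_sdiff] at hx hs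
    refine ⟨insert x X', Finset.insert_subset hx.1 hX', insert s S', Finset.insert_subset hs.1 hS',
      by rw [Finset.card_insert_of_notMem hx.2, hc], ⟨⟨F.val + walkFlow p, ?_, ?_, ?_⟩⟩⟩
    · intro d; simp only [Pi.add_apply, F.symm, walkFlow_symm]; ring
    · intro d
      have h1 := F.le_one d
      rw [Pi.add_apply, walkFlow_of_isPath hp]
      split_ifs with h2
      · have := hpd d h2; omega
      · omega
      · omega
    · intro v
      rw [outflow_add, F.out, outflow_walkFlow]
      by_cases h1 : v = x <;> by_cases h2 : v = s
      · subst h1; subst h2; simp [hx.2, hs.2]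
      · subst h1; simp [hx.2, h2]; ring
      · subst h2; simp [hs.2, h1]; ring
      · simp [h1, h2]

end Menger

section FirstReturn

open scoped Classical

variable {α : Type} [Finite α] (σ : Equiv.Perm α) (S : Set α)

theorem exists_pow_mem (d : S) : ∃ n : ℕ, 1 ≤ n ∧ (σ ^ n) d.1 ∈ S :=
  ⟨orderOf σ, orderOf_pos σ, by rw [pow_orderOf_eq_one]; exact d.2⟩

/-- The first positive time at which the orbit returns to `S`. -/
noncomputable def retTime (d : S) : ℕ := Nat.find (exists_pow_mem σ S d)

theorem retTime_pos (d : S) : 1 ≤ retTime σ S d := (Nat.find_spec (exists_pow_mem σ S d)).1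

theorem pow_retTime_mem (d : S) : (σ ^ retTime σ S d) d.1 ∈ S :=
  (Nat.find_spec (exists_pow_mem σ S d)).2

theorem notMem_of_lt_retTime (d : S) {n : ℕ} (h1 : 1 ≤ n) (h2 : n < retTime σ S d) :
    (σ ^ n) d.1 ∉ S := fun h => Nat.find_min (exists_pow_mem σ S d) h2 ⟨h1, h⟩

theorem firstReturn_injective :
    Function.Injective fun d : S => (⟨(σ ^ retTime σ S d) d.1, pow_retTime_mem σ S d⟩ : S) := by
  have key : ∀ a b : S, retTime σ S a ≤ retTime σ S b →
      (σ ^ retTime σ S a) a.1 = (σ ^ retTime σ S b) b.1 → a = b := by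
    intro a b hle h
    obtain ⟨k, hk⟩ := Nat.exists_eq_add_of_le hle
    rw [hk, pow_add, Equiv.Perm.mul_apply] at h
    have h := (σ ^ retTime σ S a).injective h
    by_contra hne
    have hk0 : k ≠ 0 := by
      rintro rfl
      exact hne (Subtype.ext (by simpa using h))
    have := retTime_pos σ S a
    exact notMem_of_lt_retTime σ S b (n := k) (by omega) (by omega) (h ▸ a.2)
  intro a b h
  have h := congrArg Subtype.val h
  rcases le_total (retTime σ S a) (retTime σ S b) with hle | hle
  · exact key a b hle h
  · exact (key b a hle h.symm).symm

/-- The permutation of `S` induced by first returns of `σ`. -/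
noncomputable def firstReturn : Equiv.Perm S :=
  Equiv.ofBijective _ (Finite.injective_iff_bijective.mp (firstReturn_injective σ S))

theorem firstReturn_val (d : S) : (firstReturn σ S d).1 = (σ ^ retTime σ S d) d.1 := rfl

theorem firstReturn_sameCycle {d e : S} (h : σ.SameCycle d.1 e.1) :
    (firstReturn σ S).SameCycle d e := by
  obtain ⟨n, hn⟩ := h.exists_nat_pow_eq
  induction n using Nat.strong_induction_on generalizing d with
  | _ n ih =>
    rcases Nat.eq_zero_or_pos n with rfl | hpos
    · have : d = e := Subtype.ext (by simpa using hn)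
      rw [this]
    · have hle : retTime σ S d ≤ n := by
        by_contra hlt
        exact notMem_of_lt_retTime σ S d hpos (by omega) (hn ▸ e.2)
      have h1 := retTime_pos σ S d
      have h2 : (σ ^ (n - retTime σ S d)) (firstReturn σ S d).1 = e.1 := by
        rw [firstReturn_val, ← Equiv.Perm.mul_apply, ← pow_add, Nat.sub_add_cancel hle, hn]
      have h3 := ih _ (by omega) (d := firstReturn σ S d) 
        ⟨((n - retTime σ S d : ℕ) : ℤ), by rw [zpow_natCast]; exact h2⟩ h2
      exact (Equiv.Perm.sameCycle_apply_left.mp h3)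

end FirstReturn

/-- A combinatorial map: a graph with vertex set `V` and darts `D` together with a cyclic
order of the darts at each vertex. -/
structure CMap (V D : Type) where
  tail : D → V
  rev : D → D
  rot : Equiv.Perm D
  rev_rev : ∀ d, rev (rev d) = d
  rev_ne : ∀ d, rev d ≠ d
  tail_rot : ∀ d, tail (rot d) = tail d
  cyc : ∀ d e, tail d = tail e → rot.SameCycle d e

namespace CMap

open scoped Classical

variable {V D : Type} (M : CMap V D)

/-- The end of a dart. -/
def head (d : D) : V := M.tail (M.rev d)

/-- Dart reversal as a permutation. -/
def revPerm : Equiv.Perm D := ⟨M.rev, M.rev, M.rev_rev, M.rev_rev⟩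

/-- The face permutation. -/
def phi : Equiv.Perm D := M.rot * M.revPerm

/-- The faces. -/
def Face : Type := Quotient (permOrbitSetoid M.phi)

/-- The face containing a dart. -/
def face (d : D) : M.Face := Quotient.mk _ d

theorem rev_injective : Function.Injective M.rev := M.revPerm.injective

@[simp] theorem rev_rev' (d : D) : M.rev (M.rev d) = d := M.rev_rev d

@[simp] theorem head_rev (d : D) : M.head (M.rev d) = M.tail d := by simp [head]

theorem tail_rev (d : D) : M.tail (M.rev d) = M.head d := rfl

theorem phi_apply (d : D) : M.phi d = M.rot (M.rev d) := rfl

@[simp] theorem tail_phi (d : D) : M.tail (M.phi d) = M.head d := M.tail_rot _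

@[simp] theorem face_phi (d : D) : M.face (M.phi d) = M.face d :=
  Quotient.sound (Equiv.Perm.SameCycle.refl M.phi d |>.apply_left)

theorem face_rot (d : D) : M.face (M.rot d) = M.face (M.rev d) := by
  rw [← M.face_phi (M.rev d), phi_apply, M.rev_rev]

theorem face_pow (n : ℕ) (d : D) : M.face ((M.phi ^ n) d) = M.face d := by
  induction n with
  | zero => rfl
  | succ n ih => rw [pow_succ', Equiv.Perm.mul_apply, face_phi, ih]

theorem face_eq_iff {d e : D} : M.face d = M.face e ↔ M.phi.SameCycle d e :=
  ⟨fun h => Quotient.exact h, fun h => Quotient.sound h⟩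

theorem face_surjective : Function.Surjective M.face := Quotient.mk_surjective

variable [Fintype D]

noncomputable instance : Fintype M.Face := Quotient.fintype _

theorem exists_pow_of_face_eq {d e : D} (h : M.face d = M.face e) :
    ∃ n : ℕ, (M.phi ^ n) d = e := (M.face_eq_iff.mp h).exists_nat_pow_eq

/-- The coboundary of a vertex function. -/
def cob (t : V → ZMod 2) (d : D) : ZMod 2 := t (M.tail d) + t (M.head d)

/-- The sum of a cochain around a face. -/
noncomputable def faceSum (z : D → ZMod 2) (f : M.Face) : ZMod 2 :=
  ∑ d with M.face d = f, z d

/-- The symmetric cochains with zero sum around every face. -/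
structure Closed (z : D → ZMod 2) : Prop where
  symm : ∀ d, z (M.rev d) = z d
  sum_face : ∀ f, M.faceSum z f = 0

theorem cob_symm (t : V → ZMod 2) (d : D) : M.cob t (M.rev d) = M.cob t d := by
  simp [cob, tail_rev, add_comm]

theorem sum_face_phi {N : Type} [AddCommMonoid N] (z : D → N) (f : M.Face) :
    ∑ d with M.face d = f, z (M.phi d) = ∑ d with M.face d = f, z d := by
  refine Finset.sum_bij (fun d _ => M.phi d) ?_ ?_ ?_ ?_
  · intro d hd; simpa using hd
  · intro a _ b _ h; exact M.phi.injective h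
  · intro d hd
    refine ⟨M.phi.symm d, ?_, by simp⟩
    have := M.face_phi (M.phi.symm d)
    rw [Equiv.apply_symm_apply] at this
    simpa [← this] using hd
  · intros; rfl

theorem closed_cob (t : V → ZMod 2) : M.Closed (M.cob t) := by
  refine ⟨M.cob_symm t, fun f => ?_⟩
  have h := M.sum_face_phi (fun d => t (M.tail d)) f
  simp only [tail_phi] at h
  simp only [faceSum, cob, Finset.sum_add_distrib]
  rw [h]
  exact CharTwo.add_self_eq_zero _

theorem Closed.add {M : CMap V D} {z z' : D → ZMod 2} (h : M.Closed z) (h' : M.Closed z') :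
    M.Closed (z + z') := by
  refine ⟨fun d => by simp [h.symm, h'.symm], fun f => ?_⟩
  have h1 := h.sum_face f
  have h2 := h'.sum_face f
  simp only [faceSum] at *
  simp only [Pi.add_apply, Finset.sum_add_distrib, h1, h2, add_zero]

end CMap

section LinearAlgebra

open scoped Classical

/-- Functions constant on the fibres of a map span a space of dimension at most the size of
the target. -/
theorem finrank_le_card_of_const {A B : Type} [Fintype A] [Fintype B] (c : A → B)
    (W : Submodule (ZMod 2) (A → ZMod 2)) (hW : ∀ s ∈ W, ∀ a a', c a = c a' → s a = s a') :
    Module.finrank (ZMod 2) W ≤ Fintype.card B := by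
  have h1 : W ≤ LinearMap.range (LinearMap.funLeft (ZMod 2) (ZMod 2) c) := by
    intro s hs
    refine ⟨fun b => if h : ∃ a, c a = b then s h.choose else 0, ?_⟩
    ext a
    have h : ∃ a', c a' = c a := ⟨a, rfl⟩
    simp only [LinearMap.funLeft_apply, h, dif_pos]
    exact hW s hs _ _ h.choose_spec
  refine (Submodule.finrank_mono h1).trans ?_
  refine (LinearMap.finrank_range_le _).trans ?_
  simp

/-- A function with zero sum on each fibre is a combination of differences within fibres. -/
theorem mem_of_sum_fiber_eq_zero {F C : Type} [Fintype F] (κ : F → C)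
    (W : Submodule (ZMod 2) (F → ZMod 2))
    (hW : ∀ f f', κ f = κ f' → Pi.single f 1 + Pi.single f' 1 ∈ W)
    (s : F → ZMod 2) (hs : ∀ c, ∑ f with κ f = c, s f = 0) : s ∈ W := by
  let rep : F → F := fun f => (⟨f, rfl⟩ : ∃ f', κ f' = κ f).choose
  have hrep : ∀ f, κ (rep f) = κ f := fun f => (⟨f, rfl⟩ : ∃ f', κ f' = κ f).choose_spec
  have hrep' : ∀ f f', κ f = κ f' → rep f = rep f' := by
    intro f f' h
    simp only [rep, h]
  have h1 : s = ∑ f, s f • (Pi.single f 1 + Pi.single (rep f) 1 : F → ZMod 2) := by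
    have h2 : ∑ f, s f • (Pi.single (rep f) 1 : F → ZMod 2) = 0 := by
      ext f0
      simp only [Finset.sum_apply, Pi.smul_apply, Pi.single_apply, smul_eq_mul, mul_ite, mul_one,
        mul_zero, Pi.zero_apply, ← Finset.sum_filter]
      by_cases h : ∃ f, rep f = f0
      · obtain ⟨f, rfl⟩ := h
        rw [← hs (κ f)]
        refine Finset.sum_congr ?_ fun _ _ => rfl
        ext f'
        simp only [Finset.mem_filter, Finset.mem_univ, true_and]
        constructor
        · intro h; rw [← hrep f, h, hrep]
        · intro h; exact hrep' _ _ h.symm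
      · rw [Finset.filter_false_of_mem, Finset.sum_empty]
        intro f _ hf
        exact h ⟨f, hf.symm⟩
    simp only [smul_add, Finset.sum_add_distrib, h2, add_zero]
    ext f0
    simp [Finset.sum_apply, Pi.single_apply]
  rw [h1]
  exact Submodule.sum_mem _ fun f _ => W.smul_mem _ (hW _ _ (hrep f).symm)

/-- The functions with zero sum on each fibre have codimension at most the size of the target. -/
theorem card_le_finrank_add_card {F C : Type} [Fintype F] [Fintype C] (κ : F → C)
    (W : Submodule (ZMod 2) (F → ZMod 2))
    (hW : ∀ f f', κ f = κ f' → Pi.single f 1 + Pi.single f' 1 ∈ W) :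
    Fintype.card F ≤ Module.finrank (ZMod 2) W + Fintype.card C := by
  let cls : (F → ZMod 2) →ₗ[ZMod 2] (C → ZMod 2) :=
    { toFun := fun s c => ∑ f with κ f = c, s f
      map_add' := fun s s' => by ext c; simp [Finset.sum_add_distrib]
      map_smul' := fun a s => by ext c; simp [Finset.mul_sum] }
  have h1 : LinearMap.ker cls ≤ W := by
    intro s hs
    refine mem_of_sum_fiber_eq_zero κ W hW s fun c => ?_
    exact congrFun (LinearMap.mem_ker.mp hs) c
  have h2 := LinearMap.finrank_range_add_finrank_ker cls
  have h3 : Module.finrank (ZMod 2) (LinearMap.range cls) ≤ Fintype.card C := by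
    refine (Submodule.finrank_le _).trans ?_
    simp
  have h4 := Submodule.finrank_mono h1
  simp only [Module.finrank_fintype_fun_eq_card] at h2
  omega

end LinearAlgebra

namespace CMap

open scoped Classical

variable {V D : Type} (M : CMap V D) [Fintype D]

/-- The space of symmetric cochains. -/
def symSpace : Submodule (ZMod 2) (D → ZMod 2) where
  carrier := {z | ∀ d, z (M.rev d) = z d}
  add_mem' := fun h h' d => by simp [h d, h' d]
  zero_mem' := fun d => rfl
  smul_mem' := fun a z h d => by simp [h d]

/-- The coboundary as a linear map. -/
def cobMap : (V → ZMod 2) →ₗ[ZMod 2] (D → ZMod 2) where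
  toFun := M.cob
  map_add' := fun t t' => by ext d; simp only [cob, Pi.add_apply]; ring
  map_smul' := fun a t => by ext d; simp only [cob, Pi.smul_apply, smul_eq_mul, RingHom.id_apply]; ring

/-- The face sum as a linear map. -/
noncomputable def faceMap : (D → ZMod 2) →ₗ[ZMod 2] (M.Face → ZMod 2) where
  toFun := M.faceSum
  map_add' := fun z z' => by ext f; simp [faceSum, Finset.sum_add_distrib]
  map_smul' := fun a z => by ext f; simp [faceSum, Finset.mul_sum]

/-- The space of closed cochains. -/
noncomputable def closedSpace : Submodule (ZMod 2) (D → ZMod 2) :=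
  M.symSpace ⊓ LinearMap.ker M.faceMap

theorem mem_closedSpace {z : D → ZMod 2} : z ∈ M.closedSpace ↔ M.Closed z :=
  ⟨fun h => ⟨h.1, fun f => congrFun (LinearMap.mem_ker.mp h.2) f⟩,
    fun h => ⟨h.symm, LinearMap.mem_ker.mpr (funext h.sum_face)⟩⟩

/-- The indicator of the edge of a dart. -/
noncomputable def edgeInd (a : D) (d : D) : ZMod 2 := if d = a ∨ d = M.rev a then 1 else 0

theorem edgeInd_symm (a d : D) : M.edgeInd a (M.rev d) = M.edgeInd a d := by
  have h1 : M.rev d = a ↔ d = M.rev a :=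
    ⟨fun h => by rw [← h, M.rev_rev], fun h => by rw [h, M.rev_rev]⟩
  have h2 : M.rev d = M.rev a ↔ d = a := M.rev_injective.eq_iff
  simp only [edgeInd, h1, h2, or_comm]

theorem edgeInd_eq_add (a : D) :
    M.edgeInd a = fun d => (if d = a then 1 else 0) + (if d = M.rev a then 1 else 0) := by
  ext d
  have := M.rev_ne a
  by_cases h1 : d = a
  · subst h1; simp [edgeInd, this.symm]
  · simp [edgeInd, h1]

theorem faceSum_edgeInd (a : D) :
    M.faceSum (M.edgeInd a) = Pi.single (M.face a) 1 + Pi.single (M.face (M.rev a)) 1 := by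
  ext f
  rw [edgeInd_eq_add, faceSum, Finset.sum_add_distrib, Finset.sum_ite_eq', Finset.sum_ite_eq']
  simp [Pi.single_apply, eq_comm]

theorem single_add_single_mem {M : CMap V D} (R : D → Prop)
    (W : Submodule (ZMod 2) (M.Face → ZMod 2))
    (hW : ∀ d, R d → Pi.single (M.face d) 1 + Pi.single (M.face (M.rev d)) 1 ∈ W)
    {f f' : M.Face}
    (h : Relation.EqvGen (fun f f' => ∃ d, R d ∧ M.face d = f ∧ M.face (M.rev d) = f') f f') :
    Pi.single f 1 + Pi.single f' 1 ∈ W := by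
  induction h with
  | rel _ _ h => obtain ⟨d, hd, rfl, rfl⟩ := h; exact hW d hd
  | refl f =>
    have : (Pi.single f 1 + Pi.single f 1 : M.Face → ZMod 2) = 0 :=
      funext fun _ => CharTwo.add_self_eq_zero _
    rw [this]; exact W.zero_mem
  | symm _ _ _ ih => rwa [add_comm]
  | trans f1 f2 f3 _ _ ih1 ih2 =>
    have : (Pi.single f1 1 + Pi.single f3 1 : M.Face → ZMod 2)
        = (Pi.single f1 1 + Pi.single f2 1) + (Pi.single f2 1 + Pi.single f3 1) := by
      have : (Pi.single f2 1 + Pi.single f2 1 : M.Face → ZMod 2) = 0 :=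
      funext fun _ => CharTwo.add_self_eq_zero _
      rw [add_assoc, ← add_assoc (Pi.single f2 1), this, zero_add]
    rw [this]
    exact W.add_mem ih1 ih2

/-- Adjacency of vertices. -/
def Adj (u v : V) : Prop := ∃ d, M.tail d = u ∧ M.head d = v

theorem faceEqv_of_tail_eq {R : D → Prop} {d e : D} (h : M.tail d = M.tail e)
    (hR : ∀ a, M.tail a = M.tail d → R a) :
    Relation.EqvGen (fun f f' => ∃ d, R d ∧ M.face d = f ∧ M.face (M.rev d) = f')
      (M.face d) (M.face e) := by
  obtain ⟨n, rfl⟩ := (M.cyc d e h).exists_nat_pow_eq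
  clear h
  induction n with
  | zero => exact .refl _
  | succ n ih =>
    refine ih.trans _ _ _ (.rel _ _ ⟨(M.rot ^ n) d, hR _ ?_, rfl, ?_⟩)
    · clear ih
      induction n with
      | zero => rfl
      | succ n ih => rw [pow_succ', Equiv.Perm.mul_apply, M.tail_rot, ih]
    · rw [pow_succ', Equiv.Perm.mul_apply, face_rot]

theorem faceEqv_of_reach {u v : V} (h : Relation.ReflTransGen M.Adj u v) {d e : D}
    (hd : M.tail d = u) (he : M.tail e = v) :
    Relation.EqvGen (fun f f' => ∃ d, True ∧ M.face d = f ∧ M.face (M.rev d) = f')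
      (M.face d) (M.face e) := by
  induction h generalizing e with
  | refl => exact M.faceEqv_of_tail_eq (hd.trans he.symm) fun _ _ => trivial
  | tail _ hbc ih =>
    obtain ⟨a, ha1, ha2⟩ := hbc
    refine (ih ha1).trans _ _ _ (.trans _ _ _ (.rel _ _ ⟨a, trivial, rfl, rfl⟩) ?_)
    exact M.faceEqv_of_tail_eq (ha2.trans he.symm) fun _ _ => trivial

/-- The dimension of the first cohomology is bounded through Euler's formula. -/
theorem finrank_closedSpace_le [Fintype V] {E C : Type} [Fintype E] [Fintype C]
    (edge : D → E) (hedge : ∀ d e, edge d = edge e → e = d ∨ e = M.rev d)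
    (comp : V → C) (hcomp : ∀ u v, comp u = comp v ↔ Relation.ReflTransGen M.Adj u v) :
    Module.finrank (ZMod 2) M.closedSpace + Fintype.card V + Fintype.card M.Face ≤
      Module.finrank (ZMod 2) (LinearMap.range M.cobMap) + Fintype.card E
        + 2 * Fintype.card C := by
  have hsym : Module.finrank (ZMod 2) M.symSpace ≤ Fintype.card E := by
    refine finrank_le_card_of_const edge _ fun s hs a a' h => ?_
    rcases hedge a a' h with rfl | rfl
    · rfl
    · exact (hs a).symm
  have hcob := LinearMap.finrank_range_add_finrank_ker M.cobMap
  have hker : Module.finrank (ZMod 2) (LinearMap.ker M.cobMap) ≤ Fintype.card C := by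
    refine finrank_le_card_of_const comp _ fun t ht u v h => ?_
    have hadj : ∀ u v, M.Adj u v → t u = t v := by
      rintro _ _ ⟨d, rfl, rfl⟩
      have h1 := congrFun (LinearMap.mem_ker.mp ht) d
      exact CharTwo.add_eq_zero.mp h1
    have := (hcomp u v).mp h
    clear h
    induction this with
    | refl => rfl
    | tail _ h2 ih => exact ih.trans (hadj _ _ h2)
  let fm : M.symSpace →ₗ[ZMod 2] (M.Face → ZMod 2) := M.faceMap.comp M.symSpace.subtype
  have hfm := LinearMap.finrank_range_add_finrank_ker fm
  have hker' : Module.finrank (ZMod 2) (LinearMap.ker fm)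
      = Module.finrank (ZMod 2) M.closedSpace := by
    have h1 : LinearMap.ker fm = M.closedSpace.comap M.symSpace.subtype := by
      ext z
      simp [fm, closedSpace]
    rw [h1]
    exact (Submodule.comapSubtypeEquivOfLe inf_le_left).finrank_eq
  have hadjc : ∀ d, comp (M.tail d) = comp (M.head d) := fun d =>
    (hcomp _ _).mpr (.single ⟨d, rfl, rfl⟩)
  let κ : M.Face → C := fun f => comp (M.tail (M.face_surjective f).choose)
  have hκ : ∀ d, κ (M.face d) = comp (M.tail d) := by
    intro d
    have h := (M.face_surjective (M.face d)).choose_spec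
    obtain ⟨n, hn⟩ := M.exists_pow_of_face_eq h
    change comp (M.tail (M.face_surjective (M.face d)).choose) = _
    conv_rhs => rw [← hn]
    generalize (M.face_surjective (M.face d)).choose = a
    clear hn h
    induction n with
    | zero => rfl
    | succ n ih => rw [pow_succ', Equiv.Perm.mul_apply, tail_phi, ← hadjc, ih]
  have hrange : Fintype.card M.Face ≤
      Module.finrank (ZMod 2) (LinearMap.range fm) + Fintype.card C := by
    refine card_le_finrank_add_card κ _ fun f f' h => ?_
    refine single_add_single_mem (fun _ => True) _ (fun d _ => ?_) (?_ : Relation.EqvGen _ f f')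
    · refine ⟨⟨M.edgeInd d, fun e => M.edgeInd_symm d e⟩, ?_⟩
      exact M.faceSum_edgeInd d
    · obtain ⟨d, rfl⟩ := M.face_surjective f
      obtain ⟨e, rfl⟩ := M.face_surjective f'
      rw [hκ, hκ, hcomp] at h
      exact M.faceEqv_of_reach h rfl rfl
  rw [Module.finrank_fintype_fun_eq_card] at hcob
  omega

/-- The closed cochains which are coboundaries outside `F`. -/
noncomputable def cobOff (F : Finset D) : Submodule (ZMod 2) (D → ZMod 2) where
  carrier := {z | M.Closed z ∧ ∃ t, ∀ d ∉ F, z d = M.cob t d}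
  add_mem' := by
    rintro z z' ⟨h, t, ht⟩ ⟨h', t', ht'⟩
    refine ⟨h.add h', t + t', fun d hd => ?_⟩
    simp only [Pi.add_apply, ht d hd, ht' d hd, cob]; ring
  zero_mem' := ⟨M.mem_closedSpace.mp (Submodule.zero_mem _), 0, fun d _ => by simp [cob]⟩
  smul_mem' := by
    rintro a z ⟨h, t, ht⟩
    refine ⟨M.mem_closedSpace.mp (Submodule.smul_mem _ a (M.mem_closedSpace.mpr h)), a • t,
      fun d hd => ?_⟩
    simp only [Pi.smul_apply, ht d hd, cob, smul_eq_mul]; ring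

/-- A small set of edges whose removal makes all short closed cochains coboundaries. -/
theorem exists_planarizing [Fintype V] {b : ℕ}
    (hb : Module.finrank (ZMod 2) M.closedSpace ≤
      Module.finrank (ZMod 2) (LinearMap.range M.cobMap) + b) (f : ℕ) :
    ∃ F : Finset D, (∀ d, M.rev d ∈ F ↔ d ∈ F) ∧ F.card ≤ f * b ∧
      ∀ z, M.Closed z → (univ.filter fun d => d ∉ F ∧ z d ≠ 0).card ≤ f →
        ∃ t, ∀ d ∉ F, z d = M.cob t d := by
  by_contra! hcon
  have key : ∀ n : ℕ, n ≤ b + 1 → ∃ F : Finset D, (∀ d, M.rev d ∈ F ↔ d ∈ F) ∧ F.card ≤ f * n ∧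
      Module.finrank (ZMod 2) (LinearMap.range M.cobMap) + n
        ≤ Module.finrank (ZMod 2) (M.cobOff F) := by
    intro n
    induction n with
    | zero =>
      intro _
      refine ⟨∅, by simp, by simp, Submodule.finrank_mono ?_⟩
      rintro _ ⟨t, rfl⟩
      exact ⟨M.closed_cob t, t, fun _ _ => rfl⟩
    | succ n ih =>
      intro hn
      obtain ⟨F, hF, hFc, hFr⟩ := ih (by omega)
      obtain ⟨z, hz, hzc, hzt⟩ := hcon F hF (hFc.trans (Nat.mul_le_mul_left _ (by omega)))
      refine ⟨F ∪ univ.filter fun d => d ∉ F ∧ z d ≠ 0, ?_, ?_, ?_⟩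
      · intro d
        simp [hF, hz.symm]
      · refine (Finset.card_union_le _ _).trans ?_
        rw [Nat.mul_succ]; omega
      · refine Nat.succ_le_of_lt (lt_of_le_of_lt hFr (Submodule.finrank_lt_finrank_of_lt ?_))
        refine SetLike.lt_iff_le_and_exists.mpr ⟨?_, z, ?_, ?_⟩
        · rintro y ⟨hy, t, ht⟩
          exact ⟨hy, t, fun d hd => ht d fun h => hd (Finset.mem_union_left _ h)⟩
        · refine ⟨hz, 0, fun d hd => ?_⟩
          simp only [Finset.mem_union, Finset.mem_filter, Finset.mem_univ, true_and, not_or,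
            not_and, not_not] at hd
          simp [hd.2 hd.1, cob]
        · rintro ⟨_, t, ht⟩
          obtain ⟨d, hd, hne⟩ := hzt t
          exact hne (ht d hd)
  obtain ⟨F, -, -, hF⟩ := key (b + 1) le_rfl
  have : M.cobOff F ≤ M.closedSpace := fun z hz => M.mem_closedSpace.mpr hz.1
  have := Submodule.finrank_mono this
  omega

end CMap

namespace CMap

open scoped Classical

variable {V D : Type} (M : CMap V D) [Fintype D]

/-- The restriction of a map to a set of edges. -/
noncomputable def restrict (S : Set D) (hS : ∀ d, M.rev d ∈ S ↔ d ∈ S) : CMap V S where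
  tail d := M.tail d.1
  rev d := ⟨M.rev d.1, (hS _).mpr d.2⟩
  rot := firstReturn M.rot S
  rev_rev d := Subtype.ext (M.rev_rev _)
  rev_ne d h := M.rev_ne d.1 (congrArg Subtype.val h)
  tail_rot d := by
    rw [firstReturn_val]
    generalize retTime M.rot S d = n
    induction n with
    | zero => rfl
    | succ n ih => rw [pow_succ', Equiv.Perm.mul_apply, M.tail_rot, ih]
  cyc d e h := firstReturn_sameCycle _ _ (M.cyc _ _ h)

variable {S : Set D} (hS : ∀ d, M.rev d ∈ S ↔ d ∈ S)

/-- Faces are merged across the deleted edges. -/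
def Merge (M : CMap V D) (S : Set D) : M.Face → M.Face → Prop :=
  Relation.EqvGen fun f f' => ∃ d, d ∉ S ∧ M.face d = f ∧ M.face (M.rev d) = f'

theorem merge_face_phi (d : S) :
    Merge M S (M.face d.1) (M.face ((M.restrict S hS).phi d).1) := by
  have key : ∀ n, 1 ≤ n → n ≤ retTime M.rot S ((M.restrict S hS).rev d) →
      Merge M S (M.face d.1) (M.face ((M.rot ^ n) (M.rev d.1))) := by
    intro n hn
    induction n, hn using Nat.le_induction with
    | base =>
      intro _
      rw [pow_one, face_rot, M.rev_rev]
      exact .refl _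
    | succ n hn ih =>
      intro h
      refine (ih (by omega)).trans _ _ _ (.rel _ _ ⟨_, ?_, rfl, ?_⟩)
      · exact notMem_of_lt_retTime M.rot S ((M.restrict S hS).rev d) hn (by omega)
      · rw [pow_succ', Equiv.Perm.mul_apply, face_rot]
  exact key _ (retTime_pos _ _ _) le_rfl

theorem exists_closed_extension (z' : S → ZMod 2) (hz : (M.restrict S hS).Closed z') :
    ∃ z, M.Closed z ∧ ∀ d : S, z d.1 = z' d := by
  let z0 : D → ZMod 2 := fun d => if h : d ∈ S then z' ⟨d, h⟩ else 0
  have hz0 : ∀ d, z0 (M.rev d) = z0 d := by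
    intro d
    by_cases h : d ∈ S
    · have h' : M.rev d ∈ S := (hS d).mpr h
      simp only [z0, h, h', dif_pos]
      exact hz.symm ⟨d, h⟩
    · have h' : M.rev d ∉ S := fun h' => h ((hS d).mp h')
      simp only [z0, h, h', dif_neg, not_false_eq_true]
  let sp : Submodule (ZMod 2) (D → ZMod 2) :=
    { carrier := {y | (∀ d, y (M.rev d) = y d) ∧ ∀ d ∈ S, y d = 0}
      add_mem' := fun h h' => ⟨fun d => by simp [h.1 d, h'.1 d], fun d hd => by
        simp [h.2 d hd, h'.2 d hd]⟩
      zero_mem' := ⟨fun _ => rfl, fun _ _ => rfl⟩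
      smul_mem' := fun a y h => ⟨fun d => by simp [h.1 d], fun d hd => by simp [h.2 d hd]⟩ }
  let st : Setoid M.Face := ⟨Merge M S, Relation.EqvGen.is_equivalence _⟩
  let κ : M.Face → Quotient st := Quotient.mk st
  have hmem : M.faceSum z0 ∈ sp.map M.faceMap := by
    refine mem_of_sum_fiber_eq_zero κ _ ?_ _ ?_
    · intro f f' h
      have h : Merge M S f f' := Quotient.exact h
      refine single_add_single_mem (fun d => d ∉ S) _ (fun d hd => ?_) h
      refine ⟨M.edgeInd d, ⟨fun e => M.edgeInd_symm d e, fun e he => ?_⟩, M.faceSum_edgeInd d⟩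
      unfold edgeInd
      rw [if_neg]
      rintro (rfl | rfl)
      · exact hd he
      · exact hd ((hS d).mp he)
    · intro c
      have h1 : ∑ f with κ f = c, M.faceSum z0 f = ∑ d with κ (M.face d) = c, z0 d := by
        rw [← Finset.sum_fiberwise_of_maps_to (s := univ.filter fun d => κ (M.face d) = c)
          (t := univ.filter fun f => κ f = c) (g := M.face) (by simp)]
        refine Finset.sum_congr rfl fun f hf => ?_
        rw [faceSum, Finset.filter_filter]
        refine Finset.sum_congr ?_ fun _ _ => rfl
        ext d
        simp only [Finset.mem_filter, Finset.mem_univ, true_and] at hf ⊢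
        constructor
        · rintro rfl; exact ⟨hf, rfl⟩
        · exact fun h => h.2
      have h2 : ∑ d with κ (M.face d) = c, z0 d
          = ∑ d : S with κ (M.face d.1) = c, z' d := by
        rw [← Finset.sum_subset (s₁ := (univ.filter fun d : S => κ (M.face d.1) = c).map
          (Function.Embedding.subtype _))]
        · rw [Finset.sum_map]
          refine Finset.sum_congr rfl fun d _ => ?_
          simp [z0]
        · intro d hd
          simp only [Finset.mem_map, Finset.mem_filter, Finset.mem_univ, true_and] at hd ⊢
          obtain ⟨a, ha, rfl⟩ := hd
          exact ha
        · intro d hd hd'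
          have : d ∉ S := by
            intro h
            refine hd' ?_
            simp only [Finset.mem_map, Finset.mem_filter, Finset.mem_univ, true_and] at hd ⊢
            exact ⟨⟨d, h⟩, hd, rfl⟩
          simp [z0, this]
      have h3 : ∑ d : S with κ (M.face d.1) = c, z' d = 0 := by
        let M' := M.restrict S hS
        have hκ : ∀ d e : S, M'.face d = M'.face e → κ (M.face d.1) = κ (M.face e.1) := by
          intro d e h
          obtain ⟨n, rfl⟩ := M'.exists_pow_of_face_eq h
          clear h
          induction n with
          | zero => rfl
          | succ n ih =>
            rw [ih, pow_succ', Equiv.Perm.mul_apply]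
            exact Quotient.sound (M.merge_face_phi hS _)
        rw [← Finset.sum_fiberwise (univ.filter fun d : S => κ (M.face d.1) = c) M'.face]
        refine Finset.sum_eq_zero fun f _ => ?_
        rw [Finset.filter_filter]
        by_cases hf : ∃ d : S, κ (M.face d.1) = c ∧ M'.face d = f
        · obtain ⟨d, hd, rfl⟩ := hf
          rw [← hz.sum_face (M'.face d), faceSum]
          refine Finset.sum_congr ?_ fun _ _ => rfl
          ext e
          simp only [Finset.mem_filter, Finset.mem_univ, true_and]
          exact ⟨fun h => h.2, fun h => ⟨(hκ e d h).trans hd, h⟩⟩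
        · rw [Finset.filter_false_of_mem, Finset.sum_empty]
          intro d _ h
          exact hf ⟨d, h⟩
      convert h1.trans (h2.trans h3)
  obtain ⟨y, hy, hyz⟩ := hmem
  refine ⟨z0 + y, ⟨fun d => by simp [hz0, hy.1 d], fun f => ?_⟩, fun d => ?_⟩
  · have h1 : M.faceMap (z0 + y) = 0 := by
      rw [map_add, hyz]
      exact funext fun _ => CharTwo.add_self_eq_zero _
    exact congrFun h1 f
  · simp [z0, hy.2 d.1 d.2]

/-- The number of edges leaving a set of vertices. -/
noncomputable def cut (T : Set V) : ℕ := (univ.filter fun d => M.tail d ∈ T ∧ M.head d ∉ T).card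

/-- Closed cochains with at most `f` darts are coboundaries. -/
def Planarlike (f : ℕ) : Prop :=
  ∀ z, M.Closed z → (univ.filter fun d => z d ≠ 0).card ≤ f → ∃ t, z = M.cob t

/-- Deleting few edges makes a map planar for short cochains. -/
theorem exists_planarlike_restrict [Fintype V] {b : ℕ}
    (hb : Module.finrank (ZMod 2) M.closedSpace ≤
      Module.finrank (ZMod 2) (LinearMap.range M.cobMap) + b) (f : ℕ) :
    ∃ (S : Set D) (hS : ∀ d, M.rev d ∈ S ↔ d ∈ S), (M.restrict S hS).Planarlike f ∧
      (univ.filter fun d => d ∉ S).card ≤ f * b := by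
  obtain ⟨F, hF, hFc, hFz⟩ := M.exists_planarizing hb f
  refine ⟨{d | d ∉ F}, fun d => not_congr (hF d), ?_, ?_⟩
  · intro z' hz' hc
    obtain ⟨z, hz, hzz⟩ := M.exists_closed_extension (fun d => not_congr (hF d)) z' hz'
    obtain ⟨t, ht⟩ := hFz z hz (by
      refine le_trans (le_of_eq ?_) hc
      rw [← Finset.card_map (Function.Embedding.subtype _)]
      congr 1
      ext d
      simp only [Finset.mem_filter, Finset.mem_univ, true_and, Finset.mem_map,
        Function.Embedding.coe_subtype, Subtype.exists, exists_and_right, exists_eq_right]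
      constructor
      · rintro ⟨h1, h2⟩
        exact ⟨h1, by rw [← hzz]; exact h2⟩
      · rintro ⟨h1, h2⟩
        exact ⟨h1, by rwa [← hzz] at h2⟩)
    refine ⟨t, funext fun d => ?_⟩
    rw [← hzz, ht d.1 d.2]
    rfl
  · simpa using hFc

end CMap

namespace CMap

open scoped Classical

variable {V D : Type} (M : CMap V D) [Fintype D]

/-- The number of darts from `A` to `B`. -/
noncomputable def edg (A B : Set V) : ℕ := (univ.filter fun d => M.tail d ∈ A ∧ M.head d ∈ B).card

theorem edg_comm (A B : Set V) : M.edg A B = M.edg B A := by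
  refine Finset.card_bij (fun d _ => M.rev d) ?_ ?_ ?_
  · intro d hd
    simp only [Finset.mem_filter, Finset.mem_univ, true_and, tail_rev, head_rev] at hd ⊢
    exact ⟨hd.2, hd.1⟩
  · intro a _ b _ h; exact M.rev_injective h
  · intro d hd
    refine ⟨M.rev d, ?_, M.rev_rev d⟩
    simp only [Finset.mem_filter, Finset.mem_univ, true_and, tail_rev, head_rev] at hd ⊢
    exact ⟨hd.2, hd.1⟩

theorem edg_union_right {A B C : Set V} (h : Disjoint B C) :
    M.edg A (B ∪ C) = M.edg A B + M.edg A C := by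
  unfold edg
  rw [← Finset.card_union_of_disjoint]
  · congr 1
    ext d
    simp only [Finset.mem_filter, Finset.mem_univ, true_and, Finset.mem_union, Set.mem_union]
    tauto
  · rw [Finset.disjoint_left]
    intro d h1 h2
    simp only [Finset.mem_filter, Finset.mem_univ, true_and] at h1 h2
    exact Set.disjoint_left.mp h h1.2 h2.2

theorem edg_union_left {A B C : Set V} (h : Disjoint A B) :
    M.edg (A ∪ B) C = M.edg A C + M.edg B C := by
  rw [edg_comm, edg_union_right _ h, edg_comm, M.edg_comm C B]

theorem edg_mono {A A' B B' : Set V} (hA : A ⊆ A') (hB : B ⊆ B') : M.edg A B ≤ M.edg A' B' := by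
  refine Finset.card_le_card fun d hd => ?_
  simp only [Finset.mem_filter, Finset.mem_univ, true_and] at hd ⊢
  exact ⟨hA hd.1, hB hd.2⟩

theorem edg_eq_zero {A B : Set V} : M.edg A B = 0 ↔ ∀ d, M.tail d ∈ A → M.head d ∉ B := by
  unfold edg
  rw [Finset.card_eq_zero, Finset.filter_eq_empty_iff]
  simp

/-- Reachability through vertices of `T`. -/
def ReachIn (T : Set V) : V → V → Prop :=
  Relation.ReflTransGen fun u v => u ∈ T ∧ v ∈ T ∧ M.Adj u v

/-- Connectedness of a set of vertices (the empty set is allowed). -/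
def Conn (T : Set V) : Prop := ∀ u ∈ T, ∀ v ∈ T, M.ReachIn T u v

theorem adj_symm {u v : V} (h : M.Adj u v) : M.Adj v u := by
  obtain ⟨d, rfl, rfl⟩ := h
  exact ⟨M.rev d, rfl, M.head_rev d⟩

theorem ReachIn.symm {M : CMap V D} {T : Set V} {u v : V} (h : M.ReachIn T u v) :
    M.ReachIn T v u := by
  induction h with
  | refl => exact .refl
  | tail _ h ih => exact .head ⟨h.2.1, h.1, M.adj_symm h.2.2⟩ ih

theorem ReachIn.mono {M : CMap V D} {T T' : Set V} (hT : T ⊆ T') {u v : V}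
    (h : M.ReachIn T u v) : M.ReachIn T' u v := by
  induction h with
  | refl => exact .refl
  | tail _ h ih => exact .tail ih ⟨hT h.1, hT h.2.1, h.2.2⟩

theorem reachIn_dart {T : Set V} {d : D} (h1 : M.tail d ∈ T) (h2 : M.head d ∈ T) :
    M.ReachIn T (M.tail d) (M.head d) := .single ⟨h1, h2, d, rfl, rfl⟩

theorem ReachIn.const {M : CMap V D} {T : Set V} {β : Type} (t : V → β)
    (ht : ∀ d, M.tail d ∈ T → M.head d ∈ T → t (M.tail d) = t (M.head d)) {u v : V}
    (h : M.ReachIn T u v) : t u = t v := by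
  induction h with
  | refl => rfl
  | tail _ h ih =>
    obtain ⟨h1, h2, d, rfl, rfl⟩ := h
    exact ih.trans (ht d h1 h2)

theorem conn_of_base {T : Set V} (u : V) (h : ∀ v ∈ T, M.ReachIn T u v) : M.Conn T :=
  fun v hv w hw => (h v hv).symm.trans (h w hw)

/-- A connected set meeting two others that are connected joins them. -/
theorem Conn.union {M : CMap V D} {A B : Set V} (hA : M.Conn A) (hB : M.Conn B)
    {u v : V} (hu : u ∈ A) (hv : v ∈ B) (h : M.ReachIn (A ∪ B) u v) : M.Conn (A ∪ B) := by
  refine M.conn_of_base u fun w hw => ?_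
  rcases hw with hw | hw
  · exact (hA u hu w hw).mono Set.subset_union_left
  · exact h.trans ((hB v hv w hw).mono Set.subset_union_right)

theorem Conn.union_of_dart {M : CMap V D} {A B : Set V} (hA : M.Conn A) (hB : M.Conn B)
    {d : D} (hu : M.tail d ∈ A) (hv : M.head d ∈ B) : M.Conn (A ∪ B) :=
  hA.union hB hu hv (M.reachIn_dart (Or.inl hu) (Or.inr hv))

theorem conn_singleton (u : V) : M.Conn {u} := by
  rintro _ rfl _ rfl; exact .refl

/-- The component of `u` in `T`. -/
def compIn (T : Set V) (u : V) : Set V := {v | M.ReachIn T u v}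

theorem mem_compIn_self (T : Set V) (u : V) : u ∈ M.compIn T u := .refl

theorem compIn_subset {T : Set V} {u : V} (hu : u ∈ T) : M.compIn T u ⊆ T := by
  intro v hv
  induction hv with
  | refl => exact hu
  | tail _ h _ => exact h.2.1

theorem head_mem_compIn {T : Set V} {u : V} (hu : u ∈ T) {d : D} (h : M.tail d ∈ M.compIn T u)
    (hd : M.head d ∈ T) : M.head d ∈ M.compIn T u :=
  Relation.ReflTransGen.tail h ⟨M.compIn_subset hu h, hd, d, rfl, rfl⟩

theorem conn_compIn {T : Set V} {u : V} : M.Conn (M.compIn T u) := by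
  refine M.conn_of_base u fun v hv => ?_
  induction hv with
  | refl => exact .refl
  | tail h1 h2 ih => exact ih.tail ⟨h1, h1.tail h2, h2.2.2⟩

theorem Conn.subset_compIn {M : CMap V D} {A T : Set V} (hA : M.Conn A) (hT : A ⊆ T) {u v : V}
    (hu : u ∈ A) (hv : u ∈ M.compIn T v) : A ⊆ M.compIn T v :=
  fun w hw => Relation.ReflTransGen.trans hv ((hA u hu w hw).mono hT)

theorem Conn.exists_dart {M : CMap V D} {T A : Set V} (hT : M.Conn T) {u v : V} (hu : u ∈ T)
    (huA : u ∈ A) (hv : v ∈ T) (hvA : v ∉ A) :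
    ∃ d, M.tail d ∈ T ∧ M.tail d ∈ A ∧ M.head d ∈ T ∧ M.head d ∉ A := by
  by_contra! hcon
  have h := hT u hu v hv
  clear hv
  induction h with
  | refl => exact hvA huA
  | @tail b c h1 h2 ih =>
    obtain ⟨hb, hc, d, rfl, rfl⟩ := h2
    by_cases h3 : M.tail d ∈ A
    · exact hvA (hcon d hb h3 hc)
    · exact ih h3

/-- The number of elements of `X` in `T`. -/
noncomputable def wt (X : Finset V) (T : Set V) : ℕ := (X.filter fun x => x ∈ T).card

theorem wt_mono (X : Finset V) {A B : Set V} (h : A ⊆ B) : wt X A ≤ wt X B :=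
  Finset.card_le_card fun x hx => by
    simp only [Finset.mem_filter] at hx ⊢
    exact ⟨hx.1, h hx.2⟩

theorem wt_union_le (X : Finset V) (A B : Set V) : wt X (A ∪ B) ≤ wt X A + wt X B := by
  unfold wt
  refine le_trans (Finset.card_le_card ?_) (Finset.card_union_le _ _)
  intro x
  simp only [Finset.mem_filter, Finset.mem_union, Set.mem_union]
  tauto

theorem wt_union (X : Finset V) {A B : Set V} (h : Disjoint A B) :
    wt X (A ∪ B) = wt X A + wt X B := by
  unfold wt
  rw [← Finset.card_union_of_disjoint]
  · congr 1
    ext x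
    simp only [Finset.mem_filter, Finset.mem_union, Set.mem_union]
    tauto
  · rw [Finset.disjoint_left]
    intro x h1 h2
    simp only [Finset.mem_filter] at h1 h2
    exact Set.disjoint_left.mp h h1.2 h2.2

theorem wt_le_card (X : Finset V) (A : Set V) : wt X A ≤ X.card := Finset.card_filter_le _ _

/-- Two connected sets `K` and `O` filling a component, such that no set of vertices of `O`
and its complement in `O` can be separated more cheaply than along `K`. -/
structure Disk (K O : Set V) : Prop where
  disj : Disjoint K O
  head_mem : ∀ d, M.tail d ∈ K ∪ O → M.head d ∈ K ∪ O
  connK : M.Conn K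
  connO : M.Conn O
  nonemptyK : K.Nonempty
  geo : ∀ T ⊆ O, M.edg T K ≤ M.edg T (O \ T) ∨ M.edg (O \ T) K ≤ M.edg T (O \ T)

theorem cut_eq_of_closed {U A : Set V} (hU : ∀ d, M.tail d ∈ U → M.head d ∈ U) (hA : A ⊆ U) :
    M.cut A = M.edg A (U \ A) := by
  unfold cut edg
  congr 1
  ext d
  simp only [Finset.mem_filter, Finset.mem_univ, true_and, Set.mem_sdiff]
  exact ⟨fun h => ⟨h.1, hU d (hA h.1), h.2⟩, fun h => ⟨h.1, h.2.2⟩⟩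

theorem exists_disk [Fintype V] (X : Finset V) {kd m : ℕ}
    (hdeg : ∀ v, (univ.filter fun d => M.tail d = v).card ≤ 4)
    (wl : ∀ T : Set V, min (wt X T) (X.card - wt X T) ≤ M.cut T + kd)
    (hm : 4 ≤ m) (hk : 8 * (m + kd) + 8 ≤ X.card) :
    ∃ K O : Set V, M.Disk K O ∧ m ≤ M.edg O K + 1 ∧ M.edg O K ≤ m ∧
      ∀ Q ⊆ O, 4 * wt X Q ≤ X.card → M.edg Q K ≤ M.edg Q (O \ Q) := by
  -- the component containing most of `X`
  obtain ⟨U, ⟨hU1, hU2⟩, hUmin⟩ := exists_minimal_of_wellFoundedLT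
    (fun T : Set V => (∀ d, M.tail d ∈ T → M.head d ∈ T) ∧ X.card < 2 * wt X T)
    ⟨Set.univ, fun _ _ => trivial, by
      have : wt X Set.univ = X.card := by simp [wt]
      omega⟩
  have hcut0 : ∀ T : Set V, (∀ d, M.tail d ∈ T → M.head d ∈ T) → M.cut T = 0 := by
    intro T hT
    unfold cut
    rw [Finset.card_eq_zero, Finset.filter_eq_empty_iff]
    rintro d - ⟨h1, h2⟩
    exact h2 (hT d h1)
  have hUne : U.Nonempty := by
    by_contra h
    rw [Set.not_nonempty_iff_eq_empty] at h
    subst h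
    simp [wt] at hU2
  obtain ⟨u0, hu0⟩ := hUne
  have hUconn : M.Conn U := by
    have hC : M.compIn U u0 = U := by
      by_contra hne
      have hsub := M.compIn_subset hu0
      set C := M.compIn U u0
      have hCcl : ∀ d, M.tail d ∈ C → M.head d ∈ C := fun d hd =>
        M.head_mem_compIn hu0 hd (hU1 d (hsub hd))
      have hC'cl : ∀ d, M.tail d ∈ U \ C → M.head d ∈ U \ C := by
        intro d hd
        refine ⟨hU1 d hd.1, fun h => hd.2 ?_⟩
        have := hCcl (M.rev d) h
        rwa [head_rev] at this
      have h1 : ¬ (X.card < 2 * wt X C) := fun h =>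
        hne (Set.Subset.antisymm hsub (hUmin ⟨hCcl, h⟩ hsub))
      have h2 : ¬ (X.card < 2 * wt X (U \ C)) := fun h =>
        (hUmin ⟨hC'cl, h⟩ Set.sdiff_subset hu0).2 (M.mem_compIn_self U u0)
      have h3 := wl C
      have h4 := wl (U \ C)
      rw [hcut0 _ hCcl] at h3
      rw [hcut0 _ hC'cl] at h4
      have h5 := wt_union_le X C (U \ C)
      rw [Set.union_sdiff_cancel hsub] at h5
      omega
    rw [← hC]; exact M.conn_compIn
  -- a maximal connected set with small boundary
  obtain ⟨K, ⟨hKU, hKc, hKne, hKm, hKX⟩, hKmax⟩ := exists_maximal_of_wellFoundedGT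
    (fun T : Set V => T ⊆ U ∧ M.Conn T ∧ T.Nonempty ∧ M.cut T ≤ m ∧ 2 * wt X T ≤ X.card)
    ⟨{u0}, by simpa using hu0, M.conn_singleton _, ⟨u0, rfl⟩, by
      refine le_trans (Finset.card_le_card ?_) ((hdeg u0).trans hm)
      intro d
      simp only [Finset.mem_filter, Finset.mem_univ, true_and, Set.mem_singleton_iff]
      exact fun h => h.1, by
      have : wt X {u0} ≤ 1 := by
        unfold wt
        refine (Finset.card_le_card (t := {u0}) ?_).trans (by simp)
        intro x
        simp
      omega⟩
  have hKwt : wt X K ≤ m + kd := by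
    have := wl K
    omega
  have hmax : ∀ T : Set V, K ⊆ T → T ⊆ U → M.Conn T → M.cut T ≤ m → 2 * wt X T ≤ X.card →
      T ⊆ K := fun T h1 h2 h3 h4 h5 => hKmax ⟨h2, h3, hKne.mono h1, h4, h5⟩ h1
  set O := U \ K with hO
  have hKO : K ∪ O = U := Set.union_sdiff_cancel hKU
  have hdisj : Disjoint K O := Set.disjoint_sdiff_right
  have hOne : O.Nonempty := by
    by_contra h
    rw [Set.not_nonempty_iff_eq_empty, hO, Set.sdiff_eq_empty] at h
    have := wt_mono X h
    omega
  obtain ⟨o0, ho0⟩ := hOne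
  obtain ⟨w0, hw0⟩ := id hKne
  have hL : M.cut K = M.edg K O := M.cut_eq_of_closed hU1 hKU
  have hLlow : m ≤ M.cut K + 1 := by
    obtain ⟨d, h1, h2, h3, h4⟩ := hUconn.exists_dart (hKU hw0) hw0 ho0.1 ho0.2
    by_contra hlt
    refine h4 (hmax (K ∪ {M.head d}) Set.subset_union_left ?_ ?_ ?_ ?_ (Or.inr rfl))
    · exact Set.union_subset hKU (by simpa using h3)
    · exact hKc.union_of_dart (M.conn_singleton _) h2 rfl
    · have h5 : (univ.filter fun e => M.tail e ∈ K ∪ {M.head d} ∧ M.head e ∉ K ∪ {M.head d})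
          ⊆ (univ.filter fun e => M.tail e ∈ K ∧ M.head e ∉ K).erase d ∪
            (univ.filter fun e => M.tail e = M.head d).erase (M.rev d) := by
        intro e
        simp only [Finset.mem_filter, Finset.mem_univ, true_and, Finset.mem_union,
          Finset.mem_erase, Set.mem_union, Set.mem_singleton_iff, not_or]
        rintro ⟨h | h, h6, h7⟩
        · exact Or.inl ⟨fun h8 => h7 (h8 ▸ rfl), h, h6⟩
        · refine Or.inr ⟨fun h8 => h6 ?_, h⟩
          rw [h8, head_rev]; exact h2
      have h6 := Finset.card_le_card h5
      have h7 := Finset.card_union_le ((univ.filter fun e => M.tail e ∈ K ∧ M.head e ∉ K).erase d)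
        ((univ.filter fun e => M.tail e = M.head d).erase (M.rev d))
      rw [Finset.card_erase_of_mem (by simp [h2, h4]),
        Finset.card_erase_of_mem (by simp [tail_rev])] at h7
      have h8 := hdeg (M.head d)
      have h9 : M.cut K = (univ.filter fun e => M.tail e ∈ K ∧ M.head e ∉ K).card := by unfold cut; congr!
      have h10 : M.cut (K ∪ {M.head d}) = (univ.filter fun e => M.tail e ∈ K ∪ {M.head d} ∧
        M.head e ∉ K ∪ {M.head d}).card := by unfold cut; congr!
      have h11 : 0 < (univ.filter fun e => M.tail e ∈ K ∧ M.head e ∉ K).card :=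
        Finset.card_pos.mpr ⟨d, by simp [h2, h4]⟩
      omega
    · have h5 := wt_union_le X K {M.head d}
      have : wt X {M.head d} ≤ 1 := by
        unfold wt
        refine (Finset.card_le_card (t := {M.head d}) ?_).trans (by simp)
        intro x
        simp
      omega
  have hedgKO : ∀ Q ⊆ O, M.edg K Q ≤ M.cut K := fun Q hQ => by
    rw [hL]; exact M.edg_mono le_rfl hQ
  have hOconn : M.Conn O := by
    have hbig : ∀ u ∈ O, X.card < 2 * wt X (K ∪ M.compIn O u) := by
      intro u hu
      by_contra hlt
      have hsub := M.compIn_subset hu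
      refine hu.2 (hmax (K ∪ M.compIn O u) Set.subset_union_left ?_ ?_ ?_ (by omega)
        (Or.inr (M.mem_compIn_self _ _)))
      · exact Set.union_subset hKU (hsub.trans Set.sdiff_subset)
      · obtain ⟨d, h1, h2, h3, h4⟩ := hUconn.exists_dart (A := M.compIn O u) hu.1
          (M.mem_compIn_self _ _) (hKU hw0) fun h => (hsub h).2 hw0
        have h5 : M.head d ∈ K := by
          by_contra h5
          exact h4 (M.head_mem_compIn hu h2 ⟨h3, h5⟩)
        rw [Set.union_comm]
        exact M.conn_compIn.union_of_dart hKc h2 h5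
      · refine le_trans (Finset.card_le_card ?_) hKm
        intro d
        simp only [Finset.mem_filter, Finset.mem_univ, true_and, Set.mem_union, not_or]
        rintro ⟨h | h, h1, h2⟩
        · exact ⟨h, h1⟩
        · exact absurd (M.head_mem_compIn hu h ⟨hU1 d (hsub h).1, h1⟩) h2
    refine M.conn_of_base o0 fun v hv => ?_
    by_contra hne
    have h1 := hbig o0 ho0
    have h2 := hbig v hv
    have h3 := wl (K ∪ M.compIn O o0)
    have h4 := wl (K ∪ M.compIn O v)
    have hc : ∀ u ∈ O, M.cut (K ∪ M.compIn O u) ≤ m := by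
      intro u hu
      refine le_trans (Finset.card_le_card ?_) hKm
      intro d
      simp only [Finset.mem_filter, Finset.mem_univ, true_and, Set.mem_union, not_or]
      rintro ⟨h | h, h1, h2⟩
      · exact ⟨h, h1⟩
      · exact absurd (M.head_mem_compIn hu h ⟨hU1 d (M.compIn_subset hu h).1, h1⟩) h2
    have h5 := hc _ ho0
    have h6 := hc _ hv
    have h7 := wt_union_le X K (M.compIn O o0)
    have h8 := wt_union_le X K (M.compIn O v)
    have h9 : wt X (M.compIn O o0 ∪ M.compIn O v) = _ := wt_union X (by
      rw [Set.disjoint_left]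
      intro w hw1 hw2
      exact hne (hw1.trans hw2.symm))
    have h10 := wt_le_card X (M.compIn O o0 ∪ M.compIn O v)
    have h11 := wt_le_card X (K ∪ M.compIn O o0)
    have h12 := wt_le_card X (K ∪ M.compIn O v)
    omega
  have hQ : ∀ Q ⊆ O, 4 * wt X Q ≤ X.card → M.edg Q K ≤ M.edg Q (O \ Q) := by
    intro Q hQO hQX
    by_contra! hlt
    set T := M.compIn (K ∪ Q) w0 with hT
    have hw0' : w0 ∈ K ∪ Q := Or.inl hw0
    have hTsub : T ⊆ K ∪ Q := M.compIn_subset hw0'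
    have hKT : K ⊆ T := hKc.subset_compIn Set.subset_union_left hw0 (M.mem_compIn_self _ _)
    have hTU : T ⊆ U := hTsub.trans (Set.union_subset hKU (hQO.trans Set.sdiff_subset))
    have hcl : ∀ d, M.tail d ∈ T → M.head d ∈ K ∪ Q → M.head d ∈ T := fun d h1 h2 =>
      M.head_mem_compIn hw0' h1 h2
    have hcut : M.cut T ≤ M.edg K (O \ Q) + M.edg Q (O \ Q) := by
      rw [← M.edg_union_left (hdisj.mono_right hQO)]
      refine Finset.card_le_card fun d => ?_
      simp only [Finset.mem_filter, Finset.mem_univ, true_and]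
      rintro ⟨h1, h2⟩
      refine ⟨hTsub h1, ⟨hU1 d (hTU h1), fun h => h2 (hKT h)⟩, fun h => h2 (hcl d h1 (Or.inr h))⟩
    have hKQ : M.edg K O = M.edg K Q + M.edg K (O \ Q) := by
      rw [← M.edg_union_right Set.disjoint_sdiff_right, Set.union_sdiff_cancel hQO]
    have hTK := hmax T hKT hTU M.conn_compIn (by rw [M.edg_comm Q K] at hlt; omega) (by
      have h1 := wt_mono X hTsub
      have h2 := wt_union_le X K Q
      omega)
    have h0 : M.edg Q K = 0 := by
      rw [M.edg_comm, M.edg_eq_zero]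
      intro d h1 h2
      exact (hQO h2).2 (hTK (hcl d (hKT h1) (Or.inr h2)))
    omega
  refine ⟨K, O, ⟨hdisj, ?_, hKc, hOconn, hKne, ?_⟩, ?_, ?_, hQ⟩
  · rw [hKO]; exact hU1
  · intro T hTO
    by_cases h1 : 4 * wt X T ≤ X.card
    · exact Or.inl (hQ T hTO h1)
    by_cases h2 : 4 * wt X (O \ T) ≤ X.card
    · right
      have := hQ (O \ T) Set.sdiff_subset h2
      rwa [Set.sdiff_sdiff_cancel_left hTO, M.edg_comm _ T] at this
    left
    have h3 := wl T
    have h4 := wt_union X (A := T) (B := O \ T) Set.disjoint_sdiff_right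
    have h5 := wt_le_card X (T ∪ O \ T)
    have h6 : M.cut T = M.edg T K + M.edg T (O \ T) := by
      rw [M.cut_eq_of_closed hU1 (hTO.trans Set.sdiff_subset),
        ← M.edg_union_right (hdisj.mono_right Set.sdiff_subset)]
      congr 1
      ext v
      simp only [hO, Set.mem_sdiff, Set.mem_union]
      constructor
      · rintro ⟨h7, h8⟩
        by_cases h9 : v ∈ K
        · exact Or.inl h9
        · exact Or.inr ⟨⟨h7, h9⟩, h8⟩
      · rintro (h7 | h7)
        · exact ⟨hKU h7, fun h8 => (hTO h8).2 h7⟩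
        · exact ⟨h7.1.1, h7.2⟩
    have h7 := hedgKO T hTO
    rw [M.edg_comm K T] at h7
    omega
  · rw [M.edg_comm, ← hL]; exact hLlow
  · rw [M.edg_comm, ← hL]; exact hKm

end CMap

namespace CMap

open scoped Classical

variable {V D : Type} (M : CMap V D) [Fintype D]

/-- Darts with exactly one end in `Q`. -/
def bdry (Q : Set V) : Set D := {d | ¬ (M.tail d ∈ Q ↔ M.head d ∈ Q)}

/-- Darts leaving `Q`. -/
def out (Q : Set V) : Set D := {d | M.tail d ∈ Q ∧ M.head d ∉ Q}

theorem rev_mem_bdry {Q : Set V} {d : D} : M.rev d ∈ M.bdry Q ↔ d ∈ M.bdry Q := by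
  simp only [bdry, Set.mem_ofPred_eq, tail_rev, head_rev]
  tauto

theorem out_subset_bdry (Q : Set V) : M.out Q ⊆ M.bdry Q := fun d hd => by
  simp only [bdry, out, Set.mem_ofPred_eq] at hd ⊢
  tauto

/-- Reversal on the boundary darts. -/
def revBdry (Q : Set V) : Equiv.Perm (M.bdry Q) :=
  M.revPerm.subtypePerm fun _ => M.rev_mem_bdry

/-- The permutation sending a dart leaving `Q` to the next one along the boundary of `Q`. -/
noncomputable def nxt (Q : Set V) : Equiv.Perm D :=
  Equiv.Perm.ofSubtype (firstReturn M.phi (M.bdry Q) * M.revBdry Q)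

theorem nxt_apply {Q : Set V} {c : D} (hc : c ∈ M.bdry Q) :
    M.nxt Q c = (M.phi ^ retTime M.phi (M.bdry Q) ⟨M.rev c, M.rev_mem_bdry.mpr hc⟩) (M.rev c) := by
  unfold nxt
  rw [Equiv.Perm.ofSubtype_apply_of_mem _ hc]
  rfl

theorem nxt_spec {Q : Set V} {c : D} (hc : c ∈ M.out Q) :
    M.nxt Q c ∈ M.out Q ∧ ∃ n : ℕ, 1 ≤ n ∧ M.nxt Q c = (M.phi ^ n) (M.rev c) ∧
      ∀ l, 1 ≤ l → l ≤ n → M.tail ((M.phi ^ l) (M.rev c)) ∈ Q := by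
  have hb := M.out_subset_bdry Q hc
  set r : M.bdry Q := ⟨M.rev c, M.rev_mem_bdry.mpr hb⟩ with hr
  have h0 := M.nxt_apply hb
  have h1 := retTime_pos M.phi (M.bdry Q) r
  have h2 := pow_retTime_mem M.phi (M.bdry Q) r
  have h3 := fun n => notMem_of_lt_retTime M.phi (M.bdry Q) r (n := n)
  rw [← hr] at h0
  set n := retTime M.phi (M.bdry Q) r
  have h4 : ∀ l, 1 ≤ l → l ≤ n → M.tail ((M.phi ^ l) (M.rev c)) ∈ Q := by
    intro l hl
    induction l, hl using Nat.le_induction with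
    | base => intro _; rw [pow_one, tail_phi, head_rev]; exact hc.1
    | succ l hl ih =>
      intro h
      have h5 := ih (by omega)
      have h6 := h3 l hl (by omega)
      simp only [bdry, Set.mem_ofPred_eq, not_not] at h6
      rw [pow_succ', Equiv.Perm.mul_apply, tail_phi]
      exact h6.mp h5
  refine ⟨?_, n, h1, h0, h4⟩
  rw [h0]
  have h5 := h4 n h1 le_rfl
  refine ⟨h5, fun h6 => ?_⟩
  simp only [bdry, Set.mem_ofPred_eq] at h2
  exact h2 (by simp only [hr]; tauto)

theorem nxt_eq_of {Q : Set V} {c d : D} (hc : c ∈ M.out Q) {n : ℕ}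
    (hd : (M.phi ^ n) (M.rev c) = d) (hdQ : M.head d ∉ Q)
    (h : ∀ l, 1 ≤ l → l ≤ n → M.tail ((M.phi ^ l) (M.rev c)) ∈ Q) : M.nxt Q c = d := by
  obtain ⟨⟨h1, h2⟩, n', hn', h3, h4⟩ := M.nxt_spec hc
  have key : ∀ k k' : ℕ, (∀ l, 1 ≤ l → l ≤ k' → M.tail ((M.phi ^ l) (M.rev c)) ∈ Q) →
      M.head ((M.phi ^ k) (M.rev c)) ∉ Q → ¬ k < k' := by
    intro k k' h5 h6 h7
    have := h5 (k + 1) (by omega) (by omega)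
    rw [pow_succ', Equiv.Perm.mul_apply, tail_phi] at this
    exact h6 this
  have h5 := key n n' h4 (hd ▸ hdQ)
  have h6 := key n' n h (h3 ▸ h2)
  have : n = n' := by omega
  rw [h3, ← this, hd]

theorem nxt_mem_out {Q : Set V} {c : D} (hc : c ∈ M.out Q) : M.nxt Q c ∈ M.out Q :=
  (M.nxt_spec hc).1

theorem face_nxt {Q : Set V} {c : D} (hc : c ∈ M.out Q) :
    M.face (M.nxt Q c) = M.face (M.rev c) := by
  obtain ⟨-, n, -, h, -⟩ := M.nxt_spec hc
  rw [h, face_pow]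

theorem pow_nxt_mem_out {Q : Set V} {c : D} (hc : c ∈ M.out Q) (n : ℕ) :
    (M.nxt Q ^ n) c ∈ M.out Q := by
  induction n with
  | zero => exact hc
  | succ n ih => rw [pow_succ', Equiv.Perm.mul_apply]; exact M.nxt_mem_out ih

theorem sameCycle_mem_out {Q : Set V} {c d : D} (hc : c ∈ M.out Q)
    (h : (M.nxt Q).SameCycle c d) : d ∈ M.out Q := by
  obtain ⟨n, rfl⟩ := h.exists_nat_pow_eq
  exact M.pow_nxt_mem_out hc n

theorem rev_notMem_out {Q : Set V} {c : D} (hc : c ∈ M.out Q) : M.rev c ∉ M.out Q :=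
  fun h => h.2 (by rw [head_rev]; exact hc.1)

/-- The cochain of the edges on the boundary walk of `Q` through `c`. -/
noncomputable def orbC (Q : Set V) (c d : D) : ZMod 2 :=
  if (M.nxt Q).SameCycle c d ∨ (M.nxt Q).SameCycle c (M.rev d) then 1 else 0

theorem orbC_eq_zero {Q : Set V} {c : D} (hc : c ∈ M.out Q) {d : D} (hd : d ∉ M.bdry Q) :
    M.orbC Q c d = 0 := by
  unfold orbC
  rw [if_neg]
  rintro (h | h)
  · exact hd (M.out_subset_bdry Q (M.sameCycle_mem_out hc h))
  · exact hd (M.rev_mem_bdry.mp (M.out_subset_bdry Q (M.sameCycle_mem_out hc h)))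

theorem orbC_of_mem {Q : Set V} {c : D} (hc : c ∈ M.out Q) {d : D} (hd : d ∈ M.out Q) :
    M.orbC Q c d = if (M.nxt Q).SameCycle c d then 1 else 0 := by
  unfold orbC
  by_cases h : (M.nxt Q).SameCycle c d
  · simp [h]
  · have : ¬ (M.nxt Q).SameCycle c (M.rev d) := fun h' =>
      M.rev_notMem_out hd (M.sameCycle_mem_out hc h')
    simp [h, this]

theorem closed_orbC {Q : Set V} {c : D} (hc : c ∈ M.out Q) : M.Closed (M.orbC Q c) := by
  refine ⟨fun d => by simp [orbC, or_comm], fun f => ?_⟩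
  have h1 : M.orbC Q c = fun d => (if (M.nxt Q).SameCycle c d then 1 else 0) +
      (if (M.nxt Q).SameCycle c (M.rev d) then 1 else 0) := by
    funext d
    by_cases h : (M.nxt Q).SameCycle c d
    · have : ¬ (M.nxt Q).SameCycle c (M.rev d) := fun h' =>
        M.rev_notMem_out (M.sameCycle_mem_out hc h) (M.sameCycle_mem_out hc h')
      simp [orbC, h, this]
    · simp [orbC, h]
  unfold faceSum
  rw [h1, Finset.sum_add_distrib, ← Finset.sum_filter, ← Finset.sum_filter, Finset.sum_const,
    Finset.sum_const, Finset.filter_filter, Finset.filter_filter]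
  rw [show (univ.filter fun d => M.face d = f ∧ (M.nxt Q).SameCycle c (M.rev d)).card =
    (univ.filter fun d => M.face d = f ∧ (M.nxt Q).SameCycle c d).card from ?_]
  · rw [← two_nsmul, smul_smul, mul_comm, mul_smul]
    have : (2 : ℕ) • (1 : ZMod 2) = 0 := by decide
    rw [this, smul_zero]
  refine Finset.card_bij (fun d _ => M.nxt Q (M.rev d)) ?_ ?_ ?_
  · intro d hd
    simp only [Finset.mem_filter, Finset.mem_univ, true_and] at hd ⊢
    refine ⟨?_, hd.2.apply_right⟩
    rw [M.face_nxt (M.sameCycle_mem_out hc hd.2), rev_rev', hd.1]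
  · intro a _ b _ h; exact M.rev_injective ((M.nxt Q).injective h)
  · intro d hd
    simp only [Finset.mem_filter, Finset.mem_univ, true_and] at hd
    have h2 : (M.nxt Q).SameCycle c ((M.nxt Q).symm d) := by
      rw [← Equiv.Perm.sameCycle_apply_right, Equiv.apply_symm_apply]; exact hd.2
    refine ⟨M.rev ((M.nxt Q).symm d), ?_, by simp⟩
    simp only [Finset.mem_filter, Finset.mem_univ, true_and, rev_rev']
    refine ⟨?_, h2⟩
    rw [← M.face_nxt (M.sameCycle_mem_out hc h2), Equiv.apply_symm_apply, hd.1]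

theorem sameCycle_of_cob {Q U : Set V} (hQ : M.Conn Q) (hU : M.Conn (U \ Q)) (hQU : Q ⊆ U)
    (hcl : ∀ d, M.tail d ∈ U → M.head d ∈ U) {c : D} (hc : c ∈ M.out Q) {t : V → ZMod 2}
    (ht : M.orbC Q c = M.cob t) {d : D} (hd : d ∈ M.out Q) : (M.nxt Q).SameCycle c d := by
  have key : ∀ e, e ∉ M.bdry Q → t (M.tail e) = t (M.head e) := by
    intro e he
    have h1 := M.orbC_eq_zero hc he
    rw [ht, cob] at h1
    exact CharTwo.add_eq_zero.mp h1
  have h1 : t (M.tail c) = t (M.tail d) := by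
    refine (hQ _ hc.1 _ hd.1).const t fun e h1 h2 => key e ?_
    simp [bdry, h1, h2]
  have h2 : t (M.head c) = t (M.head d) := by
    refine (hU _ ⟨hcl _ (hQU hc.1), hc.2⟩ _ ⟨hcl _ (hQU hd.1), hd.2⟩).const t
      fun e h1 h2 => key e ?_
    simp [bdry, h1.2, h2.2]
  have h3 : M.orbC Q c c = M.orbC Q c d := by
    rw [ht, cob, cob, h1, h2]
  rw [M.orbC_of_mem hc hc, M.orbC_of_mem hc hd, if_pos (Equiv.Perm.SameCycle.refl _ _)] at h3
  by_contra h4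
  rw [if_neg h4] at h3
  exact absurd h3 (by decide)

end CMap

namespace CMap

open scoped Classical

variable {V D : Type} (M : CMap V D) [Fintype D]

/-- A list of darts crossing from face to face, not using the edges inside `K`. -/
def IsWalk (K : Set V) : M.Face → List D → M.Face → Prop
  | f, [], f' => f = f'
  | f, d :: l, f' => M.face d = f ∧ ¬ (M.tail d ∈ K ∧ M.head d ∈ K) ∧
      IsWalk K (M.face (M.rev d)) l f'

variable {M}

theorem IsWalk.append {K : Set V} {f g h : M.Face} {l l' : List D} (h1 : M.IsWalk K f l g)
    (h2 : M.IsWalk K g l' h) : M.IsWalk K f (l ++ l') h := by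
  induction l generalizing f with
  | nil => cases h1; exact h2
  | cons d l ih => exact ⟨h1.1, h1.2.1, ih h1.2.2⟩

theorem isWalk_single {K : Set V} {d : D} (h : ¬ (M.tail d ∈ K ∧ M.head d ∈ K)) :
    M.IsWalk K (M.face d) [d] (M.face (M.rev d)) := ⟨rfl, h, rfl⟩

theorem IsWalk.reverse {K : Set V} {f g : M.Face} {l : List D} (h : M.IsWalk K f l g) :
    M.IsWalk K g (l.map M.rev).reverse f := by
  induction l generalizing f with
  | nil => cases h; exact rfl
  | cons d l ih =>
    simp only [List.map_cons, List.reverse_cons]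
    refine (ih h.2.2).append ⟨rfl, ?_, ?_⟩
    · rw [tail_rev, head_rev, and_comm]; exact h.2.1
    · rw [rev_rev']; exact h.1

theorem IsWalk.mem {K : Set V} {f g : M.Face} {l : List D} (h : M.IsWalk K f l g) {d : D}
    (hd : d ∈ l) : ¬ (M.tail d ∈ K ∧ M.head d ∈ K) := by
  induction l generalizing f with
  | nil => simp at hd
  | cons e l ih =>
    rcases List.mem_cons.mp hd with rfl | hd
    · exact h.2.1
    · exact ih h.2.2 hd

variable (M)

/-- The distance between faces, capped at `B`. -/
noncomputable def gd (K : Set V) (B : ℕ) (f g : M.Face) : ℕ :=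
  sInf {k | k = B ∨ ∃ l, M.IsWalk K f l g ∧ l.length = k}

variable {K : Set V} {B : ℕ}

theorem gd_le_cap (f g : M.Face) : M.gd K B f g ≤ B := Nat.sInf_le (Or.inl rfl)

theorem gd_le_of_walk {f g : M.Face} {l : List D} (h : M.IsWalk K f l g) :
    M.gd K B f g ≤ l.length := Nat.sInf_le (Or.inr ⟨l, h, rfl⟩)

theorem exists_walk {f g : M.Face} (h : M.gd K B f g < B) :
    ∃ l, M.IsWalk K f l g ∧ l.length = M.gd K B f g := by
  have : M.gd K B f g ∈ {k | k = B ∨ ∃ l, M.IsWalk K f l g ∧ l.length = k} :=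
    Nat.sInf_mem ⟨B, Or.inl rfl⟩
  rcases this with h1 | h1
  · omega
  · exact h1

theorem gd_self (f : M.Face) : M.gd K B f f = 0 :=
  Nat.le_zero.mp (M.gd_le_of_walk (l := []) rfl)

theorem gd_comm (f g : M.Face) : M.gd K B f g = M.gd K B g f := by
  have key : ∀ f g : M.Face, M.gd K B f g ≤ M.gd K B g f := by
    intro f g
    by_cases h : M.gd K B g f < B
    · obtain ⟨l, h1, h2⟩ := M.exists_walk h
      rw [← h2]
      simpa using M.gd_le_of_walk (B := B) h1.reverse
    · exact (M.gd_le_cap f g).trans (not_lt.mp h)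
  exact le_antisymm (key f g) (key g f)

theorem gd_triangle (f g h : M.Face) : M.gd K B f h ≤ M.gd K B f g + M.gd K B g h := by
  by_cases h1 : M.gd K B f g < B
  · by_cases h2 : M.gd K B g h < B
    · obtain ⟨l, h3, h4⟩ := M.exists_walk h1
      obtain ⟨l', h5, h6⟩ := M.exists_walk h2
      rw [← h4, ← h6, ← List.length_append]
      exact M.gd_le_of_walk (h3.append h5)
    · have := M.gd_le_cap (K := K) (B := B) f h
      omega
  · have := M.gd_le_cap (K := K) (B := B) f h
    omega

theorem gd_rev_le {d : D} (h : ¬ (M.tail d ∈ K ∧ M.head d ∈ K)) :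
    M.gd K B (M.face d) (M.face (M.rev d)) ≤ 1 := M.gd_le_of_walk (isWalk_single h)

theorem eq_of_gd_eq_zero {f g : M.Face} (hB : 0 < B) (h : M.gd K B f g = 0) : f = g := by
  obtain ⟨l, h1, h2⟩ := M.exists_walk (h ▸ hB : M.gd K B f g < B)
  rw [h, List.length_eq_zero_iff] at h2
  subst h2
  exact h1

/-- The last step of a shortest path. -/
theorem exists_dart_gd {f g : M.Face} {k : ℕ} (hk : k + 1 < B) (h : M.gd K B f g = k + 1) :
    ∃ d, ¬ (M.tail d ∈ K ∧ M.head d ∈ K) ∧ M.face (M.rev d) = g ∧ M.gd K B f (M.face d) = k := by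
  rw [gd_comm] at h
  obtain ⟨l, h1, h2⟩ := M.exists_walk (h ▸ hk : M.gd K B g f < B)
  rw [h] at h2
  cases l with
  | nil => simp at h2
  | cons d l =>
    refine ⟨M.rev d, ?_, by rw [rev_rev']; exact h1.1, ?_⟩
    · rw [tail_rev, head_rev, and_comm]; exact h1.2.1
    · have h3 := M.gd_le_of_walk (B := B) h1.2.2
      have h4 := M.gd_triangle (K := K) (B := B) g (M.face (M.rev d)) f
      have h5 : M.gd K B g (M.face (M.rev d)) ≤ 1 := by
        rw [← h1.1]; exact M.gd_rev_le h1.2.1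
      rw [gd_comm]
      simp only [List.length_cons] at h2
      omega

/-- The cochain of a list of darts. -/
noncomputable def chain (l : List D) (d : D) : ZMod 2 := (l.map fun a => M.edgeInd a d).sum

theorem chain_nil : M.chain [] = 0 := rfl

theorem chain_cons (a : D) (l : List D) : M.chain (a :: l) = M.edgeInd a + M.chain l := by
  ext d; simp [chain]

theorem chain_symm (l : List D) (d : D) : M.chain l (M.rev d) = M.chain l d := by
  unfold chain
  simp only [M.edgeInd_symm]

theorem chain_eq_zero {l : List D} {d : D} (h1 : d ∉ l) (h2 : M.rev d ∉ l) :
    M.chain l d = 0 := by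
  unfold chain
  refine List.sum_eq_zero fun x hx => ?_
  obtain ⟨a, ha, rfl⟩ := List.mem_map.mp hx
  unfold edgeInd
  rw [if_neg]
  rintro (rfl | rfl)
  · exact h1 ha
  · rw [rev_rev'] at h2; exact h2 ha

theorem chain_eq_ite {l : List D} (hl : l.Nodup) (hr : ∀ a ∈ l, M.rev a ∉ l) (d : D) :
    M.chain l d = if d ∈ l ∨ M.rev d ∈ l then 1 else 0 := by
  induction l with
  | nil => simp [chain]
  | cons a l ih =>
    rw [List.nodup_cons] at hl
    rw [chain_cons, Pi.add_apply, ih hl.2 fun x hx h => hr x (by simp [hx]) (by simp [h])]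
    have h1 : M.rev d = a ↔ d = M.rev a :=
      ⟨fun h => by rw [← h, M.rev_rev], fun h => by rw [h, M.rev_rev]⟩
    by_cases h2 : d = a ∨ d = M.rev a
    · have h3 : ¬ (d ∈ l ∨ M.rev d ∈ l) := by
        rcases h2 with rfl | rfl
        · rintro (h | h)
          · exact hl.1 h
          · exact hr d (by simp) (by simp [h])
        · rw [rev_rev']
          rintro (h | h)
          · exact hr a (by simp) (by simp [h])
          · exact hl.1 h
      rw [if_neg h3, edgeInd, if_pos h2, if_pos, add_zero]
      simp only [List.mem_cons, h1]
      tauto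
    · rw [edgeInd, if_neg h2, zero_add]
      congr 1
      simp only [List.mem_cons, h1, eq_iff_iff]
      tauto

theorem card_chain_le (l : List D) :
    (univ.filter fun d => M.chain l d ≠ 0).card ≤ 2 * l.length := by
  have h : (univ.filter fun d => M.chain l d ≠ 0) ⊆ l.toFinset ∪ (l.map M.rev).toFinset := by
    intro d hd
    simp only [Finset.mem_filter, Finset.mem_univ, true_and] at hd
    by_contra h1
    simp only [Finset.mem_union, List.mem_toFinset, List.mem_map, not_or] at h1
    refine hd (M.chain_eq_zero h1.1 fun h2 => h1.2 ⟨_, h2, M.rev_rev d⟩)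
  refine (Finset.card_le_card h).trans ((Finset.card_union_le _ _).trans ?_)
  have h1 := l.toFinset_card_le
  have h2 := (l.map M.rev).toFinset_card_le
  rw [List.length_map] at h2
  omega

theorem add_self_pi {A : Type} (x : A → ZMod 2) : x + x = 0 :=
  funext fun _ => CharTwo.add_self_eq_zero _

theorem faceSum_add (z z' : D → ZMod 2) :
    M.faceSum (z + z') = M.faceSum z + M.faceSum z' := by
  ext f; simp [faceSum, Finset.sum_add_distrib]

theorem faceSum_zero : M.faceSum (0 : D → ZMod 2) = 0 := by
  ext f; simp [faceSum]

theorem IsWalk.faceSum_chain {M : CMap V D} {f g : M.Face} {l : List D}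
    (h : M.IsWalk K f l g) : M.faceSum (M.chain l) = Pi.single f 1 + Pi.single g 1 := by
  induction l generalizing f with
  | nil => cases h; rw [chain_nil, faceSum_zero]; exact (add_self_pi _).symm
  | cons d l ih =>
    rw [chain_cons, faceSum_add, faceSum_edgeInd, ih h.2.2, h.1, add_assoc,
      ← add_assoc (Pi.single (M.face (M.rev d)) 1), add_self_pi, zero_add]

theorem card_le_add {z z' : D → ZMod 2} {a b : ℕ}
    (h : (univ.filter fun d => z d ≠ 0).card ≤ a)
    (h' : (univ.filter fun d => z' d ≠ 0).card ≤ b) :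
    (univ.filter fun d => (z + z') d ≠ 0).card ≤ a + b := by
  refine le_trans (Finset.card_le_card ?_) ((Finset.card_union_le _ _).trans (add_le_add h h'))
  intro d
  simp only [Finset.mem_filter, Finset.mem_univ, true_and, Finset.mem_union, Pi.add_apply]
  intro hd
  by_contra! h3
  exact hd (by rw [h3.1, h3.2, add_zero])

theorem closed_of_faceSum {z : D → ZMod 2} (h : ∀ d, z (M.rev d) = z d)
    (h0 : M.faceSum z = 0) : M.Closed z := ⟨h, fun f => congrFun h0 f⟩

/-- An oriented set of edges covered by a list is at most as large as the list. -/
theorem card_le_length {l : List D} {W : Finset D} (hW : ∀ d ∈ W, M.rev d ∉ W)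
    (h : ∀ d ∈ W, d ∈ l ∨ M.rev d ∈ l) : W.card ≤ l.length := by
  refine le_trans (Finset.card_le_card_of_injOn (t := l.toFinset)
    (fun d => if d ∈ l then d else M.rev d) ?_ ?_) l.toFinset_card_le
  · intro d hd
    simp only [Finset.mem_coe, List.mem_toFinset]
    split_ifs with h1
    · exact h1
    · exact (h d hd).resolve_left h1
  · intro a ha b hb hab
    simp only at hab
    split_ifs at hab with h1 h2 h2
    · exact hab
    · exact absurd ha (hab ▸ hW b hb)
    · exact absurd hb (hab ▸ hW a ha)
    · exact M.rev_injective hab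

end CMap

namespace CMap

open scoped Classical

variable {V D : Type}

/-- A disk whose complement has a long boundary, in a map without short essential cycles. -/
structure Setup (M : CMap V D) [Fintype D] (K O : Set V) (n : ℕ) where
  disk : M.Disk K O
  planar : M.Planarlike (100 * n)
  deg : ∀ v, (univ.filter fun d => M.tail d = v).card ≤ 4
  le_edg : 20 * n ≤ M.edg O K + 1
  edg_le : M.edg O K ≤ 20 * n
  le_n : 100 ≤ n
  b0 : D
  b0_mem : b0 ∈ M.out O

namespace Setup

variable {M : CMap V D} [Fintype D] {K O : Set V} {n : ℕ} (s : M.Setup K O n)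

include s

theorem notMem_O {v : V} (h : v ∈ K) : v ∉ O := Set.disjoint_left.mp s.disk.disj h

theorem notMem_K {v : V} (h : v ∈ O) : v ∉ K := fun h' => s.notMem_O h' h

theorem mem_out_iff {d : D} : d ∈ M.out O ↔ M.tail d ∈ O ∧ M.head d ∈ K := by
  constructor
  · rintro ⟨h1, h2⟩
    exact ⟨h1, (s.disk.head_mem d (Or.inr h1)).resolve_right h2⟩
  · rintro ⟨h1, h2⟩
    exact ⟨h1, s.notMem_O h2⟩

theorem sdiff_O : (K ∪ O) \ O = K := by
  ext v
  have := s.notMem_O (v := v)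
  simp only [Set.mem_sdiff, Set.mem_union]
  tauto

theorem card_out : (univ.filter fun d => d ∈ M.out O).card = M.edg O K := by
  unfold edg
  congr 1
  ext d
  simp only [Finset.mem_filter, Finset.mem_univ, true_and]
  exact s.mem_out_iff

theorem head_mem_of_tail {d : D} (h : M.tail d ∈ O) : M.head d ∈ K ∨ M.head d ∈ O :=
  s.disk.head_mem d (Or.inr h)

theorem tail_mem_of_face {d e : D} (h : M.face d = M.face e) (hd : M.tail d ∈ K ∪ O) :
    M.tail e ∈ K ∪ O := by
  obtain ⟨k, rfl⟩ := M.exists_pow_of_face_eq h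
  clear h
  induction k with
  | zero => exact hd
  | succ k ih => rw [pow_succ', Equiv.Perm.mul_apply, tail_phi]; exact s.disk.head_mem _ ih

theorem sameCycle {d : D} (hd : d ∈ M.out O) : (M.nxt O).SameCycle s.b0 d := by
  have hcl := M.closed_orbC s.b0_mem
  obtain ⟨t, ht⟩ := s.planar _ hcl (by
    have h1 : (univ.filter fun d => M.orbC O s.b0 d ≠ 0) ⊆
        (univ.filter fun d => d ∈ M.out O) ∪ (univ.filter fun d => d ∈ M.out O).image M.rev := by
      intro d hd
      simp only [Finset.mem_filter, Finset.mem_univ, true_and, Finset.mem_union,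
        Finset.mem_image, orbC, ne_eq, ite_eq_right_iff, one_ne_zero, imp_false, not_not] at hd ⊢
      rcases hd with h | h
      · exact Or.inl (M.sameCycle_mem_out s.b0_mem h)
      · exact Or.inr ⟨_, M.sameCycle_mem_out s.b0_mem h, M.rev_rev d⟩
    have h2 := Finset.card_le_card h1
    have h3 := Finset.card_union_le (univ.filter fun d => d ∈ M.out O)
      ((univ.filter fun d => d ∈ M.out O).image M.rev)
    have h4 := Finset.card_image_le (s := univ.filter fun d => d ∈ M.out O) (f := M.rev)
    have h5 := s.card_out
    have h6 := s.edg_le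
    omega)
  exact M.sameCycle_of_cob s.disk.connO (U := K ∪ O) (by rw [s.sdiff_O]; exact s.disk.connK)
    Set.subset_union_right s.disk.head_mem s.b0_mem ht hd

/-- The darts leaving `O` in cyclic order. -/
noncomputable def b (j : ℤ) : D := (M.nxt O ^ j) s.b0

/-- The faces around the boundary of `O`. -/
noncomputable def y (j : ℤ) : M.Face := M.face (s.b j)

theorem b_add_one (j : ℤ) : s.b (j + 1) = M.nxt O (s.b j) := by
  unfold b
  rw [add_comm, zpow_add, zpow_one, Equiv.Perm.mul_apply]

theorem b_mem (j : ℤ) : s.b j ∈ M.out O := M.sameCycle_mem_out s.b0_mem ⟨j, rfl⟩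

theorem tail_b (j : ℤ) : M.tail (s.b j) ∈ O := (s.b_mem j).1

theorem head_b (j : ℤ) : M.head (s.b j) ∈ K := (s.mem_out_iff.mp (s.b_mem j)).2

theorem exists_b {d : D} (hd : d ∈ M.out O) : ∃ j, s.b j = d := s.sameCycle hd

theorem face_rev_b (j : ℤ) : M.face (M.rev (s.b j)) = s.y (j + 1) := by
  rw [y, b_add_one, M.face_nxt (s.b_mem j)]

theorem b_eq_iff {i j : ℤ} : s.b i = s.b j ↔ (M.edg O K : ℤ) ∣ i - j := by
  have h1 : Function.minimalPeriod (M.nxt O • ·) s.b0 = M.edg O K := by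
    rw [MulAction.minimalPeriod_eq_card, ← s.card_out, Fintype.card_subtype]
    congr 1
    ext d
    simp only [Finset.mem_filter, Finset.mem_univ, true_and, MulAction.mem_orbit_iff]
    constructor
    · rintro ⟨⟨g, k, rfl⟩, rfl⟩
      exact M.sameCycle_mem_out s.b0_mem ⟨k, rfl⟩
    · intro hd
      obtain ⟨k, hk⟩ := s.sameCycle hd
      exact ⟨⟨_, k, rfl⟩, hk⟩
  rw [← h1, ← MulAction.zpow_smul_eq_iff_minimalPeriod_dvd, b, b, sub_eq_neg_add, zpow_add,
    mul_smul, zpow_neg, inv_smul_eq_iff]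
  rfl

theorem isWalk_arc (i : ℤ) (a : ℕ) :
    M.IsWalk K (s.y i) ((List.range a).map fun j : ℕ => s.b (i + j)) (s.y (i + a)) := by
  induction a with
  | zero => simp [IsWalk]
  | succ a ih =>
    rw [List.range_succ, List.map_append]
    refine ih.append ⟨rfl, fun h => s.notMem_K (s.tail_b _) h.1, ?_⟩
    rw [face_rev_b]
    show s.y _ = s.y _
    push_cast
    rw [add_assoc]

theorem nodup_arc (i : ℤ) {a : ℕ} (ha : a ≤ M.edg O K) :
    ((List.range a).map fun j : ℕ => s.b (i + j)).Nodup := by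
  refine List.Nodup.map_on ?_ List.nodup_range
  intro x hx y hy h
  rw [s.b_eq_iff] at h
  rw [List.mem_range] at hx hy
  obtain ⟨k, hk⟩ := h
  have h1 : (x : ℤ) - y = (M.edg O K : ℤ) * k := by rw [← hk]; ring
  have h2 : |(x : ℤ) - y| < M.edg O K := by rw [abs_lt]; omega
  have h3 : (x : ℤ) - y = 0 := Int.eq_zero_of_abs_lt_dvd ⟨k, h1⟩ h2
  omega

/-- A cochain vanishing inside `K` is the coboundary of a set of vertices of `O`. -/
theorem exists_set {z : D → ZMod 2} (hz : M.Closed z)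
    (hc : (univ.filter fun d => z d ≠ 0).card ≤ 100 * n)
    (hK : ∀ d, M.tail d ∈ K → M.head d ∈ K → z d = 0) :
    ∃ T ⊆ O, ∀ d, M.tail d ∈ K ∪ O →
      (z d ≠ 0 ↔ ¬ (M.tail d ∈ T ↔ M.head d ∈ T)) := by
  obtain ⟨t, rfl⟩ := s.planar z hz hc
  obtain ⟨k0, hk0⟩ := s.disk.nonemptyK
  have ht : ∀ v ∈ K, t v = t k0 := fun v hv =>
    (s.disk.connK v hv k0 hk0).const t fun d h1 h2 => CharTwo.add_eq_zero.mp (hK d h1 h2)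
  refine ⟨{v | v ∈ O ∧ t v ≠ t k0}, fun v hv => hv.1, fun d hd => ?_⟩
  have key : ∀ v ∈ K ∪ O, (v ∈ {v | v ∈ O ∧ t v ≠ t k0} ↔ t v ≠ t k0) := by
    rintro v (hv | hv)
    · simp [ht v hv]
    · simp [hv]
  rw [key _ hd, key _ (s.disk.head_mem d hd), cob]
  have : ∀ a b c : ZMod 2, a + b ≠ 0 ↔ ¬ (a ≠ c ↔ b ≠ c) := by decide
  exact this _ _ _

theorem le_length {i : ℤ} {a : ℕ} {l : List D} (hl : M.IsWalk K (s.y i) l (s.y (i + a)))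
    (ha : a ≤ M.edg O K) : a ≤ l.length ∨ M.edg O K ≤ a + l.length := by
  by_contra! hcon
  have h20 := s.edg_le
  set arc := (List.range a).map fun j : ℕ => s.b (i + j) with harc
  have harcl : arc.length = a := by simp [harc]
  have hw := s.isWalk_arc i a
  have harcO : ∀ d ∈ arc, d ∈ M.out O := by
    intro d hd
    obtain ⟨j, -, rfl⟩ := List.mem_map.mp hd
    exact s.b_mem _
  have hite := M.chain_eq_ite (s.nodup_arc i ha) fun d hd h =>
    M.rev_notMem_out (harcO d hd) (harcO _ h)
  rw [← harc] at hw hite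
  obtain ⟨T, hTO, hT⟩ := s.exists_set (z := M.chain arc + M.chain l)
    (M.closed_of_faceSum (fun d => by simp only [Pi.add_apply, chain_symm])
      (by rw [faceSum_add, hw.faceSum_chain, hl.faceSum_chain, add_self_pi]))
    ((card_le_add (M.card_chain_le arc) (M.card_chain_le l)).trans (by omega))
    (fun d h1 h2 => by
      rw [Pi.add_apply, M.chain_eq_zero, M.chain_eq_zero, add_zero]
      · exact fun h => hl.mem h ⟨h1, h2⟩
      · exact fun h => hl.mem h ⟨h2, by rw [head_rev]; exact h1⟩
      · exact fun h => s.notMem_K (harcO _ h).1 h1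
      · exact fun h => s.notMem_K (harcO _ h).1 h2)
  -- off the walk, the coboundary of `T` is the arc
  have hT1 : ∀ d, M.tail d ∈ K ∪ O → d ∉ l → M.rev d ∉ l →
      ((d ∈ arc ∨ M.rev d ∈ arc) ↔ ¬ (M.tail d ∈ T ↔ M.head d ∈ T)) := by
    intro d h1 h2 h3
    rw [← hT d h1, Pi.add_apply, M.chain_eq_zero h2 h3, add_zero, hite]
    simp [or_iff_not_imp_left]
  have hnK : ∀ v ∈ K, v ∉ T := fun v hv h => s.notMem_K (hTO h) hv
  set WK := univ.filter fun d => d ∈ M.out O ∧ (d ∈ l ∨ M.rev d ∈ l) with hWK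
  set WO := univ.filter fun d => M.tail d ∈ T ∧ M.head d ∈ O \ T with hWO
  have hWOl : ∀ d ∈ WO, d ∈ l ∨ M.rev d ∈ l := by
    intro d hd
    simp only [hWO, Finset.mem_filter, Finset.mem_univ, true_and, Set.mem_sdiff] at hd
    by_contra! h
    rcases (hT1 d (Or.inr (hTO hd.1)) h.1 h.2).mpr (by tauto) with h1 | h1
    · exact (harcO _ h1).2 hd.2.1
    · exact (harcO _ h1).2 (by rw [head_rev]; exact hTO hd.1)
  have hW : (WK ∪ WO).card ≤ l.length := by
    refine M.card_le_length ?_ ?_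
    · intro d hd hd'
      simp only [hWK, hWO, Finset.mem_union, Finset.mem_filter, Finset.mem_univ, true_and,
        out, Set.mem_setOf_eq, tail_rev, head_rev, Set.mem_sdiff] at hd hd'
      have h1 := @hTO (M.tail d)
      have h2 := @hTO (M.head d)
      tauto
    · intro d hd
      rcases Finset.mem_union.mp hd with h | h
      · simp only [hWK, Finset.mem_filter, Finset.mem_univ, true_and] at h
        exact h.2
      · exact hWOl d h
  rw [Finset.card_union_of_disjoint] at hW
  swap
  · rw [Finset.disjoint_left]
    intro d h1 h2
    simp only [hWK, hWO, Finset.mem_filter, Finset.mem_univ, true_and, Set.mem_sdiff] at h1 h2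
    exact h1.1.2 h2.2.1
  have hWOe : WO.card = M.edg T (O \ T) := by rw [hWO]; unfold edg; congr!
  have harcT : arc.toFinset ⊆ WK ∪ univ.filter fun d => M.tail d ∈ T ∧ M.head d ∈ K := by
    intro d hd
    rw [List.mem_toFinset] at hd
    have h1 := harcO d hd
    simp only [hWK, Finset.mem_union, Finset.mem_filter, Finset.mem_univ, true_and]
    by_cases h2 : d ∈ l ∨ M.rev d ∈ l
    · exact Or.inl ⟨h1, h2⟩
    · push Not at h2
      have h3 := (hT1 d (Or.inr h1.1) h2.1 h2.2).mp (Or.inl hd)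
      have h4 := (s.mem_out_iff.mp h1).2
      have h5 := hnK _ h4
      exact Or.inr ⟨by tauto, h4⟩
  have houtT : (univ.filter fun d => d ∈ M.out O) ⊆
      arc.toFinset ∪ (WK ∪ univ.filter fun d => M.tail d ∈ O \ T ∧ M.head d ∈ K) := by
    intro d hd
    simp only [hWK, Finset.mem_union, Finset.mem_filter, Finset.mem_univ, true_and,
      List.mem_toFinset, Set.mem_sdiff] at hd ⊢
    have h4 := (s.mem_out_iff.mp hd).2
    by_cases h2 : d ∈ l ∨ M.rev d ∈ l
    · exact Or.inr (Or.inl ⟨hd, h2⟩)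
    by_cases h3 : d ∈ arc
    · exact Or.inl h3
    push Not at h2
    have h5 := hnK _ h4
    have h6 := (hT1 d (Or.inr hd.1) h2.1 h2.2).not.mp (by
      rintro (h | h)
      · exact h3 h
      · exact M.rev_notMem_out hd (harcO _ h))
    exact Or.inr (Or.inr ⟨⟨hd.1, by tauto⟩, h4⟩)
  have h1 := Finset.card_le_card harcT
  have h2 := Finset.card_union_le WK (univ.filter fun d => M.tail d ∈ T ∧ M.head d ∈ K)
  have h3 := Finset.card_le_card houtT
  have h4 := Finset.card_union_le arc.toFinset
    (WK ∪ univ.filter fun d => M.tail d ∈ O \ T ∧ M.head d ∈ K)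
  have h5 := Finset.card_union_le WK (univ.filter fun d => M.tail d ∈ O \ T ∧ M.head d ∈ K)
  rw [s.card_out] at h3
  have h6 : arc.toFinset.card = a := by
    rw [List.toFinset_card_of_nodup (s.nodup_arc i ha), harcl]
  have h7 := s.disk.geo T hTO
  have h8 : M.edg T K = (univ.filter fun d => M.tail d ∈ T ∧ M.head d ∈ K).card := by
    unfold edg; congr!
  have h9 : M.edg (O \ T) K = (univ.filter fun d => M.tail d ∈ O \ T ∧ M.head d ∈ K).card := by
    unfold edg; congr!
  omega

/-- The faces around the boundary are as far apart as along the boundary. -/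
theorem le_gd (i : ℤ) (a : ℕ) (ha : a ≤ M.edg O K) :
    a ≤ M.gd K (100 * n) (s.y i) (s.y (i + a)) ∨
      M.edg O K ≤ a + M.gd K (100 * n) (s.y i) (s.y (i + a)) := by
  have h20 := s.edg_le
  by_cases h : M.gd K (100 * n) (s.y i) (s.y (i + a)) < 100 * n
  · obtain ⟨l, h1, h2⟩ := M.exists_walk h
    have := s.le_length h1 ha
    omega
  · left; omega

theorem gd_le (i : ℤ) (a : ℕ) : M.gd K (100 * n) (s.y i) (s.y (i + a)) ≤ a := by
  simpa using M.gd_le_of_walk (B := 100 * n) (s.isWalk_arc i a)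

theorem y_eq_iff {i j : ℤ} : s.y i = s.y j ↔ (M.edg O K : ℤ) ∣ i - j := by
  constructor
  · intro h
    have hL : (0 : ℤ) < M.edg O K := by have := s.le_edg; have := s.le_n; omega
    obtain ⟨a, ha⟩ := Int.eq_ofNat_of_zero_le (Int.emod_nonneg (j - i) hL.ne')
    have h2 := Int.emod_lt_of_pos (j - i) hL
    have h3 : s.b (i + a) = s.b j := by
      rw [s.b_eq_iff, ← ha]
      exact ⟨-((j - i) / M.edg O K), by linarith [Int.emod_add_mul_ediv (j - i) (M.edg O K)]⟩
    have h4 : s.y (i + a) = s.y i := by rw [y, h3, h]; rfl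
    have h5 := s.le_length (i := i) (a := a) (l := []) h4.symm (by omega)
    simp only [List.length_nil] at h5
    have : a = 0 := by omega
    rw [this, Nat.cast_zero] at ha
    rw [← neg_sub, dvd_neg]
    exact Int.dvd_of_emod_eq_zero ha
  · intro h
    rw [y, y, s.b_eq_iff.mpr h]

theorem eq_b_of_face {d : D} (hd : d ∈ M.out O) {j : ℤ} (h : M.face d = s.y j) : d = s.b j := by
  obtain ⟨i, rfl⟩ := s.exists_b hd
  exact s.b_eq_iff.mpr (s.y_eq_iff.mp h)

theorem eq_b_of_face_rev {d : D} (hd : d ∈ M.out O) {j : ℤ} (h : M.face (M.rev d) = s.y j) :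
    d = s.b (j - 1) := by
  obtain ⟨i, rfl⟩ := s.exists_b hd
  rw [face_rev_b, y_eq_iff] at h
  rw [b_eq_iff]
  rwa [show i - (j - 1) = i + 1 - j by ring]

end Setup

end CMap

theorem cons_lt_iff {a b : ℕ} {l l' : List ℕ} :
    a :: l < b :: l' ↔ a < b ∨ a = b ∧ l < l' := List.cons_lt_cons_iff

theorem cons_le_iff {a b : ℕ} {l l' : List ℕ} :
    a :: l ≤ b :: l' ↔ a < b ∨ a = b ∧ l ≤ l' := by
  rw [← not_lt, ← not_lt, cons_lt_iff]
  grind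

theorem nil_lt_iff {l : List ℕ} : [] < l ↔ l ≠ [] := by
  cases l <;> simp

theorem nil_le' (l : List ℕ) : [] ≤ l := by
  rw [← not_lt]; simp

theorem le_of_prefix {l κ : List ℕ} (h : l <+: κ) : l ≤ κ := by
  obtain ⟨t, rfl⟩ := h
  induction l with
  | nil => exact nil_le' _
  | cons a l ih => rw [List.cons_append, cons_le_iff]; exact Or.inr ⟨rfl, ih⟩

theorem prefix_of_le_of_lt {l κ : List ℕ} {n : ℕ} (h : l ≤ κ) (h' : κ < l ++ [n]) : l <+: κ := by
  induction l generalizing κ with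
  | nil => exact List.nil_prefix
  | cons a l ih =>
    cases κ with
    | nil => exact absurd (nil_lt_iff.mpr (List.cons_ne_nil a l)) (not_lt.mpr h)
    | cons b κ =>
      rw [cons_le_iff] at h
      rw [List.cons_append, cons_lt_iff] at h'
      obtain rfl : a = b := by omega
      rw [List.cons_prefix_cons]
      exact ⟨rfl, ih (by simpa using h) (by simpa using h')⟩

theorem prefix_concat_iff_lt {l κ : List ℕ} {n : ℕ} :
    l ++ [n] <+: κ ↔ l ++ [n] ≤ κ ∧ κ < l ++ [n + 1] := by
  induction l generalizing κ with
  | nil =>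
    cases κ with
    | nil => simp
    | cons b κ =>
      rw [List.nil_append, List.nil_append, cons_le_iff, cons_lt_iff, List.cons_prefix_cons]
      have h1 := nil_le' κ
      simp [h1]
      omega
  | cons a l ih =>
    cases κ with
    | nil => simp
    | cons b κ =>
      rw [List.cons_append, List.cons_append, cons_le_iff, cons_lt_iff, List.cons_prefix_cons, ih]
      constructor
      · rintro ⟨rfl, h⟩; exact ⟨Or.inr ⟨rfl, h.1⟩, Or.inr ⟨rfl, h.2⟩⟩
      · rintro ⟨h1, h2⟩
        obtain rfl : a = b := by omega
        exact ⟨rfl, by simpa using h1, by simpa using h2⟩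

theorem lt_concat_zero_iff {l κ : List ℕ} : κ < l ++ [0] ↔ κ ≤ l := by
  induction l generalizing κ with
  | nil =>
    cases κ with
    | nil => simp
    | cons b κ => rw [List.nil_append, cons_lt_iff]; simp
  | cons a l ih =>
    cases κ with
    | nil => simp [nil_le']
    | cons b κ => rw [List.cons_append, cons_le_iff, cons_lt_iff, ih]

theorem append_lt_append {l κ : List ℕ} (h : κ < l) (h' : ¬ κ <+: l) (u v : List ℕ) :
    κ ++ u < l ++ v := by
  induction l generalizing κ with
  | nil => simp at h
  | cons a l ih =>
    cases κ with
    | nil => simp at h'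
    | cons b κ =>
      rw [cons_lt_iff] at h
      rw [List.cons_append, List.cons_append, cons_lt_iff]
      rcases h with h | ⟨rfl, h⟩
      · exact Or.inl h
      · exact Or.inr ⟨rfl, ih h fun h1 => h' (by rw [List.cons_prefix_cons]; exact ⟨rfl, h1⟩)⟩

theorem concat_lt_concat_iff {l : List ℕ} {m n : ℕ} : l ++ [m] < l ++ [n] ↔ m < n := by
  induction l with
  | nil => rw [List.nil_append, List.nil_append, cons_lt_iff]; simp
  | cons a l ih => rw [List.cons_append, List.cons_append, cons_lt_iff, ih]; simp

namespace CMap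

open scoped Classical

variable {V D : Type}

theorem exists_rot_pow (M : CMap V D) [Fintype D]
    (deg : ∀ v, (univ.filter fun d => M.tail d = v).card ≤ 4) {d e : D}
    (h : M.tail d = M.tail e) :
    ∃ k ≤ 2, (M.rot ^ k) d = e ∨ (M.rot ^ k) e = d := by
  obtain ⟨k, hk⟩ := (M.cyc d e h).exists_nat_pow_eq
  have hp : Function.minimalPeriod (M.rot • ·) d ≤ 4 := by
    refine le_trans ?_ (deg (M.tail d))
    rw [MulAction.minimalPeriod_eq_card, Fintype.card_subtype]
    refine Finset.card_le_card fun x => ?_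
    simp only [Finset.mem_filter, Finset.mem_univ, true_and, MulAction.mem_orbit_iff]
    rintro ⟨⟨g, k, rfl⟩, rfl⟩
    have h1 : ∀ k : ℕ, M.tail ((M.rot ^ k) d) = M.tail d := by
      intro k
      induction k with
      | zero => rfl
      | succ k ih => rw [pow_succ', Equiv.Perm.mul_apply, M.tail_rot, ih]
    obtain ⟨j, hj⟩ := (show M.rot.SameCycle d ((M.rot ^ k) d) from ⟨k, rfl⟩).exists_nat_pow_eq
    have h2 : M.tail ((M.rot ^ k) d) = M.tail d := by rw [← hj]; exact h1 j
    exact h2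
  have hpos : 0 < Function.minimalPeriod (M.rot • ·) d :=
    Nat.pos_of_ne_zero (MulAction.minimalPeriod_pos M.rot d).out
  have hmod : (M.rot ^ (k % Function.minimalPeriod (M.rot • ·) d)) d = e := by
    rw [← hk]
    exact MulAction.pow_smul_mod_minimalPeriod M.rot d k
  have hper : (M.rot ^ Function.minimalPeriod (M.rot • ·) d) d = d := by
    have h : M.rot ^ Function.minimalPeriod (M.rot • ·) d • d = d :=
      MulAction.pow_smul_eq_iff_minimalPeriod_dvd.mpr dvd_rfl
    exact h
  have hlt := Nat.mod_lt k hpos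
  set p := Function.minimalPeriod (M.rot • ·) d
  by_cases h2 : k % p ≤ 2
  · exact ⟨_, h2, Or.inl hmod⟩
  · have h3 : k % p = 3 := by omega
    have h4 : p = 4 := by omega
    refine ⟨1, by omega, Or.inr ?_⟩
    rw [← hmod, h3, ← Equiv.Perm.mul_apply, ← pow_add, show 1 + 3 = p by omega, hper]

namespace Setup

variable {M : CMap V D} [Fintype D] {K O : Set V} {n : ℕ} (s : M.Setup K O n)

include s

theorem not_inK {d : D} (h : M.tail d ∈ O) : ¬ (M.tail d ∈ K ∧ M.head d ∈ K) :=
  fun h' => s.notMem_K h h'.1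

theorem not_inK' {d : D} (h : M.head d ∈ O) : ¬ (M.tail d ∈ K ∧ M.head d ∈ K) :=
  fun h' => s.notMem_K h h'.2

/-- Around a vertex of `O` a Lipschitz function of the faces varies by at most two. -/
theorem le_add_two {g : M.Face → ℕ}
    (hg : ∀ d, ¬ (M.tail d ∈ K ∧ M.head d ∈ K) → g (M.face d) ≤ g (M.face (M.rev d)) + 1)
    {d e : D} (h : M.tail d = M.tail e) (hO : M.tail d ∈ O) :
    g (M.face d) ≤ g (M.face e) + 2 := by
  have step : ∀ k : ℕ, ∀ d : D, M.tail d ∈ O → M.tail ((M.rot ^ k) d) = M.tail d ∧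
      g (M.face ((M.rot ^ k) d)) ≤ g (M.face d) + k ∧
      g (M.face d) ≤ g (M.face ((M.rot ^ k) d)) + k := by
    intro k d hd
    induction k with
    | zero => simp
    | succ k ih =>
      obtain ⟨h1, h2, h3⟩ := ih
      rw [pow_succ', Equiv.Perm.mul_apply, M.tail_rot, M.face_rot]
      have h4 := hg ((M.rot ^ k) d) (s.not_inK (h1 ▸ hd))
      have h5 := hg (M.rev ((M.rot ^ k) d)) (s.not_inK' (by rw [head_rev]; exact h1 ▸ hd))
      rw [rev_rev'] at h5
      exact ⟨h1, by omega, by omega⟩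
  obtain ⟨k, hk, rfl | rfl⟩ := M.exists_rot_pow s.deg h
  · have := step k d hO
    omega
  · have := step k e (h ▸ hO)
    omega

/-- The distance of a face from the root. -/
noncomputable def dep (f : M.Face) : ℕ := M.gd K (100 * n) (s.y 0) f

theorem dep_root : s.dep (s.y 0) = 0 := M.gd_self _

theorem dep_eq_zero_iff {f : M.Face} : s.dep f = 0 ↔ f = s.y 0 :=
  ⟨fun h => (M.eq_of_gd_eq_zero (by have := s.le_n; omega) h).symm, fun h => h ▸ s.dep_root⟩

theorem gd_rev_le_one {d : D} (h : ¬ (M.tail d ∈ K ∧ M.head d ∈ K)) :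
    M.gd K (100 * n) (M.face d) (M.face (M.rev d)) ≤ 1 :=
  M.gd_rev_le h

theorem gd_lip (f : M.Face) {d : D} (h : ¬ (M.tail d ∈ K ∧ M.head d ∈ K)) :
    M.gd K (100 * n) f (M.face d) ≤ M.gd K (100 * n) f (M.face (M.rev d)) + 1 := by
  have h1 := M.gd_triangle (K := K) (B := 100 * n) f (M.face (M.rev d)) (M.face d)
  have h2 := s.gd_rev_le_one h
  rw [gd_comm] at h2
  omega

theorem dep_lip {d : D} (h : ¬ (M.tail d ∈ K ∧ M.head d ∈ K)) :
    s.dep (M.face d) ≤ s.dep (M.face (M.rev d)) + 1 := s.gd_lip _ h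

theorem dep_lip' {d : D} (h : ¬ (M.tail d ∈ K ∧ M.head d ∈ K)) :
    s.dep (M.face (M.rev d)) ≤ s.dep (M.face d) + 1 := by
  have := s.dep_lip (d := M.rev d) (by rw [tail_rev, head_rev, and_comm]; exact h)
  rwa [rev_rev'] at this

theorem dep_y_nat {j : ℕ} (hj : j ≤ 9 * n) : s.dep (s.y j) = j := by
  have h1 := s.gd_le 0 j
  have h2 := s.le_edg
  have h3 := s.le_gd 0 j (by have := s.le_n; omega)
  have h4 := s.le_n
  rw [zero_add] at h1 h3
  unfold dep
  omega

theorem dep_y_neg {j : ℕ} (hj : j ≤ 9 * n) : s.dep (s.y (-j)) = j := by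
  have h1 := s.gd_le (-j) j
  have h2 := s.le_edg
  have h3 := s.le_gd (-j) j (by have := s.le_n; omega)
  have h4 := s.le_n
  rw [neg_add_cancel, gd_comm] at h1 h3
  unfold dep
  omega

/-- Faces at finite depth lie in the component of `K ∪ O`. -/
theorem tail_mem_of_dep {d : D} (h : s.dep (M.face d) < 100 * n) : M.tail d ∈ K ∪ O := by
  obtain ⟨l, hl, -⟩ := M.exists_walk h
  have key : ∀ (l : List D) (f : M.Face), M.IsWalk K f l (M.face d) →
      (∀ e, M.face e = f → M.tail e ∈ K ∪ O) → M.tail d ∈ K ∪ O := by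
    intro l
    induction l with
    | nil => intro f h1 h2; exact h2 d h1.symm
    | cons e l ih =>
      intro f h1 h2
      refine ih _ h1.2.2 fun e' he' => s.tail_mem_of_face he'.symm ?_
      exact s.disk.head_mem e (h2 e h1.1)
  exact key l _ hl fun e he => s.tail_mem_of_face he.symm (Or.inr (s.tail_b 0))

/-- The depth of a vertex. -/
noncomputable def lam (v : V) : ℕ := sInf {k | ∃ d, M.tail d = v ∧ s.dep (M.face d) = k}

theorem lam_le (d : D) : s.lam (M.tail d) ≤ s.dep (M.face d) := Nat.sInf_le ⟨d, rfl, rfl⟩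

theorem lam_head_le (d : D) : s.lam (M.head d) ≤ s.dep (M.face d) := by
  have := s.lam_le (M.phi d)
  rwa [tail_phi, face_phi] at this

theorem exists_lam (d : D) : ∃ e, M.tail e = M.tail d ∧ s.dep (M.face e) = s.lam (M.tail d) :=
  Nat.sInf_mem (s := {k | ∃ e, M.tail e = M.tail d ∧ s.dep (M.face e) = k}) ⟨_, d, rfl, rfl⟩

theorem dep_le_lam {d : D} (h : M.tail d ∈ O) : s.dep (M.face d) ≤ s.lam (M.tail d) + 2 := by
  obtain ⟨e, h1, h2⟩ := s.exists_lam d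
  rw [← h2]
  exact s.le_add_two (fun d hd => s.dep_lip hd) h1.symm h

/-- The depth of a vertex, shifted so that `K` comes first. -/
noncomputable def lamK (v : V) : ℕ := if v ∈ K then 0 else s.lam v + 1

/-- The edge of a dart leads from a face to one nearer to the root. -/
def IsCand (x : M.Face) (t : D) : Prop :=
  ¬ (M.tail t ∈ K ∧ M.head t ∈ K) ∧ M.face (M.rev t) = x ∧ s.dep (M.face t) + 1 = s.dep x

theorem exists_pt (x : M.Face) : ∃ t, 0 < s.dep x → s.dep x < 100 * n → s.IsCand x t ∧
    ∀ t', s.IsCand x t' → min (s.lamK (M.tail t)) (s.lamK (M.head t)) ≤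
      min (s.lamK (M.tail t')) (s.lamK (M.head t')) := by
  by_cases h : 0 < s.dep x ∧ s.dep x < 100 * n
  · obtain ⟨k, hk⟩ := Nat.exists_eq_succ_of_ne_zero h.1.ne'
    obtain ⟨d, h1, h2, h3⟩ := M.exists_dart_gd (by omega) hk
    obtain ⟨t, ht, hmin⟩ := Finset.exists_min_image (univ.filter fun t => s.IsCand x t)
      (fun t => min (s.lamK (M.tail t)) (s.lamK (M.head t)))
      ⟨d, by simp only [Finset.mem_filter, Finset.mem_univ, true_and]
             exact ⟨h1, h2, by rw [hk]; exact congrArg (· + 1) h3⟩⟩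
    simp only [Finset.mem_filter, Finset.mem_univ, true_and] at ht hmin
    exact ⟨t, fun _ _ => ⟨ht, hmin⟩⟩
  · exact ⟨s.b0, fun h1 h2 => absurd ⟨h1, h2⟩ h⟩

/-- The dart from the parent of a face to the face. -/
noncomputable def pt (x : M.Face) : D := (s.exists_pt x).choose

variable {x : M.Face}

theorem isCand_pt (h : 0 < s.dep x) (h' : s.dep x < 100 * n) : s.IsCand x (s.pt x) :=
  ((s.exists_pt x).choose_spec h h').1

theorem pt_min (h : 0 < s.dep x) (h' : s.dep x < 100 * n) {t : D} (ht : s.IsCand x t) :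
    min (s.lamK (M.tail (s.pt x))) (s.lamK (M.head (s.pt x))) ≤
      min (s.lamK (M.tail t)) (s.lamK (M.head t)) :=
  ((s.exists_pt x).choose_spec h h').2 t ht

theorem face_rev_pt (h : 0 < s.dep x) (h' : s.dep x < 100 * n) : M.face (M.rev (s.pt x)) = x :=
  (s.isCand_pt h h').2.1

theorem dep_face_pt (h : 0 < s.dep x) (h' : s.dep x < 100 * n) :
    s.dep (M.face (s.pt x)) + 1 = s.dep x := (s.isCand_pt h h').2.2

theorem pt_mem_K (h : 0 < s.dep x) (h' : s.dep x < 100 * n) {t : D} (ht : s.IsCand x t)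
    (htK : M.tail t ∈ K ∨ M.head t ∈ K) : s.pt x ∈ M.out O ∨ M.rev (s.pt x) ∈ M.out O := by
  have h1 := s.pt_min h h' ht
  have h2 := (s.isCand_pt h h').1
  have h3 : min (s.lamK (M.tail t)) (s.lamK (M.head t)) = 0 := by
    unfold lamK
    rcases htK with h | h <;> simp [h]
  have h4 : M.tail (s.pt x) ∈ K ∨ M.head (s.pt x) ∈ K := by
    by_contra! h4
    rw [h3] at h1
    simp [lamK, h4.1, h4.2] at h1
  have h5 : M.tail (s.pt x) ∈ K ∪ O :=
    s.tail_mem_of_dep (by have := s.dep_face_pt h h'; omega)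
  have h6 := s.disk.head_mem _ h5
  rw [s.mem_out_iff, s.mem_out_iff, tail_rev, head_rev]
  simp only [Set.mem_union] at h5 h6
  tauto

theorem pt_y_succ {j : ℕ} (hj : j + 1 ≤ 9 * n) : s.pt (s.y (j + 1)) = s.b j := by
  have hd := s.dep_y_nat hj
  push_cast at hd
  have hd0 := s.dep_y_nat (j := j) (by omega)
  have h1 : 0 < s.dep (s.y (j + 1)) := by omega
  have h2 : s.dep (s.y (j + 1)) < 100 * n := by omega
  have hc : s.IsCand (s.y (j + 1)) (s.b j) :=
    ⟨s.not_inK (s.tail_b _), s.face_rev_b _, by rw [hd]; exact congrArg (· + 1) hd0⟩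
  have h3 := s.face_rev_pt h1 h2
  have h4 := s.dep_face_pt h1 h2
  rcases s.pt_mem_K h1 h2 hc (Or.inr (s.head_b _)) with h | h
  · rw [s.eq_b_of_face_rev h h3]
    congr 1; ring
  · have h5 := s.eq_b_of_face h h3
    have h6 : s.pt (s.y (j + 1)) = M.rev (s.b (j + 1)) := by rw [← h5, M.rev_rev]
    rw [h6, s.face_rev_b, hd] at h4
    exfalso
    rcases Nat.lt_or_ge (j + 1) (9 * n) with h7 | h7
    · have h8 := s.dep_y_nat (j := j + 2) (by omega)
      push_cast at h8
      rw [show (j : ℤ) + 1 + 1 = j + 2 by ring] at h4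
      omega
    · have h8 := s.le_gd 0 (j + 2) (by have := s.le_edg; have := s.le_n; omega)
      rw [zero_add] at h8
      push_cast at h8
      change _ ≤ s.dep _ ∨ _ ≤ _ + s.dep _ at h8
      rw [show (j : ℤ) + 1 + 1 = j + 2 by ring] at h4
      have := s.le_edg
      have := s.le_n
      omega

theorem pt_y_neg {j : ℕ} (hj : j + 1 ≤ 8 * n) :
    s.pt (s.y (-(j + 1 : ℕ))) = M.rev (s.b (-(j + 1 : ℕ))) := by
  have hd := s.dep_y_neg (j := j + 1) (by omega)
  have hd0 := s.dep_y_neg (j := j) (by omega)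
  have h1 : 0 < s.dep (s.y (-(j + 1 : ℕ))) := by omega
  have h2 : s.dep (s.y (-(j + 1 : ℕ))) < 100 * n := by omega
  have hc : s.IsCand (s.y (-(j + 1 : ℕ))) (M.rev (s.b (-(j + 1 : ℕ)))) := by
    refine ⟨s.not_inK' (by rw [head_rev]; exact s.tail_b _), by rw [rev_rev']; rfl, ?_⟩
    rw [face_rev_b, hd, show -((j + 1 : ℕ) : ℤ) + 1 = -(j : ℤ) by push_cast; ring, hd0]
  have h3 := s.face_rev_pt h1 h2
  have h4 := s.dep_face_pt h1 h2
  rcases s.pt_mem_K h1 h2 hc (Or.inl (s.head_b _)) with h | h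
  · exfalso
    have h5 := s.eq_b_of_face_rev h h3
    have h8 := s.dep_y_neg (j := j + 2) (by have := s.le_n; omega)
    rw [h5] at h4
    change s.dep (s.y _) + 1 = _ at h4
    rw [show -((j + 1 : ℕ) : ℤ) - 1 = -((j + 2 : ℕ) : ℤ) by push_cast; ring] at h4
    omega
  · rw [← s.eq_b_of_face h h3, M.rev_rev]

/-- If some vertex of a face is two levels below it, then the parent edge of the face
has an end at that level, or in `K`. -/
theorem pt_low {d : D} (hd : M.tail d ∈ O) (hlam : s.lam (M.tail d) + 2 = s.dep (M.face d))
    (h' : s.dep (M.face d) < 100 * n) :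
    ∃ v, (v = M.tail (s.pt (M.face d)) ∨ v = M.head (s.pt (M.face d))) ∧
      (v ∈ K ∨ s.lam v + 2 ≤ s.dep (M.face d)) := by
  obtain ⟨e, he, hlam'⟩ := s.exists_lam d
  have hcand : ∃ t, s.IsCand (M.face d) t ∧ (M.tail t = M.tail d ∨ M.head t = M.tail d) := by
    have nb : ∀ c, M.tail c ∈ O → s.dep (M.face (M.rot c)) ≤ s.dep (M.face c) + 1 ∧
        s.dep (M.face c) ≤ s.dep (M.face (M.rot c)) + 1 := by
      intro c hc
      rw [M.face_rot]
      exact ⟨s.dep_lip' (s.not_inK hc), s.dep_lip (s.not_inK hc)⟩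
    obtain ⟨k, hk, h | h⟩ := M.exists_rot_pow s.deg he.symm
    · have h1 := nb d hd
      have h2 := nb (M.rot d) (by rw [M.tail_rot]; exact hd)
      have h3 : s.dep (M.face (M.rot d)) + 1 = s.dep (M.face d) := by
        interval_cases k
        · simp only [pow_zero, Equiv.Perm.coe_one, id_eq] at h; subst h; omega
        · simp only [pow_one] at h; subst h; omega
        · simp only [pow_two, Equiv.Perm.mul_apply] at h; subst h; omega
      refine ⟨M.rev d, ⟨s.not_inK' (by rw [head_rev]; exact hd), by rw [rev_rev'], ?_⟩,
        Or.inr (M.head_rev d)⟩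
      rw [← M.face_rot]; exact h3
    · have h1 := nb e (he ▸ hd)
      have h2 := nb (M.rot e) (by rw [M.tail_rot]; exact he ▸ hd)
      interval_cases k
      · simp only [pow_zero, Equiv.Perm.coe_one, id_eq] at h; subst h; omega
      · simp only [pow_one] at h; subst h; omega
      · simp only [pow_two, Equiv.Perm.mul_apply] at h
        subst h
        rw [M.tail_rot, M.tail_rot] at *
        refine ⟨M.rot e, ⟨s.not_inK (by rw [M.tail_rot]; exact hd), (M.face_rot _).symm, by omega⟩,
          Or.inl (M.tail_rot e)⟩
  obtain ⟨t, ht, htd⟩ := hcand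
  have h1 := s.pt_min (by omega) h' ht
  have h2 : min (s.lamK (M.tail t)) (s.lamK (M.head t)) ≤ s.lam (M.tail d) + 1 := by
    have h3 : s.lamK (M.tail d) = s.lam (M.tail d) + 1 := by simp [lamK, s.notMem_K hd]
    rcases htd with h | h
    · exact (min_le_left _ _).trans (by rw [h, h3])
    · exact (min_le_right _ _).trans (by rw [h, h3])
  have key : ∀ v, s.lamK v ≤ s.lam (M.tail d) + 1 → v ∈ K ∨ s.lam v + 2 ≤ s.dep (M.face d) := by
    intro v hv
    by_cases h : v ∈ K
    · exact Or.inl h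
    · right
      simp only [lamK, if_neg h] at hv
      omega
  rcases min_le_iff.mp (h1.trans h2) with h | h
  · exact ⟨_, Or.inl rfl, key _ h⟩
  · exact ⟨_, Or.inr rfl, key _ h⟩

end Setup

end CMap

namespace CMap

open scoped Classical

variable {V D : Type}

theorem ite_add_ite_ne_zero {p q r t : Prop} [Decidable p] [Decidable r] [Decidable t]
    [Decidable (p ∨ q)] (h1 : p → ¬ r) (h2 : q → ¬ t) (h3 : p → ¬ q) :
    ((if p ∨ q then (1 : ZMod 2) else 0) + (if r then 1 else 0) + (if t then 1 else 0) ≠ 0) ↔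
      ¬ (p ∨ r ↔ q ∨ t) := by
  have h11 : (1 : ZMod 2) + 1 = 0 := by decide
  by_cases hp : p <;> by_cases hq : q <;> by_cases hr : r <;> by_cases ht : t <;> simp_all

theorem parity_step {f A B P Q a b a' b' : Prop} (e3 : f ↔ ¬ (A ↔ B)) (e2 : f ↔ ¬ (P ↔ Q))
    (e4 : (a' ↔ a) ↔ ¬ P) (e5 : (b' ↔ b) ↔ ¬ Q) (ih : A ↔ ¬ (a ↔ b)) : B ↔ ¬ (a' ↔ b') := by
  rw [e3] at e2
  clear e3
  by_cases hP : P <;> by_cases hQ : Q <;> by_cases ha : a <;> by_cases hb : b <;>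
    simp_all

namespace Setup

variable {M : CMap V D} [Fintype D] {K O : Set V} {n : ℕ} (s : M.Setup K O n)

include s

/-- The dart at which the traversal of a face starts. -/
noncomputable def start (x : M.Face) : D :=
  if s.dep x = 0 then M.rev (s.b (-1)) else M.phi (M.rev (s.pt x))

theorem start_root : s.start (s.y 0) = M.rev (s.b (-1)) := if_pos s.dep_root

variable {x x' : M.Face}

theorem start_eq (h : 0 < s.dep x) : s.start x = M.phi (M.rev (s.pt x)) := if_neg h.ne'

theorem face_start (h : s.dep x < 100 * n) : M.face (s.start x) = x := by
  rcases Nat.eq_zero_or_pos (s.dep x) with h0 | h0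
  · rw [s.dep_eq_zero_iff.mp h0, start_root, face_rev_b, neg_add_cancel]
  · rw [s.start_eq h0, face_phi, s.face_rev_pt h0 h]

/-- The position of a dart in the traversal of its face. -/
noncomputable def idx (d : D) : ℕ := sInf {k | (M.phi ^ k) (s.start (M.face d)) = d}

variable {d e : D}

theorem idx_spec (h : s.dep (M.face d) < 100 * n) :
    (M.phi ^ s.idx d) (s.start (M.face d)) = d :=
  Nat.sInf_mem (s := {k | (M.phi ^ k) (s.start (M.face d)) = d})
    (M.exists_pow_of_face_eq (s.face_start h))

theorem idx_le {k : ℕ} (h : (M.phi ^ k) (s.start (M.face d)) = d) : s.idx d ≤ k :=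
  Nat.sInf_le h

theorem idx_start (h : s.dep x < 100 * n) : s.idx (s.start x) = 0 :=
  Nat.le_zero.mp (s.idx_le (by rw [s.face_start h]; rfl))

theorem idx_phi (h : s.dep (M.face d) < 100 * n) (h' : M.phi d ≠ s.start (M.face d)) :
    s.idx (M.phi d) = s.idx d + 1 := by
  refine le_antisymm (s.idx_le ?_) ?_
  · rw [M.face_phi, pow_succ', Equiv.Perm.mul_apply, s.idx_spec h]
  · have h1 := s.idx_spec (d := M.phi d) (by rwa [face_phi])
    rw [M.face_phi] at h1
    rcases hk : s.idx (M.phi d) with _ | k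
    · rw [hk] at h1
      exact absurd h1.symm h'
    · rw [hk, pow_succ', Equiv.Perm.mul_apply] at h1
      have := s.idx_le (M.phi.injective h1)
      omega

theorem eq_of_idx (h : s.dep (M.face d) < 100 * n) (hf : M.face d = M.face e)
    (hi : s.idx d = s.idx e) : d = e := by
  rw [← s.idx_spec h, ← s.idx_spec (d := e) (hf ▸ h), hi, hf]

theorem idx_le_of_wrap (h : s.dep (M.face d) < 100 * n) (h' : M.phi d = s.start (M.face d))
    (hf : M.face e = M.face d) : s.idx e ≤ s.idx d := by
  by_contra! hlt
  have h1 := s.idx_spec (d := e) (hf ▸ h)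
  have h2 : (M.phi ^ (s.idx d + 1)) (s.start (M.face d)) = s.start (M.face d) := by
    rw [pow_succ', Equiv.Perm.mul_apply, s.idx_spec h, h']
  have h3 := s.idx_le (d := e) (k := s.idx e - (s.idx d + 1)) (by
    rw [hf] at h1 ⊢
    rw [show s.idx e = s.idx e - (s.idx d + 1) + (s.idx d + 1) by omega, pow_add,
      Equiv.Perm.mul_apply, h2] at h1
    exact h1)
  omega

/-- The key of a face, with explicit recursion depth. -/
noncomputable def keyAux : ℕ → M.Face → List ℕ
  | 0, _ => []
  | k + 1, x => keyAux k (M.face (s.pt x)) ++ [s.idx (s.pt x)]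

/-- The key of a face: the positions of the darts leading to it in the tree. -/
noncomputable def key (x : M.Face) : List ℕ := s.keyAux (s.dep x) x

/-- The key of a dart. -/
noncomputable def dkey (d : D) : List ℕ := s.key (M.face d) ++ [s.idx d]

theorem dkey_eq (d : D) : s.dkey d = s.key (M.face d) ++ [s.idx d] := rfl

theorem key_root : s.key (s.y 0) = [] := by rw [key, dep_root]; rfl

theorem key_eq (h : 0 < s.dep x) (h' : s.dep x < 100 * n) : s.key x = s.dkey (s.pt x) := by
  rw [dkey, key, key, ← s.dep_face_pt h h']
  rfl

/-- Induction along the tree. -/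
theorem dep_induction {P : M.Face → Prop} (h0 : P (s.y 0))
    (hs : ∀ x, 0 < s.dep x → s.dep x < 100 * n → P (M.face (s.pt x)) → P x) (x : M.Face)
    (hx : s.dep x < 100 * n) : P x := by
  induction hk : s.dep x generalizing x with
  | zero => rw [s.dep_eq_zero_iff.mp hk]; exact h0
  | succ k ih =>
    have h1 := s.dep_face_pt (x := x) (by omega) hx
    exact hs x (by omega) hx (ih _ (by omega) (by omega))

theorem length_key (h : s.dep x < 100 * n) : (s.key x).length = s.dep x := by
  refine s.dep_induction (P := fun x => (s.key x).length = s.dep x) ?_ ?_ x h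
  · rw [key_root, dep_root]; rfl
  · intro x h0 h1 ih
    rw [s.key_eq h0 h1, dkey, List.length_append, ih, ← s.dep_face_pt h0 h1]
    rfl

theorem length_dkey (h : s.dep (M.face d) < 100 * n) :
    (s.dkey d).length = s.dep (M.face d) + 1 := by
  rw [dkey, List.length_append, s.length_key h]; rfl

theorem eq_of_key (h : s.dep x < 100 * n) (h' : s.dep x' < 100 * n) (hk : s.key x = s.key x') :
    x = x' := by
  have := s.dep_induction
    (P := fun x => ∀ x', s.dep x' < 100 * n → s.key x = s.key x' → x = x') ?_ ?_ x h
  · exact this x' h' hk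
  · intro x' h' hk
    have h1 := s.length_key h'
    rw [← hk, key_root] at h1
    exact (s.dep_eq_zero_iff.mp h1.symm).symm
  · intro x h0 h ih x' h' hk
    have h1 := s.length_key h'
    rw [← hk, s.length_key h] at h1
    have hk' := hk
    rw [s.key_eq h0 h, s.key_eq (h1 ▸ h0) h', dkey, dkey] at hk'
    obtain ⟨h2, h3⟩ := List.append_inj' hk' rfl
    have h4 := ih _ (by have := s.dep_face_pt (h1 ▸ h0) h'; omega) h2
    have h5 := s.eq_of_idx (by have := s.dep_face_pt h0 h; omega) h4 (by simpa using h3)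
    rw [← s.face_rev_pt h0 h, h5, s.face_rev_pt (h1 ▸ h0) h']

theorem eq_of_dkey (h : s.dep (M.face d) < 100 * n) (h' : s.dep (M.face e) < 100 * n)
    (hk : s.dkey d = s.dkey e) : d = e := by
  obtain ⟨h2, h3⟩ := List.append_inj' hk rfl
  exact s.eq_of_idx h (s.eq_of_key h h' h2) (by simpa using h3)

/-- The path from a face to the root, with explicit recursion depth. -/
noncomputable def tpAux : ℕ → M.Face → List D
  | 0, _ => []
  | k + 1, x => M.rev (s.pt x) :: tpAux k (M.face (s.pt x))

/-- The path from a face to the root in the tree. -/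
noncomputable def tp (x : M.Face) : List D := s.tpAux (s.dep x) x

theorem tp_root : s.tp (s.y 0) = [] := by rw [tp, dep_root]; rfl

theorem tp_eq (h : 0 < s.dep x) (h' : s.dep x < 100 * n) :
    s.tp x = M.rev (s.pt x) :: s.tp (M.face (s.pt x)) := by
  rw [tp, tp, ← s.dep_face_pt h h']
  rfl

theorem isWalk_tp (h : s.dep x < 100 * n) : M.IsWalk K x (s.tp x) (s.y 0) := by
  refine s.dep_induction (P := fun x => M.IsWalk K x (s.tp x) (s.y 0)) ?_ ?_ x h
  · rw [tp_root]; exact rfl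
  · intro x h0 h1 ih
    rw [s.tp_eq h0 h1]
    refine ⟨s.face_rev_pt h0 h1, ?_, by rwa [rev_rev']⟩
    rw [tail_rev, head_rev, and_comm]
    exact (s.isCand_pt h0 h1).1

theorem length_tp (h : s.dep x < 100 * n) : (s.tp x).length = s.dep x := by
  refine s.dep_induction (P := fun x => (s.tp x).length = s.dep x) ?_ ?_ x h
  · rw [tp_root, dep_root]; rfl
  · intro x h0 h1 ih
    rw [s.tp_eq h0 h1, List.length_cons, ih, s.dep_face_pt h0 h1]

/-- The darts on the tree path are reversed parent darts of ancestors. -/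
theorem mem_tp (h : s.dep x < 100 * n) (hd : d ∈ s.tp x) :
    ∃ z, 0 < s.dep z ∧ s.dep z < 100 * n ∧ s.key z <+: s.key x ∧ d = M.rev (s.pt z) := by
  refine s.dep_induction (P := fun x => d ∈ s.tp x → ∃ z, 0 < s.dep z ∧ s.dep z < 100 * n ∧
    s.key z <+: s.key x ∧ d = M.rev (s.pt z)) ?_ ?_ x h hd
  · rw [tp_root]; simp
  · intro x h0 h1 ih hd
    rw [s.tp_eq h0 h1, List.mem_cons] at hd
    rcases hd with rfl | hd
    · exact ⟨x, h0, h1, List.prefix_rfl, rfl⟩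
    · obtain ⟨z, h2, h3, h4, h5⟩ := ih hd
      refine ⟨z, h2, h3, h4.trans ?_, h5⟩
      rw [s.key_eq h0 h1]
      exact List.prefix_append _ _

theorem key_face_pt_prefix (h : 0 < s.dep x) (h' : s.dep x < 100 * n) :
    s.key (M.face (s.pt x)) <+: s.key x := by
  rw [s.key_eq h h']
  exact List.prefix_append _ _

theorem chain_tp (h : s.dep x < 100 * n) (hd : s.dep (M.face d) < 100 * n)
    (hw : M.phi d ≠ s.start (M.face d)) :
    M.chain (s.tp x) d = if s.dkey d <+: s.key x then 1 else 0 := by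
  refine s.dep_induction
    (P := fun x => M.chain (s.tp x) d = if s.dkey d <+: s.key x then 1 else 0) ?_ ?_ x h
  · rw [tp_root, key_root, if_neg]
    · rfl
    · simp [dkey]
  · intro x h0 h1 ih
    have h2 := s.dep_face_pt h0 h1
    rw [s.tp_eq h0 h1, chain_cons, Pi.add_apply, ih, edgeInd, rev_rev', s.key_eq h0 h1]
    simp only [s.dkey_eq (s.pt x), List.prefix_concat_iff]
    simp only [← s.dkey_eq]
    have h3 : d ≠ M.rev (s.pt x) := by
      rintro rfl
      rw [s.face_rev_pt h0 h1, s.start_eq h0] at hw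
      exact hw rfl
    have h4 : d = s.pt x ↔ s.dkey d = s.dkey (s.pt x) :=
      ⟨fun h => h ▸ rfl, s.eq_of_dkey hd (by omega)⟩
    have h5 : s.dkey d = s.dkey (s.pt x) → ¬ s.dkey d <+: s.key (M.face (s.pt x)) := by
      intro h h'
      have := h'.length_le
      rw [h, s.length_key (by omega), s.length_dkey (by omega)] at this
      omega
    simp only [h3, false_or, h4]
    split_ifs <;> grind

/-- A dart of the dual graph whose edge is not in the tree. -/
def IsChord (a : D) : Prop :=
  ¬ (M.tail a ∈ K ∧ M.head a ∈ K) ∧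
    ∀ x, 0 < s.dep x → s.dep x < 100 * n → s.pt x ≠ a ∧ s.pt x ≠ M.rev a

/-- The fundamental cycle of a chord. -/
noncomputable def fc (a : D) : D → ZMod 2 :=
  M.edgeInd a + M.chain (s.tp (M.face a)) + M.chain (s.tp (M.face (M.rev a)))

variable {a : D}

theorem closed_fc (h : s.dep (M.face a) < 100 * n) (h' : s.dep (M.face (M.rev a)) < 100 * n) :
    M.Closed (s.fc a) := by
  refine M.closed_of_faceSum (fun d => ?_) ?_
  · simp only [fc, Pi.add_apply, chain_symm, edgeInd_symm]
  · rw [fc, faceSum_add, faceSum_add, faceSum_edgeInd, (s.isWalk_tp h).faceSum_chain,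
      (s.isWalk_tp h').faceSum_chain]
    ext f
    simp only [Pi.add_apply, Pi.zero_apply]
    ring_nf
    reduce_mod_char

theorem isChord_rev (h : s.IsChord a) : s.IsChord (M.rev a) := by
  refine ⟨by rw [tail_rev, head_rev, and_comm]; exact h.1, fun x h0 h1 => ?_⟩
  rw [rev_rev']
  exact (h.2 x h0 h1).symm

theorem fc_ne_zero (h : s.dep (M.face a) < 100 * n) (h' : s.dep (M.face (M.rev a)) < 100 * n)
    (hd : s.fc a d ≠ 0) : d = a ∨ d = M.rev a ∨
      ∃ z, 0 < s.dep z ∧ s.dep z < 100 * n ∧ (d = s.pt z ∨ d = M.rev (s.pt z)) ∧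
        (s.key z <+: s.key (M.face a) ∨ s.key z <+: s.key (M.face (M.rev a))) := by
  by_contra! hc
  refine hd ?_
  have key : ∀ x, s.dep x < 100 * n →
      (∀ z, s.key z <+: s.key x → s.key z <+: s.key (M.face a) ∨
        s.key z <+: s.key (M.face (M.rev a))) → M.chain (s.tp x) d = 0 := by
    intro x hx hz
    refine M.chain_eq_zero (fun hm => ?_) fun hm => ?_ <;>
      obtain ⟨z, h1, h2, h3, h4⟩ := s.mem_tp hx hm
    · have := hc.2.2 z h1 h2 (Or.inr h4)
      exact (hz z h3).elim this.1 this.2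
    · have := hc.2.2 z h1 h2 (Or.inl (M.rev_injective h4))
      exact (hz z h3).elim this.1 this.2
  simp only [fc, Pi.add_apply]
  rw [key _ h fun z hz => Or.inl hz, key _ h' fun z hz => Or.inr hz, edgeInd, if_neg (by tauto),
    add_zero, add_zero]

theorem dkey_prefix_dkey {c : D} (ha : s.dep (M.face a) < 100 * n)
    (hc : s.dep (M.face c) < 100 * n) :
    s.dkey c <+: s.dkey a ↔ c = a ∨ s.dkey c <+: s.key (M.face a) := by
  rw [s.dkey_eq a, List.prefix_concat_iff, ← s.dkey_eq a]
  exact or_congr_left ⟨s.eq_of_dkey hc ha, fun h => h ▸ rfl⟩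

theorem dkey_lt_phi {c : D} (ha : s.dep (M.face a) < 100 * n) (hc : s.dep (M.face c) < 100 * n)
    (hw : M.phi c ≠ s.start (M.face c)) :
    (s.dkey a < s.dkey (M.phi c) ↔ s.dkey a < s.dkey c) ↔
      ¬ (c = a ∨ s.dkey c <+: s.key (M.face a)) := by
  have h2 : s.dkey c <+: s.dkey a ↔ s.dkey c ≤ s.dkey a ∧ s.dkey a < s.dkey (M.phi c) := by
    rw [s.dkey_eq (M.phi c), s.dkey_eq c, prefix_concat_iff_lt, M.face_phi, s.idx_phi hc hw]
  have h3 : s.dkey c < s.dkey (M.phi c) := by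
    rw [dkey, dkey, M.face_phi, s.idx_phi hc hw, concat_lt_concat_iff]
    omega
  rw [← s.dkey_prefix_dkey ha hc, h2, ← not_lt]
  have h4 : s.dkey a < s.dkey c → s.dkey a < s.dkey (M.phi c) := fun h => h.trans h3
  tauto

theorem not_dkey_prefix {c : D} (ha : s.dep (M.face c) < 100 * n) :
    ¬ s.dkey c <+: s.key (M.face c) := by
  intro h
  have := h.length_le
  rw [s.length_key ha, s.length_dkey ha] at this
  omega

theorem fc_ne_zero_iff {c : D} (hf : s.dep (M.face a) < 100 * n)
    (hf' : s.dep (M.face (M.rev a)) < 100 * n) (hc : s.dep (M.face c) < 100 * n)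
    (hw : M.phi c ≠ s.start (M.face c)) : s.fc a c ≠ 0 ↔
      ¬ ((c = a ∨ s.dkey c <+: s.key (M.face a)) ↔
        (c = M.rev a ∨ s.dkey c <+: s.key (M.face (M.rev a)))) := by
  have h2 : c = a → ¬ s.dkey c <+: s.key (M.face a) := by
    rintro rfl; exact s.not_dkey_prefix hc
  have h3 : c = M.rev a → ¬ s.dkey c <+: s.key (M.face (M.rev a)) := by
    rintro rfl; exact s.not_dkey_prefix hc
  have h4 : c = a → c ≠ M.rev a := by rintro rfl; exact (M.rev_ne _).symm
  simp only [fc, Pi.add_apply, edgeInd, s.chain_tp hf hc hw, s.chain_tp hf' hc hw]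
  exact ite_add_ite_ne_zero h2 h3 h4

theorem card_fc_le (h : s.dep (M.face a) ≤ 10 * n) (h' : s.dep (M.face (M.rev a)) ≤ 10 * n) :
    (univ.filter fun d => s.fc a d ≠ 0).card ≤ 100 * n := by
  have hn := s.le_n
  have h1 : (univ.filter fun d => M.edgeInd a d ≠ 0).card ≤ 2 := by
    refine (Finset.card_le_card (t := {a, M.rev a}) fun d hd => ?_).trans Finset.card_le_two
    simp only [Finset.mem_filter, Finset.mem_univ, true_and] at hd
    simp only [Finset.mem_insert, Finset.mem_singleton]
    by_contra hc
    exact hd (if_neg hc)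
  refine (card_le_add (card_le_add h1 (M.card_chain_le _)) (M.card_chain_le _)).trans ?_
  rw [s.length_tp (by omega), s.length_tp (by omega)]
  omega

theorem fc_self (ha : s.IsChord a) (h : s.dep (M.face a) < 100 * n)
    (h' : s.dep (M.face (M.rev a)) < 100 * n) : s.fc a a = 1 := by
  have key : ∀ x, s.dep x < 100 * n → M.chain (s.tp x) a = 0 := by
    intro x hx
    refine M.chain_eq_zero (fun hm => ?_) fun hm => ?_ <;>
      obtain ⟨z, h1, h2, -, h4⟩ := s.mem_tp hx hm
    · exact (ha.2 z h1 h2).2 (by rw [h4, rev_rev'])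
    · exact (ha.2 z h1 h2).1 (M.rev_injective h4.symm)
  simp only [fc, Pi.add_apply]
  rw [key _ h, key _ h', edgeInd, if_pos (Or.inl rfl), add_zero, add_zero]

/-- The region cut off by a fundamental cycle, in terms of keys. -/
theorem exists_region (ha : s.IsChord a) (h : s.dep (M.face a) ≤ 10 * n)
    (h' : s.dep (M.face (M.rev a)) ≤ 10 * n) :
    ∃ T ⊆ O, (∀ d, M.tail d ∈ K ∪ O →
        (s.fc a d ≠ 0 ↔ ¬ (M.tail d ∈ T ↔ M.head d ∈ T))) ∧
      ∀ c, s.dep (M.face c) < 100 * n →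
        (M.tail c ∈ T ↔ ¬ (s.dkey a < s.dkey c ↔ s.dkey (M.rev a) < s.dkey c)) := by
  have hn := s.le_n
  have hf : s.dep (M.face a) < 100 * n := by omega
  have hf' : s.dep (M.face (M.rev a)) < 100 * n := by omega
  have hcard := s.card_fc_le h h'
  have hK : ∀ d, M.tail d ∈ K → M.head d ∈ K → s.fc a d = 0 := by
    intro d h1 h2
    by_contra hd
    rcases s.fc_ne_zero hf hf' hd with rfl | rfl | ⟨z, h3, h4, h5, -⟩
    · exact ha.1 ⟨h1, h2⟩
    · exact (s.isChord_rev ha).1 ⟨h1, h2⟩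
    · have h6 := (s.isCand_pt h3 h4).1
      rcases h5 with rfl | rfl
      · exact h6 ⟨h1, h2⟩
      · rw [tail_rev] at h1; rw [head_rev] at h2; exact h6 ⟨h2, h1⟩
  obtain ⟨T, hTO, hT⟩ := s.exists_set (s.closed_fc hf hf') hcard hK
  refine ⟨T, hTO, hT, ?_⟩
  -- One step of the traversal of a face.
  have step : ∀ c, s.dep (M.face c) < 100 * n → M.phi c ≠ s.start (M.face c) →
      (M.tail c ∈ T ↔ ¬ (s.dkey a < s.dkey c ↔ s.dkey (M.rev a) < s.dkey c)) →
      (M.tail (M.phi c) ∈ T ↔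
        ¬ (s.dkey a < s.dkey (M.phi c) ↔ s.dkey (M.rev a) < s.dkey (M.phi c))) := by
    intro c hc hw ih
    have e2 := s.fc_ne_zero_iff hf hf' hc hw
    have e3 := hT c (s.tail_mem_of_dep hc)
    have e4 := s.dkey_lt_phi hf hc hw
    have e5 := s.dkey_lt_phi hf' hc hw
    rw [tail_phi]
    exact parity_step e3 e2 e4 e5 ih
  have main : ∀ x, s.dep x < 100 * n → ∀ c, M.face c = x →
      (M.tail c ∈ T ↔ ¬ (s.dkey a < s.dkey c ↔ s.dkey (M.rev a) < s.dkey c)) := by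
    have face : ∀ x, s.dep x < 100 * n → (M.tail (s.start x) ∈ T ↔
        ¬ (s.dkey a < s.dkey (s.start x) ↔ s.dkey (M.rev a) < s.dkey (s.start x))) →
        ∀ c, M.face c = x →
        (M.tail c ∈ T ↔ ¬ (s.dkey a < s.dkey c ↔ s.dkey (M.rev a) < s.dkey c)) := by
      intro x hx h0 c hc
      subst hc
      have : ∀ k ≤ s.idx c, (M.tail ((M.phi ^ k) (s.start (M.face c))) ∈ T ↔
          ¬ (s.dkey a < s.dkey ((M.phi ^ k) (s.start (M.face c))) ↔
            s.dkey (M.rev a) < s.dkey ((M.phi ^ k) (s.start (M.face c))))) := by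
        intro k hk
        induction k with
        | zero => exact h0
        | succ k ih =>
          rw [pow_succ', Equiv.Perm.mul_apply]
          have hfk : M.face ((M.phi ^ k) (s.start (M.face c))) = M.face c := by
            rw [face_pow, s.face_start hx]
          refine step _ (by rw [hfk]; exact hx) (fun hw => ?_) (ih (by omega))
          have h1 := s.idx_le_of_wrap (e := c) (by rw [hfk]; exact hx) hw hfk.symm
          have h2 := s.idx_le (d := (M.phi ^ k) (s.start (M.face c))) (k := k) (by rw [hfk])
          omega
      have := this _ le_rfl
      rwa [s.idx_spec hx] at this
    intro x hx
    refine s.dep_induction (P := fun x => ∀ c, M.face c = x →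
      (M.tail c ∈ T ↔ ¬ (s.dkey a < s.dkey c ↔ s.dkey (M.rev a) < s.dkey c))) ?_ ?_ x hx
    · have h0 : s.dep (s.y 0) < 100 * n := by rw [dep_root]; omega
      refine face _ h0 ?_
      have h1 : ∀ a, ¬ s.dkey a < s.dkey (s.start (s.y 0)) := by
        intro a ha
        rw [s.dkey_eq (s.start _), s.idx_start h0, s.face_start h0, key_root,
          lt_concat_zero_iff, ← not_lt, nil_lt_iff] at ha
        exact ha (by simp [dkey])
      have h2 : M.tail (s.start (s.y 0)) ∉ T := by
        rw [start_root]
        exact fun h => s.notMem_K (hTO h) (s.head_b _)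
      simp [h1, h2]
    · intro x h0 h1 ih
      refine face _ h1 ?_
      have h2 := ih (s.pt x) rfl
      have h3 : ∀ a, s.dep (M.face a) < 100 * n → s.pt x ≠ a →
          (s.dkey a < s.dkey (s.start x) ↔ s.dkey a < s.dkey (s.pt x)) := by
        intro a ha hne
        rw [s.dkey_eq (s.start x), s.idx_start h1, s.face_start h1, lt_concat_zero_iff, s.key_eq h0 h1, le_iff_lt_or_eq,
          or_iff_left]
        intro h
        have := s.dep_face_pt h0 h1
        exact hne (s.eq_of_dkey ha (by omega) h).symm
      rw [h3 _ hf (ha.2 x h0 h1).1, h3 _ hf' (ha.2 x h0 h1).2, ← h2, s.start_eq h0, tail_phi,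
        head_rev]
  exact fun c hc => main _ hc c rfl

end Setup

end CMap

namespace CMap

open scoped Classical

variable {V D : Type}

/-- A dual walk from a face outside a region to a face inside it meets a face whose boundary
crosses the boundary of the region. -/
theorem IsWalk.exists_cross {M : CMap V D} [Fintype D] {K : Set V} (T : Set V) {g f : M.Face}
    {l : List D} (hl : M.IsWalk K g l f) (hg : ∃ c, M.face c = g ∧ M.tail c ∉ T)
    (hf : ∀ c, M.face c = f → M.tail c ∈ T) :
    ∃ z l1 l2, M.IsWalk K g l1 z ∧ M.IsWalk K z l2 f ∧ l1.length + l2.length = l.length ∧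
      ∃ e, M.face e = z ∧ ¬ (M.tail e ∈ T ↔ M.head e ∈ T) := by
  have cross : ∀ c c', M.face c = M.face c' → M.tail c ∉ T → M.tail c' ∈ T →
      ∃ e, M.face e = M.face c ∧ ¬ (M.tail e ∈ T ↔ M.head e ∈ T) := by
    intro c c' h h1 h2
    by_contra! hc
    obtain ⟨k, rfl⟩ := M.exists_pow_of_face_eq h
    clear h
    induction k with
    | zero => exact h1 h2
    | succ k ih =>
      rw [pow_succ', Equiv.Perm.mul_apply, tail_phi] at h2
      exact ih ((hc _ (M.face_pow k c)).mpr h2)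
  induction l generalizing g with
  | nil =>
    cases hl
    obtain ⟨c, h1, h2⟩ := hg
    exact absurd (hf c h1) h2
  | cons e l ih =>
    obtain ⟨c, h1, h2⟩ := hg
    by_cases h : M.tail e ∈ T
    · obtain ⟨e', h3, h4⟩ := cross c e (h1.trans hl.1.symm) h2 h
      exact ⟨g, [], e :: l, rfl, hl, by simp, e', h3.trans h1, h4⟩
    · by_cases h' : M.head e ∈ T
      · exact ⟨g, [], e :: l, rfl, hl, by simp, e, hl.1, fun h'' => h (h''.mpr h')⟩
      · obtain ⟨z, l1, l2, h3, h4, h5, h6⟩ := ih hl.2.2 ⟨_, rfl, h'⟩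
        exact ⟨z, e :: l1, l2, ⟨hl.1, hl.2.1, h3⟩, h4, by simp; omega, h6⟩

namespace Setup

variable {M : CMap V D} [Fintype D] {K O : Set V} {n : ℕ} (s : M.Setup K O n)

include s

variable {x y z : M.Face} {d e : D}

theorem dep_le_add_gd (x y : M.Face) : s.dep y ≤ s.dep x + M.gd K (100 * n) x y :=
  M.gd_triangle _ _ _

/-- Every prefix of the key of a face is the key of an ancestor. -/
theorem exists_anc (hy : s.dep y < 100 * n) {p : List ℕ} (hp : p <+: s.key y) :
    ∃ z, s.dep z < 100 * n ∧ s.key z = p ∧ s.dep z + M.gd K (100 * n) z y ≤ s.dep y := by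
  refine s.dep_induction (P := fun y => p <+: s.key y → ∃ z, s.dep z < 100 * n ∧ s.key z = p ∧
    s.dep z + M.gd K (100 * n) z y ≤ s.dep y) ?_ ?_ y hy hp
  · intro hp
    rw [key_root, List.prefix_nil] at hp
    exact ⟨s.y 0, by rw [dep_root]; have := s.le_n; omega, by rw [key_root, hp],
      by rw [gd_self]; omega⟩
  · intro y h0 h1 ih hp
    rw [s.key_eq h0 h1, dkey, List.prefix_concat_iff, ← dkey, ← s.key_eq h0 h1] at hp
    rcases hp with rfl | hp
    · exact ⟨y, h1, rfl, by rw [gd_self]; omega⟩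
    · obtain ⟨z, h2, h3, h4⟩ := ih hp
      refine ⟨z, h2, h3, ?_⟩
      have h5 := M.gd_triangle (K := K) (B := 100 * n) z (M.face (s.pt y)) y
      have h6 := s.gd_rev_le_one (s.isCand_pt h0 h1).1
      rw [s.face_rev_pt h0 h1] at h6
      have h7 := s.dep_face_pt h0 h1
      omega

theorem gd_desc (hz : s.dep z < 100 * n) (hy : s.dep y < 100 * n) (h : s.key z <+: s.key y) :
    s.dep z + M.gd K (100 * n) z y ≤ s.dep y := by
  obtain ⟨z', h1, h2, h3⟩ := s.exists_anc hy h
  rwa [← s.eq_of_key h1 hz h2]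

/-- The reference distance. -/
noncomputable def d0 (y : M.Face) : ℕ := M.gd K (100 * n) (s.y (-n)) y

/-- The transversal coordinate, before truncation. -/
noncomputable def psib (f : M.Face) : ℕ :=
  sInf {k | ∃ y, s.dep y ≤ 4 * n ∧ s.key f ≤ s.key y ∧
    k = s.d0 y + ((s.dep f - s.dep y) + (s.dep y - s.dep f))}

/-- The transversal coordinate of a face. -/
noncomputable def psi (f : M.Face) : ℕ :=
  if s.dep f ≤ 4 * n then min (s.psib f) (3 * n) else 3 * n

theorem psib_le (h : s.dep y ≤ 4 * n) (h' : s.key x ≤ s.key y) :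
    s.psib x ≤ s.d0 y + ((s.dep x - s.dep y) + (s.dep y - s.dep x)) :=
  Nat.sInf_le ⟨y, h, h', rfl⟩

theorem psib_le_d0 (h : s.dep x ≤ 4 * n) : s.psib x ≤ s.d0 x :=
  (s.psib_le h le_rfl).trans (by omega)

theorem exists_psib (h : s.dep x ≤ 4 * n) : ∃ y, s.dep y ≤ 4 * n ∧ s.key x ≤ s.key y ∧
    s.psib x = s.d0 y + ((s.dep x - s.dep y) + (s.dep y - s.dep x)) :=
  Nat.sInf_mem (s := {k | ∃ y, s.dep y ≤ 4 * n ∧ s.key x ≤ s.key y ∧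
    k = s.d0 y + ((s.dep x - s.dep y) + (s.dep y - s.dep x))}) ⟨_, x, h, le_rfl, rfl⟩

theorem d0_le (x y : M.Face) : s.d0 y ≤ s.d0 x + M.gd K (100 * n) x y := M.gd_triangle _ _ _

theorem dep_le_psib (h : s.dep x ≤ 4 * n) : s.dep x ≤ s.psib x + n := by
  obtain ⟨y, h1, h2, h3⟩ := s.exists_psib h
  have h4 := s.dep_le_add_gd (s.y (-n)) y
  rw [s.dep_y_neg (by omega)] at h4
  change _ ≤ _ + s.d0 y at h4
  omega

theorem psib_lip (h : ¬ (M.tail d ∈ K ∧ M.head d ∈ K)) (hd : s.dep (M.face d) ≤ 4 * n)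
    (hd' : s.dep (M.face (M.rev d)) ≤ 4 * n) :
    s.psib (M.face d) ≤ s.psib (M.face (M.rev d)) + 1 := by
  have hn := s.le_n
  have l1 := s.dep_lip h
  have l2 := s.dep_lip' h
  have hg := s.gd_rev_le_one h
  have hg' := hg
  rw [gd_comm] at hg'
  have hb := s.psib_le_d0 hd
  obtain ⟨y, hy, hk, he⟩ := s.exists_psib hd'
  rw [he]
  by_cases h1 : s.key (M.face d) ≤ s.key y
  · have := s.psib_le hy h1
    omega
  rw [not_le] at h1
  by_cases h2 : s.key (M.face (M.rev d)) <+: s.key y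
  · have h3 := s.gd_desc (by omega) (by omega) h2
    rw [gd_comm] at h3
    have h4 := s.d0_le y (M.face (M.rev d))
    have h5 := s.d0_le (M.face (M.rev d)) (M.face d)
    omega
  by_cases h3 : s.key y <+: s.key (M.face d)
  · have h4 := s.gd_desc (by omega) (by omega) h3
    have h5 := s.d0_le y (M.face d)
    omega
  have hch : s.IsChord d := by
    refine ⟨h, fun x h0 h1' => ⟨?_, ?_⟩⟩
    · rintro rfl
      rw [s.face_rev_pt h0 h1', s.key_eq h0 h1'] at hk
      exact absurd (hk.trans_lt h1) (not_lt.mpr (le_of_prefix (List.prefix_append _ _)))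
    · intro h4
      have h5 := s.face_rev_pt h0 h1'
      rw [h4, rev_rev'] at h5
      have h6 := s.key_eq h0 h1'
      rw [h4, ← h5, dkey] at h6
      rw [h6] at h1
      exact h2 (prefix_of_le_of_lt hk h1)
  by_cases h4 : s.d0 y < 100 * n
  swap
  · have : s.d0 (M.face d) ≤ 100 * n := M.gd_le_cap _ _
    omega
  obtain ⟨T, hTO, hT, hTk⟩ := s.exists_region hch (by omega) (by omega)
  have hyT : ∀ c, M.face c = y → M.tail c ∈ T := by
    rintro c rfl
    rw [hTk c (by omega)]
    have h5 : s.dkey (M.rev d) < s.dkey c := by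
      refine append_lt_append (lt_of_le_of_ne hk ?_) h2 _ _
      rintro h5
      exact h2 (h5 ▸ List.prefix_rfl)
    have h6 : s.dkey c < s.dkey d := append_lt_append h1 h3 _ _
    simp [h5, h6.le]
  obtain ⟨l, hl, hll⟩ := M.exists_walk h4
  obtain ⟨z, l1', l2', hl1, hl2, hlen, e, rfl, heT⟩ := hl.exists_cross T
    ⟨M.rev (s.b (-n - 1)), by rw [face_rev_b, sub_add_cancel],
      fun h => s.notMem_K (hTO h) (s.head_b _)⟩ hyT
  have g1 := M.gd_le_of_walk (B := 100 * n) hl1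
  have g2 := M.gd_le_of_walk (B := 100 * n) hl2
  have g4 := s.dep_le_add_gd (M.face e) y
  have g5 := s.dep_le_add_gd y (M.face e)
  rw [gd_comm] at g5
  change s.d0 (M.face e) ≤ _ at g1
  change _ = s.d0 y at hll
  have hze : s.dep (M.face e) < 100 * n ∧ (s.key (M.face e) <+: s.key (M.face d) ∨
      s.key (M.face e) <+: s.key (M.face (M.rev d))) := by
    have hO : M.tail e ∈ K ∪ O := by
      by_contra hO
      have h7 : M.head e ∉ K ∪ O := fun h7 => hO (by
        have := s.disk.head_mem (M.rev e) (by rwa [tail_rev])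
        rwa [head_rev] at this)
      exact heT ⟨fun h => absurd (Or.inr (hTO h)) hO, fun h => absurd (Or.inr (hTO h)) h7⟩
    rcases s.fc_ne_zero (by omega) (by omega) ((hT e hO).mpr heT) with
      rfl | rfl | ⟨z, h5, h6, rfl | rfl, h7⟩
    · exact ⟨by omega, Or.inl List.prefix_rfl⟩
    · exact ⟨by omega, Or.inr List.prefix_rfl⟩
    · have h8 := s.key_face_pt_prefix h5 h6
      have h9 := s.dep_face_pt h5 h6
      exact ⟨by omega, h7.imp h8.trans h8.trans⟩
    · rw [s.face_rev_pt h5 h6]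
      exact ⟨h6, h7⟩
  rcases hze with ⟨h5, h6 | h6⟩
  · have h7 := s.gd_desc h5 (by omega) h6
    have h8 := s.d0_le (M.face e) (M.face d)
    omega
  · have h7 := s.gd_desc h5 (by omega) h6
    have h8 := s.d0_le (M.face e) (M.face (M.rev d))
    have h9 := s.d0_le (M.face (M.rev d)) (M.face d)
    omega

theorem psi_lip (h : ¬ (M.tail d ∈ K ∧ M.head d ∈ K)) :
    s.psi (M.face d) ≤ s.psi (M.face (M.rev d)) + 1 := by
  have hn := s.le_n
  have l1 := s.dep_lip h
  unfold psi
  split_ifs with h1 h2 h2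
  · have := s.psib_lip h h1 h2
    omega
  · omega
  · have := s.dep_le_psib h2
    omega
  · omega

theorem psi_y_neg {l : ℕ} (hl : l ≤ 4 * n) : s.psi (s.y (-l)) ≤ (n - l) + (l - n) := by
  have h1 := s.dep_y_neg (j := l) (by omega)
  have h2 := s.psib_le_d0 (x := s.y (-l)) (by omega)
  have h3 : s.d0 (s.y (-l)) ≤ (n - l) + (l - n) := by
    rcases le_total l n with h | h
    · have := s.gd_le (-n) (n - l)
      rw [show -(n : ℤ) + (n - l : ℕ) = -l by push_cast [h]; ring] at this
      exact this.trans (by omega)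
    · have := s.gd_le (-l) (l - n)
      rw [show -(l : ℤ) + (l - n : ℕ) = -n by push_cast [h]; ring, gd_comm] at this
      exact this.trans (by omega)
  unfold psi
  rw [if_pos (by omega)]
  omega

/-- After the dart `b l`, a face `y l` only continues inside `K` before its last dart. -/
theorem not_idx_lt {l : ℕ} (hl : l ≤ 8 * n) (hf : M.face e = s.y l)
    (he : ¬ (M.tail e ∈ K ∧ M.head e ∈ K)) (hd : s.dep (M.face (M.rev e)) = l + 1)
    (hi : s.idx (s.b l) < s.idx e) : False := by
  have hn := s.le_n
  have hdep := s.dep_y_nat (j := l) (by omega)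
  have hfin : s.dep (M.face e) < 100 * n := by rw [hf]; omega
  have hp : ∀ c, M.face c = s.y l → M.tail c ∈ K → M.head c ∈ O → c = M.rev (s.b (l - 1)) := by
    intro c hc h1 h2
    have h3 : M.rev c ∈ M.out O := by
      rw [s.mem_out_iff, tail_rev, head_rev]; exact ⟨h2, h1⟩
    rw [← s.eq_b_of_face_rev h3 (by rwa [rev_rev']), rev_rev']
  have hsp := s.idx_spec hfin
  have key : ∀ j, s.idx (s.b l) < j → j ≤ s.idx e →
      M.tail ((M.phi ^ j) (s.start (M.face e))) ∈ K := by
    intro j h1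
    induction j, h1 using Nat.le_induction with
    | base =>
      intro _
      have h2 := s.idx_spec (d := s.b l) (by change s.dep (s.y l) < _; omega)
      change (M.phi ^ _) (s.start (s.y l)) = _ at h2
      rw [hf, pow_succ', Equiv.Perm.mul_apply, h2, tail_phi]
      exact s.head_b _
    | succ j hj ih =>
      intro h2
      have h3 := ih (by omega)
      have hfj : M.face ((M.phi ^ j) (s.start (M.face e))) = s.y l := by
        rw [face_pow, s.face_start hfin, hf]
      rw [pow_succ', Equiv.Perm.mul_apply, tail_phi]
      by_contra h4
      have h5 : M.head ((M.phi ^ j) (s.start (M.face e))) ∈ O := by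
        have := s.disk.head_mem _ (Or.inl h3)
        exact this.resolve_left h4
      have h6 := hp _ hfj h3 h5
      rcases Nat.eq_zero_or_pos l with rfl | hl0
      · have h7 : s.start (M.face e) = M.rev (s.b (-1)) := by
          rw [hf]; exact s.start_root
        have h8 := s.idx_le (d := e) (k := s.idx e - j) (by
          rw [show s.idx e = s.idx e - j + j by omega, pow_add, Equiv.Perm.mul_apply, h6] at hsp
          rw [h7]
          exact hsp)
        have h9 : j = 0 := by omega
        omega
      · have h7 : s.pt (s.y l) = s.b (l - 1) := by
          have := s.pt_y_succ (j := l - 1) (by omega)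
          rw [show ((l - 1 : ℕ) : ℤ) = l - 1 by push_cast [hl0]; ring, sub_add_cancel] at this
          exact this
        have h8 := s.idx_le_of_wrap (d := (M.phi ^ j) (s.start (M.face e))) (e := e)
          (by rw [hfj, ← hf]; exact hfin)
          (by rw [hfj, h6, s.start_eq (x := s.y l) (by omega), h7]) (by rw [hfj, hf])
        have h9 := s.idx_le (d := (M.phi ^ j) (s.start (M.face e))) (k := j) (by rw [hfj, hf])
        omega
  have h1 := key _ hi le_rfl
  rw [hsp] at h1
  have h2 : M.head e ∈ O := by
    have := s.disk.head_mem _ (Or.inl h1)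
    exact this.resolve_left fun h => he ⟨h1, h⟩
  have h3 := hp e hf h1 h2
  rcases Nat.eq_zero_or_pos l with rfl | hl0
  · have h4 : e = s.start (s.y 0) := by rw [s.start_root]; simpa using h3
    rw [h4, s.idx_start (by rw [dep_root]; omega)] at hi
    omega
  · rw [h3, rev_rev'] at hd
    change s.dep (s.y _) = _ at hd
    rw [show (l : ℤ) - 1 = (l - 1 : ℕ) by push_cast [hl0]; ring, s.dep_y_nat (by omega)] at hd
    omega

theorem prefix_of_key_y_le {l : ℕ} (hl : l ≤ 8 * n) (hy : s.dep y < 100 * n)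
    (h : s.key (s.y l) ≤ s.key y) : s.key (s.y l) <+: s.key y := by
  have hn := s.le_n
  induction l with
  | zero => rw [Nat.cast_zero, key_root]; exact List.nil_prefix
  | succ l ih =>
    have hd := s.dep_y_nat (j := l) (by omega)
    have hd' := s.dep_y_nat (j := l + 1) (by omega)
    have hk : s.key (s.y ((l + 1 : ℕ) : ℤ)) = s.key (s.y l) ++ [s.idx (s.b l)] := by
      rw [s.key_eq (by omega) (by omega), show ((l + 1 : ℕ) : ℤ) = l + 1 by push_cast; ring,
        s.pt_y_succ (by omega)]
      rfl
    rw [hk] at h ⊢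
    obtain ⟨r, hr⟩ := ih (by omega) ((le_of_prefix (List.prefix_append _ _)).trans h)
    rcases r with _ | ⟨i, r⟩
    · rw [List.append_nil] at hr
      rw [← hr] at h
      exact absurd h (not_le.mpr (lt_of_le_of_ne (le_of_prefix (List.prefix_append _ _))
        (by simp)))
    · obtain ⟨z, h1, h2, -⟩ := s.exists_anc hy (p := s.key (s.y l) ++ [i])
        ⟨r, by rw [← hr]; simp⟩
      have h3 : 0 < s.dep z := by
        rw [← s.length_key h1, h2]; simp
      have h4 := h2
      rw [s.key_eq h3 h1, dkey] at h4
      obtain ⟨h5, h6⟩ := List.append_inj' h4 rfl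
      have h7 := s.dep_face_pt h3 h1
      have h8 := s.eq_of_key (by omega) (by omega) h5
      have h9 : s.idx (s.pt z) = i := by simpa using h6
      have h10 : ¬ s.idx (s.b l) < i := by
        intro h10
        refine s.not_idx_lt (l := l) (by omega) h8 (s.isCand_pt h3 h1).1 ?_ (by omega)
        rw [s.face_rev_pt h3 h1, ← h7, h8, hd]
      have h11 : ¬ i < s.idx (s.b l) := by
        intro h11
        rw [← not_lt, ← hr] at h
        refine h ?_
        have h13 := append_lt_append (l := s.key (s.y l) ++ [s.idx (s.b l)])
          (κ := s.key (s.y l) ++ [i]) (concat_lt_concat_iff.mpr h11) (by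
            intro h
            have := h.eq_of_length (by simp)
            simp at this
            omega) r []
        simpa using h13
      have h12 : i = s.idx (s.b l) := by omega
      exact ⟨r, by rw [← hr, ← h12]; simp⟩

theorem psi_y {l : ℕ} (hl : l ≤ 2 * n) : s.psi (s.y l) = n + l := by
  have hn := s.le_n
  have h1 := s.dep_y_nat (j := l) (by omega)
  have h2 := s.psib_le_d0 (x := s.y l) (by omega)
  have h3 := s.gd_le (-n) (n + l)
  have h4 := s.le_gd (-n) (n + l) (by have := s.le_edg; omega)
  rw [show -(n : ℤ) + (n + l : ℕ) = l by push_cast; ring] at h3 h4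
  change s.d0 _ ≤ _ at h3
  change _ ≤ s.d0 _ ∨ _ ≤ _ + s.d0 _ at h4
  have h5 := s.le_edg
  obtain ⟨y, h6, h7, h8⟩ := s.exists_psib (x := s.y l) (by omega)
  have h9 := s.gd_desc (by omega) (by omega) (s.prefix_of_key_y_le (by omega) (by omega) h7)
  have h10 := s.d0_le y (s.y l)
  rw [gd_comm] at h10
  unfold psi
  rw [if_pos (by omega)]
  omega

end Setup

end CMap

namespace CMap

open scoped Classical

variable {V D : Type}

namespace Setup

variable {M : CMap V D} [Fintype D] {K O : Set V} {n : ℕ} (s : M.Setup K O n)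

include s

variable {i : ℕ} {c d e : D}

theorem y_add_edg (j : ℤ) : s.y (j + M.edg O K) = s.y j :=
  s.y_eq_iff.mpr (by simp)

theorem b_add_edg (j : ℤ) : s.b (j + M.edg O K) = s.b j :=
  s.b_eq_iff.mpr (by simp)

theorem le_dep_y (a : ℕ) (ha : a ≤ M.edg O K) :
    a ≤ s.dep (s.y a) ∨ M.edg O K ≤ a + s.dep (s.y a) := by
  have := s.le_gd 0 a ha
  rwa [zero_add] at this

theorem exists_b_nat (hd : d ∈ M.out O) : ∃ a : ℕ, a < M.edg O K ∧ d = s.b a := by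
  obtain ⟨j, rfl⟩ := s.exists_b hd
  have h1 := s.le_edg
  have h2 := s.le_n
  have h3 : (0 : ℤ) < M.edg O K := by omega
  refine ⟨(j % M.edg O K).toNat, ?_, ?_⟩
  · have := Int.emod_lt_of_pos j h3
    have := Int.emod_nonneg j h3.ne'
    omega
  · rw [Int.toNat_of_nonneg (Int.emod_nonneg j h3.ne')]
    exact s.b_eq_iff.mpr (Int.dvd_self_sub_emod)

theorem dep_y_le (j : ℤ) : s.dep (s.y j) ≤ 10 * n := by
  obtain ⟨a, h1, h2⟩ := s.exists_b_nat (s.b_mem j)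
  rw [y, h2, ← y]
  have h3 := s.gd_le 0 a
  rw [zero_add] at h3
  change s.dep _ ≤ _ at h3
  have h4 := s.gd_le a (M.edg O K - a)
  rw [show (a : ℤ) + (M.edg O K - a : ℕ) = 0 + M.edg O K by push_cast [h1.le]; ring,
    y_add_edg, gd_comm] at h4
  change s.dep _ ≤ _ at h4
  have h5 := s.edg_le
  omega

theorem lam_tail_b_le (j : ℤ) : s.lam (M.tail (s.b j)) ≤ s.dep (s.y j) := s.lam_le _

theorem dep_le_lam_head (h : M.head d ∈ O) : s.dep (M.face d) ≤ s.lam (M.head d) + 2 := by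
  have := s.dep_le_lam (d := M.phi d) (by rwa [tail_phi])
  rwa [tail_phi, face_phi] at this

theorem dep_y_le_lam (j : ℤ) : s.dep (s.y j) ≤ s.lam (M.tail (s.b j)) + 2 :=
  s.dep_le_lam (s.tail_b j)

/-- The vertices of `O` at depth at least `i`. -/
def hi (i : ℕ) : Set V := {v | v ∈ O ∧ i ≤ s.lam v}

/-- The `i`-th region: the component of the far vertex among the vertices at depth at least `i`. -/
def lev (i : ℕ) : Set V := M.compIn (s.hi i) (M.tail (s.b (5 * n : ℕ)))

theorem far_mem_hi (hi : i ≤ n) : M.tail (s.b (5 * n : ℕ)) ∈ s.hi i := by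
  refine ⟨s.tail_b _, ?_⟩
  have h1 := s.dep_y_nat (j := 5 * n) (by omega)
  have h2 := s.dep_y_le_lam (5 * n : ℕ)
  have := s.le_n
  omega

theorem lev_subset (hi : i ≤ n) : s.lev i ⊆ s.hi i := M.compIn_subset (s.far_mem_hi hi)

theorem lev_subset_O (hi : i ≤ n) : s.lev i ⊆ O := fun _ h => (s.lev_subset hi h).1

theorem conn_lev : M.Conn (s.lev i) := M.conn_compIn

theorem lev_exit (hi : i ≤ n) (hd : d ∈ M.out (s.lev i)) :
    M.head d ∈ K ∨ (M.head d ∈ O ∧ s.lam (M.head d) < i) := by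
  rcases s.head_mem_of_tail (s.lev_subset_O hi hd.1) with h | h
  · exact Or.inl h
  · refine Or.inr ⟨h, ?_⟩
    by_contra! h'
    exact hd.2 (M.head_mem_compIn (s.far_mem_hi hi) hd.1 ⟨h, h'⟩)

theorem lev_mono {i' : ℕ} (h : i ≤ i') : s.lev i' ⊆ s.lev i := by
  intro v hv
  exact ReachIn.mono (T := s.hi i') (T' := s.hi i) (fun u hu => ⟨hu.1, h.trans hu.2⟩) hv

theorem arc_step {j : ℤ} (hi : i ≤ n) (hj : i + 2 ≤ s.dep (s.y (j + 1))) :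
    (M.tail (s.b j) ∈ s.lev i ↔ M.tail (s.b (j + 1)) ∈ s.lev i) ∧
      (M.tail (s.b j) ∈ s.lev i → M.nxt (s.lev i) (s.b j) = s.b (j + 1)) := by
  obtain ⟨h1, k, h2, h3, h4⟩ := M.nxt_spec (s.b_mem j)
  rw [← b_add_one] at h1 h3
  have hmem : ∀ l, 1 ≤ l → l ≤ k → M.tail ((M.phi ^ l) (M.rev (s.b j))) ∈ s.hi i := by
    intro l h5 h6
    refine ⟨h4 l h5 h6, ?_⟩
    have h7 := s.dep_le_lam (h4 l h5 h6)
    rw [face_pow, face_rev_b] at h7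
    omega
  have hr : ∀ l, 1 ≤ l → l ≤ k →
      M.ReachIn (s.hi i) (M.tail (s.b j)) (M.tail ((M.phi ^ l) (M.rev (s.b j)))) := by
    intro l h5
    induction l, h5 using Nat.le_induction with
    | base =>
      intro _
      rw [pow_one, tail_phi, head_rev]
      exact .refl
    | succ l h5 ih =>
      intro h6
      refine (ih (by omega)).trans ?_
      have h7 := hmem (l + 1) (by omega) h6
      rw [pow_succ', Equiv.Perm.mul_apply, tail_phi] at h7 ⊢
      exact M.reachIn_dart (hmem l h5 (by omega)) h7
  refine ⟨⟨fun h => ?_, fun h => ?_⟩, fun h => ?_⟩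
  · rw [h3]
    exact h.trans (hr k h2 le_rfl)
  · rw [h3] at h
    exact h.trans (hr k h2 le_rfl).symm
  · exact M.nxt_eq_of ⟨h, fun h' => s.notMem_O (s.head_b j) (s.lev_subset_O hi h')⟩ h3.symm
      (fun h' => s.notMem_O (s.head_b _) (s.lev_subset_O hi h'))
      fun l h5 h6 => h.trans (hr l h5 h6)

theorem arc_dep {l : ℕ} (h : i + 2 ≤ l) (h' : l + i + 2 ≤ M.edg O K) :
    i + 2 ≤ s.dep (s.y l) := by
  have := s.le_dep_y l (by omega)
  omega

theorem tail_b_mem_lev (hi : i + 10 ≤ n) {l : ℕ} (h : i + 2 ≤ l) (h' : l + i + 3 ≤ M.edg O K) :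
    M.tail (s.b l) ∈ s.lev i := by
  have key : ∀ l, i + 2 ≤ l → l + i + 3 ≤ M.edg O K →
      (M.tail (s.b (i + 2 : ℕ)) ∈ s.lev i ↔ M.tail (s.b l) ∈ s.lev i) := by
    intro l h
    induction l, h using Nat.le_induction with
    | base => exact fun _ => Iff.rfl
    | succ l h ih =>
      intro h'
      rw [ih (by omega), (s.arc_step (j := l) (by omega) ?_).1]
      · push_cast; rfl
      · have := s.arc_dep (i := i) (l := l + 1) (by omega) (by omega)
        push_cast at this
        exact this
  have h1 := s.le_edg
  have h2 := s.le_n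
  rw [← key l h h', key (5 * n) (by omega) (by omega)]
  exact M.mem_compIn_self _ _

theorem nxt_lev_b (hi : i + 10 ≤ n) {l : ℕ} (h : i + 2 ≤ l) (h' : l + i + 4 ≤ M.edg O K) :
    M.nxt (s.lev i) (s.b l) = s.b (l + 1 : ℕ) := by
  have h1 := s.arc_dep (i := i) (l := l + 1) (by omega) (by omega)
  push_cast at h1 ⊢
  exact (s.arc_step (by omega) h1).2 (s.tail_b_mem_lev hi h (by omega))

/-- The boundary of every shallow face can be joined to the root outside a region. -/
theorem reachIn_root (hi : i ≤ n) {x : M.Face} (hx : s.dep x < i) :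
    ∀ d, M.face d = x → M.ReachIn ((K ∪ O) \ s.lev i) (M.tail (s.b 0)) (M.tail d) := by
  have hn := s.le_n
  have around : ∀ d e, M.face d = M.face e → s.dep (M.face d) < i →
      M.tail d ∈ (K ∪ O) \ s.lev i ∧
      M.ReachIn ((K ∪ O) \ s.lev i) (M.tail d) (M.tail e) := by
    intro d e h h1
    have hm : ∀ e, M.face e = M.face d → M.tail e ∈ (K ∪ O) \ s.lev i := by
      intro e h
      refine ⟨s.tail_mem_of_dep (by rw [h]; omega), fun h' => ?_⟩
      have := (s.lev_subset hi h').2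
      have := s.lam_le e
      rw [h] at this
      omega
    refine ⟨hm d rfl, ?_⟩
    obtain ⟨k, rfl⟩ := M.exists_pow_of_face_eq h
    clear h
    induction k with
    | zero => exact .refl
    | succ k ih =>
      refine ih.trans ?_
      have h2 := hm ((M.phi ^ (k + 1)) d) (M.face_pow _ _)
      rw [pow_succ', Equiv.Perm.mul_apply, tail_phi] at h2 ⊢
      exact M.reachIn_dart (hm _ (M.face_pow _ _)) h2
  refine s.dep_induction (P := fun x => s.dep x < i → ∀ d, M.face d = x →
    M.ReachIn ((K ∪ O) \ s.lev i) (M.tail (s.b 0)) (M.tail d)) ?_ ?_ x (by omega) hx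
  · intro h d hd
    exact (around (s.b 0) d hd.symm h).2
  · rintro x h0 h1 ih h2 d rfl
    have h3 := s.dep_face_pt h0 h1
    have h4 := ih (by omega) (M.phi (s.pt (M.face d))) (by rw [face_phi])
    rw [tail_phi, ← tail_rev] at h4
    exact h4.trans (around _ d (s.face_rev_pt h0 h1) (by rw [s.face_rev_pt h0 h1]; exact h2)).2

theorem exists_tail_eq {v : V} (hv : v ∈ O) : ∃ d, M.tail d = v := by
  by_cases h : M.tail s.b0 = v
  · exact ⟨_, h⟩
  · obtain ⟨d, -, h1, -⟩ := s.disk.connO.exists_dart (A := {v}) hv rfl s.b0_mem.1 h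
    exact ⟨d, h1⟩

theorem conn_compl_lev (h0 : 0 < i) (hi : i ≤ n) : M.Conn ((K ∪ O) \ s.lev i) := by
  have low : ∀ v ∈ O, s.lam v < i → M.ReachIn ((K ∪ O) \ s.lev i) (M.tail (s.b 0)) v := by
    intro v hv hl
    obtain ⟨d, rfl⟩ := s.exists_tail_eq hv
    obtain ⟨e, h1, h2⟩ := s.exists_lam d
    rw [← h1]
    exact s.reachIn_root hi (x := M.face e) (by omega) e rfl
  have hb : s.lam (M.tail (s.b 0)) < i := by
    have := s.lam_tail_b_le 0
    rw [dep_root] at this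
    omega
  have hbl : M.tail (s.b 0) ∈ (K ∪ O) \ s.lev i :=
    ⟨Or.inr (s.tail_b 0), fun h => absurd (s.lev_subset hi h).2 (by omega)⟩
  have hK : K ⊆ (K ∪ O) \ s.lev i :=
    fun v hv => ⟨Or.inl hv, fun h => s.notMem_O hv (s.lev_subset_O hi h)⟩
  refine M.conn_of_base (M.tail (s.b 0)) ?_
  rintro v ⟨hv | hv, hvl⟩
  · exact (M.reachIn_dart hbl (hK (s.head_b 0))).trans
      ((s.disk.connK _ (s.head_b 0) v hv).mono hK)
  · by_cases hl : s.lam v < i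
    · exact low v hv hl
    · have hvi : v ∈ s.hi i := ⟨hv, not_lt.mp hl⟩
      have hC : M.compIn (s.hi i) v ⊆ (K ∪ O) \ s.lev i := by
        intro u hu
        refine ⟨Or.inr (M.compIn_subset hvi hu).1, fun h => hvl ?_⟩
        exact Relation.ReflTransGen.trans h (ReachIn.symm hu)
      obtain ⟨d, h1, h2, h3, h4⟩ := s.disk.connO.exists_dart (A := M.compIn (s.hi i) v) hv
        (M.mem_compIn_self _ _) (s.tail_b 0)
        fun h => absurd (M.compIn_subset hvi h).2 (by omega)
      have h5 : s.lam (M.head d) < i := by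
        by_contra! h5
        exact h4 (M.head_mem_compIn hvi h2 ⟨h3, h5⟩)
      have h6 := low _ h3 h5
      have h7 : M.head d ∈ (K ∪ O) \ s.lev i :=
        ⟨Or.inr h3, fun h => absurd (s.lev_subset hi h).2 (by omega)⟩
      refine (h6.trans (M.reachIn_dart (hC h2) h7).symm).trans ?_
      have h8 : M.ReachIn (M.compIn (s.hi i) v) v (M.tail d) :=
        M.conn_compIn _ (M.mem_compIn_self _ _) _ h2
      exact (h8.mono hC).symm

/-- A closed cochain carried by shallow edges is a coboundary. -/
theorem cob_of_shallow {z : D → ZMod 2} (hz : M.Closed z)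
    (h : ∀ d, z d ≠ 0 → ¬ (M.tail d ∈ K ∧ M.head d ∈ K) ∧ s.dep (M.face d) ≤ 10 * n) :
    ∃ t, z = M.cob t := by
  have hn := s.le_n
  induction hk : (univ.filter fun d => z d ≠ 0 ∧ s.IsChord d).card using Nat.strong_induction_on
    generalizing z with
  | _ k ih =>
    by_cases hch : ∃ a, z a ≠ 0 ∧ s.IsChord a
    · obtain ⟨a, ha, hc⟩ := hch
      have ha' : z (M.rev a) ≠ 0 := by rwa [hz.1]
      have h1 := (h a ha).2
      have h2 := (h _ ha').2
      have hcl := s.closed_fc (a := a) (by omega) (by omega)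
      obtain ⟨t1, ht1⟩ := s.planar _ hcl (s.card_fc_le h1 h2)
      have hfd : ∀ d, s.IsChord d → s.fc a d ≠ 0 → d = a ∨ d = M.rev a := by
        intro d hd h3
        rcases s.fc_ne_zero (by omega) (by omega) h3 with h4 | h4 | ⟨x, h5, h6, h7, -⟩
        · exact Or.inl h4
        · exact Or.inr h4
        · rcases h7 with h7 | h7
          · exact absurd h7.symm (hd.2 x h5 h6).1
          · exact absurd (by rw [h7, rev_rev']) (hd.2 x h5 h6).2
      have hone : ∀ u : ZMod 2, u ≠ 0 → u + 1 = 0 := by decide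
      have hlt : (univ.filter fun d =>
        (z + s.fc a) d ≠ 0 ∧ s.IsChord d).card < k := by
        rw [← hk]
        refine Finset.card_lt_card ⟨fun d hd => ?_, fun hsub => ?_⟩
        · simp only [Finset.mem_filter, Finset.mem_univ, true_and] at hd ⊢
          refine ⟨fun h0 => hd.1 ?_, hd.2⟩
          rw [Pi.add_apply, h0, zero_add]
          by_contra h3
          rcases hfd d hd.2 h3 with rfl | rfl
          · exact ha h0
          · exact ha' h0
        · have h3 := @hsub a (by simp [ha, hc])
          simp only [Finset.mem_filter, Finset.mem_univ, true_and] at h3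
          refine h3.1 ?_
          rw [Pi.add_apply, s.fc_self hc (by omega) (by omega), hone _ ha]
      have hsh : ∀ d, (z + s.fc a) d ≠ 0 →
          ¬ (M.tail d ∈ K ∧ M.head d ∈ K) ∧ s.dep (M.face d) ≤ 10 * n := by
        intro d hd
        by_cases h0 : z d = 0
        · rw [Pi.add_apply, h0, zero_add] at hd
          rcases s.fc_ne_zero (by omega) (by omega) hd with rfl | rfl | ⟨x, h5, h6, h7, h8⟩
          · exact absurd h0 ha
          · exact absurd h0 ha'
          · have h9 : s.dep x ≤ 10 * n := by
              rcases h8 with h8 | h8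
              · have := s.gd_desc h6 (by omega) h8
                omega
              · have := s.gd_desc h6 (by omega) h8
                omega
            have h10 := s.isCand_pt h5 h6
            have h11 := s.dep_face_pt h5 h6
            rcases h7 with rfl | rfl
            · exact ⟨by exact h10.1, by omega⟩
            · rw [tail_rev, head_rev, s.face_rev_pt h5 h6]
              exact ⟨fun h => h10.1 ⟨h.2, h.1⟩, h9⟩
        · exact h d h0
      obtain ⟨t2, ht2⟩ := ih _ hlt (hz.add hcl) hsh rfl
      refine ⟨t1 + t2, ?_⟩
      have h3 : z = s.fc a + (z + s.fc a) := by
        rw [add_comm z, ← add_assoc, add_self_pi, zero_add]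
      rw [h3, ht2, ht1]
      ext d
      simp only [Pi.add_apply, cob]
      ring
    · refine ⟨0, ?_⟩
      by_contra! hne
      obtain ⟨d0, hd0⟩ : ∃ d, z d ≠ 0 := by
        by_contra! h0
        exact hne (by ext d; simp [h0, cob])
      obtain ⟨d, hd, hmax⟩ := Finset.exists_max_image (univ.filter fun d => z d ≠ 0)
        (fun d => s.dep (M.face d)) ⟨d0, by simp [hd0]⟩
      simp only [Finset.mem_filter, Finset.mem_univ, true_and] at hd hmax
      have htree : ∀ e, z e ≠ 0 → ∃ x, 0 < s.dep x ∧ s.dep x < 100 * n ∧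
          (e = s.pt x ∨ e = M.rev (s.pt x)) := by
        intro e he
        by_contra! h1
        refine hch ⟨e, he, (h e he).1, fun x h2 h3 => ⟨fun h4 => (h1 x h2 h3).1 h4.symm, fun h4 => ?_⟩⟩
        exact (h1 x h2 h3).2 (by rw [h4, rev_rev'])
      have hup : ∀ e, z e ≠ 0 → s.dep (M.face d) ≤ s.dep (M.face e) →
          e = M.rev (s.pt (M.face e)) := by
        intro e he hde
        obtain ⟨x, h2, h3, rfl | rfl⟩ := htree e he
        · have h4 := hmax (M.rev (s.pt x)) (by rwa [hz.1])
          have h5 := s.dep_face_pt h2 h3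
          rw [s.face_rev_pt h2 h3] at h4
          omega
        · rw [s.face_rev_pt h2 h3]
      have hsum := hz.2 (M.face d)
      rw [faceSum, Finset.sum_eq_single d] at hsum
      · exact hd hsum
      · intro e he hed
        simp only [Finset.mem_filter, Finset.mem_univ, true_and] at he
        by_contra h0
        apply hed
        rw [hup e h0 (by rw [he]), hup d hd le_rfl, he]
      · simp

theorem sameCycle_lev (h0 : 0 < i) (hi : i + 10 ≤ n) (hc : c ∈ M.out (s.lev i))
    (hd : d ∈ M.out (s.lev i)) : (M.nxt (s.lev i)).SameCycle c d := by
  have hb : ∀ e, M.tail e ∈ s.lev i → M.head e ∉ s.lev i →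
      ¬ (M.tail e ∈ K ∧ M.head e ∈ K) ∧ s.dep (M.face e) ≤ 10 * n := by
    intro e h1 h2
    refine ⟨s.not_inK (s.lev_subset_O (by omega) h1), ?_⟩
    rcases s.lev_exit (by omega) ⟨h1, h2⟩ with h3 | ⟨h3, h4⟩
    · obtain ⟨j, rfl⟩ := s.exists_b (s.mem_out_iff.mpr ⟨s.lev_subset_O (by omega) h1, h3⟩)
      exact s.dep_y_le j
    · have := s.dep_le_lam_head h3
      omega
  have hb' : ∀ e, M.tail e ∉ s.lev i → M.head e ∈ s.lev i →
      ¬ (M.tail e ∈ K ∧ M.head e ∈ K) ∧ s.dep (M.face e) ≤ 10 * n := by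
    intro e h1 h2
    refine ⟨s.not_inK' (s.lev_subset_O (by omega) h2), ?_⟩
    rcases s.lev_exit (i := i) (d := M.rev e) (by omega) ⟨by rwa [tail_rev], by rwa [head_rev]⟩ with
      h3 | ⟨h3, h4⟩
    · obtain ⟨j, h5⟩ := s.exists_b (d := M.rev e) (s.mem_out_iff.mpr
        ⟨by rw [tail_rev]; exact s.lev_subset_O (by omega) h2, h3⟩)
      rw [← rev_rev' M e, ← h5, face_rev_b]
      exact s.dep_y_le _
    · rw [head_rev] at h3 h4
      have := s.dep_le_lam h3
      omega
  obtain ⟨t, ht⟩ := s.cob_of_shallow (M.closed_orbC hc) (by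
    intro e he
    have h1 : e ∈ M.bdry (s.lev i) := by
      by_contra h1
      exact he (M.orbC_eq_zero hc h1)
    by_cases h2 : M.tail e ∈ s.lev i
    · exact hb e h2 fun h3 => h1 ⟨fun _ => h3, fun _ => h2⟩
    · refine hb' e h2 ?_
      by_contra h3
      exact h1 ⟨fun h => absurd h h2, fun h => absurd h h3⟩)
  exact M.sameCycle_of_cob s.conn_lev (s.conn_compl_lev h0 (by omega))
    (fun v hv => Or.inr (s.lev_subset_O (by omega) hv)) s.disk.head_mem hc ht hd

end Setup

end CMap

namespace CMap

open scoped Classical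

variable {V D : Type}

namespace Setup

variable {M : CMap V D} [Fintype D] {K O : Set V} {n : ℕ} (s : M.Setup K O n)

include s

variable {i : ℕ} {c d e : D} {x x' : M.Face}

theorem psi_le_of_key {k : ℕ} (hx : s.dep x ≤ 4 * n) (hy : s.dep x' ≤ 4 * n)
    (h : s.key x ≤ s.key x') (h1 : s.dep x ≤ s.dep x' + k) (h2 : s.dep x' ≤ s.dep x + k) :
    s.psi x ≤ s.psi x' + k := by
  unfold psi
  rw [if_pos hx, if_pos hy]
  obtain ⟨z, h5, h6, h7⟩ := s.exists_psib hy
  have := s.psib_le h5 (h.trans h6)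
  omega

theorem psi_le_of_isWalk {l : List D} (h : M.IsWalk K x l x') :
    s.psi x' ≤ s.psi x + l.length := by
  induction l generalizing x with
  | nil => simp only [IsWalk] at h; simp [h]
  | cons d l ih =>
    obtain ⟨h1, h2, h3⟩ := h
    have h4 := ih h3
    have h5 := s.psi_lip (d := M.rev d) (by rw [tail_rev, head_rev]; exact fun h => h2 ⟨h.2, h.1⟩)
    rw [rev_rev', h1] at h5
    rw [List.length_cons]
    omega

theorem psi_le_gd (h : M.gd K (100 * n) x x' < 100 * n) :
    s.psi x' ≤ s.psi x + M.gd K (100 * n) x x' := by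
  obtain ⟨l, h1, h2⟩ := M.exists_walk h
  rw [← h2]
  exact s.psi_le_of_isWalk h1

/-- Traversing faces in the order of the keys, the potential drops by at most three. -/
theorem psi_le_of_dkey (h : s.dkey c < s.dkey d) (hi : i + 3 ≤ n)
    (h1 : i ≤ s.dep (M.face c) ∧ s.dep (M.face c) ≤ i + 3)
    (h2 : i ≤ s.dep (M.face d) ∧ s.dep (M.face d) ≤ i + 3) :
    s.psi (M.face c) ≤ s.psi (M.face d) + 3 := by
  rcases le_or_gt (s.key (M.face c)) (s.key (M.face d)) with h3 | h3
  · exact s.psi_le_of_key (by omega) (by omega) h3 (by omega) (by omega)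
  · by_cases h4 : s.key (M.face d) <+: s.key (M.face c)
    · have h5 := s.gd_desc (by omega) (by omega) h4
      have := s.psi_le_gd (x := M.face d) (x' := M.face c) (by omega)
      omega
    · exact absurd (append_lt_append h3 h4 [s.idx d] [s.idx c]) h.not_gt

/-- Boundary darts of a level that either stay in `O` or are among the first darts to `K`. -/
def Good (i : ℕ) (c : D) : Prop :=
  M.head c ∈ K → ∃ j : ℤ, c = s.b j ∧ -((i : ℤ) + 3) ≤ j ∧ j ≤ i + 2

theorem lam_of_lev (hi : i ≤ n) {v : V} (h : v ∈ s.lev i) : i ≤ s.lam v :=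
  (s.lev_subset hi h).2

theorem dep_y_abs {j : ℤ} (h1 : -((i : ℤ) + 3) ≤ j) (h2 : j ≤ i + 3) (hi : i + 3 ≤ n) :
    s.dep (s.y j) ≤ i + 3 := by
  rcases le_total 0 j with h | h
  · lift j to ℕ using h
    rw [s.dep_y_nat (by omega)]
    omega
  · obtain ⟨m, rfl⟩ : ∃ m : ℕ, j = -m := ⟨j.natAbs, by omega⟩
    rw [s.dep_y_neg (by omega)]
    omega

theorem dep_le_of_head_notMem (hi : i ≤ n) (hc : c ∈ M.out (s.lev i)) (h : M.head c ∉ K) :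
    s.dep (M.face c) ≤ i + 1 ∧ s.dep (M.face (M.rev c)) ≤ i + 1 := by
  rcases s.lev_exit hi hc with h1 | ⟨h1, h2⟩
  · exact absurd h1 h
  · have h3 := s.dep_le_lam_head h1
    have h4 := s.dep_le_lam (d := M.rev c) (by rwa [tail_rev])
    rw [tail_rev] at h4
    omega

theorem le_dep_of_mem (hi : i ≤ n) (hc : M.tail c ∈ s.lev i) :
    i ≤ s.dep (M.face c) ∧ i ≤ s.dep (M.face (M.rev c)) := by
  have h1 := s.lam_of_lev hi hc
  have h2 := s.lam_le c
  have h3 := s.lam_head_le (M.rev c)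
  rw [head_rev] at h3
  omega

theorem dep_of_good (hi : i + 3 ≤ n) (hc : c ∈ M.out (s.lev i)) (h : s.Good i c) :
    s.dep (M.face c) ≤ i + 3 ∧ s.dep (M.face (M.rev c)) ≤ i + 3 := by
  by_cases h1 : M.head c ∈ K
  · obtain ⟨j, rfl, h2, h3⟩ := h h1
    refine ⟨s.dep_y_abs h2 (by omega) hi, ?_⟩
    rw [face_rev_b]
    exact s.dep_y_abs (by omega) (by omega) hi
  · have := s.dep_le_of_head_notMem (by omega) hc h1
    omega

/-- The parent dart of a face on the boundary of a level does not stay inside the level. -/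
theorem pt_exit (hi : i + 3 ≤ n) (hc : c ∈ M.out (s.lev i)) (hg : s.Good i c)
    (h0 : 0 < s.dep (M.face c)) :
    ¬ (M.tail (s.pt (M.face c)) ∈ s.lev i ∧ M.head (s.pt (M.face c)) ∈ s.lev i) := by
  rintro ⟨h1, h2⟩
  have hO := s.lev_subset_O (i := i) (by omega)
  by_cases hK : M.head c ∈ K
  · obtain ⟨j, rfl, h3, h4⟩ := hg hK
    change 0 < s.dep (s.y j) at h0
    change M.tail (s.pt (s.y j)) ∈ _ at h1
    change M.head (s.pt (s.y j)) ∈ _ at h2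
    rcases lt_trichotomy j 0 with h5 | rfl | h5
    · obtain ⟨m, rfl⟩ : ∃ m : ℕ, j = -(m + 1 : ℕ) := ⟨j.natAbs - 1, by omega⟩
      rw [s.pt_y_neg (by omega), tail_rev] at h1
      exact s.notMem_O (s.head_b _) (hO h1)
    · rw [dep_root] at h0
      omega
    · obtain ⟨m, rfl⟩ : ∃ m : ℕ, j = m + 1 := ⟨j.natAbs - 1, by omega⟩
      rw [s.pt_y_succ (by omega)] at h2
      exact s.notMem_O (s.head_b _) (hO h2)
  · obtain ⟨h3, h4⟩ := (s.lev_exit (by omega) hc).resolve_left hK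
    have h5 := s.dep_le_lam_head h3
    have hl1 := s.lam_of_lev (by omega) h1
    have hl2 := s.lam_of_lev (by omega) h2
    have h6 := s.dep_face_pt h0 (by omega)
    have h7 := s.lam_le (s.pt (M.face c))
    obtain ⟨v, h8, h9⟩ := s.pt_low (d := M.phi c) (by rwa [tail_phi])
      (by rw [tail_phi, face_phi]; omega) (by rw [face_phi]; omega)
    rw [face_phi] at h8 h9
    rcases h8 with rfl | rfl
    · rcases h9 with h9 | h9
      · exact s.notMem_O h9 (hO h1)
      · omega
    · rcases h9 with h9 | h9
      · exact s.notMem_O h9 (hO h2)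
      · omega

/-- Without wrapping, indices increase along a face. -/
theorem idx_pow (hd : s.dep (M.face d) < 100 * n) (m : ℕ)
    (h : ∀ l < m, (M.phi ^ (l + 1)) d ≠ s.start (M.face d)) :
    s.idx ((M.phi ^ m) d) = s.idx d + m := by
  induction m with
  | zero => simp
  | succ m ih =>
    rw [pow_succ', Equiv.Perm.mul_apply, s.idx_phi, ih fun l hl => h l (by omega), add_assoc]
    · rwa [face_pow]
    · rw [face_pow, ← Equiv.Perm.mul_apply, ← pow_succ']
      exact h m (by omega)

theorem idx_lt_nxt (h0 : 0 < i) (hi : i + 10 ≤ n) (hc : c ∈ M.out (s.lev i))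
    (hg : s.Good i c) (hg' : s.Good i (M.nxt (s.lev i) c))
    (hpt : s.pt (M.face (M.rev c)) ≠ c) : s.idx (M.rev c) < s.idx (M.nxt (s.lev i) c) := by
  have hx := M.face_nxt hc
  have hd := (s.dep_of_good (by omega) hc hg).2
  have hd' := (s.le_dep_of_mem (by omega) hc.1).2
  obtain ⟨h1, m, h2, h3, h4⟩ := M.nxt_spec hc
  rw [h3, s.idx_pow (by omega)]
  · omega
  · intro l hl h5
    rw [s.start_eq (by omega), pow_succ', Equiv.Perm.mul_apply] at h5
    have h6 := M.phi.injective h5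
    rcases Nat.eq_zero_or_pos l with rfl | hl0
    · rw [pow_zero, Equiv.Perm.one_apply] at h6
      exact hpt (by rw [← rev_rev' M (s.pt _), ← h6, rev_rev'])
    · have h7 := h4 l hl0 (by omega)
      have h8 := h4 (l + 1) (by omega) (by omega)
      rw [pow_succ', Equiv.Perm.mul_apply, tail_phi, h6, head_rev] at h8
      rw [h6, tail_rev] at h7
      refine s.pt_exit (by omega) h1 hg' (by rw [hx]; omega) ?_
      rw [hx]
      exact ⟨h8, h7⟩

theorem b_tree {j : ℤ} (h1 : -((i : ℤ) + 3) ≤ j) (h2 : j ≤ i + 2) (hi : i + 3 ≤ n) :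
    ¬ s.IsChord (s.b j) := by
  intro h
  rcases lt_or_ge j 0 with h5 | h5
  · obtain ⟨m, rfl⟩ : ∃ m : ℕ, j = -(m + 1 : ℕ) := ⟨j.natAbs - 1, by omega⟩
    have h3 := s.dep_y_neg (j := m + 1) (by omega)
    exact (h.2 _ (by omega) (by omega)).2 (s.pt_y_neg (j := m) (by omega))
  · lift j to ℕ using h5
    have h3 := s.dep_y_nat (j := j + 1) (by omega)
    push_cast at h3
    exact (h.2 _ (by omega) (by omega)).1 (s.pt_y_succ (j := j) (by omega))

theorem dkey_lt_of_idx (hf : M.face c = M.face d) (h : s.idx c < s.idx d) :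
    s.dkey c < s.dkey d := by
  rw [dkey_eq, dkey_eq, hf, concat_lt_concat_iff]
  exact h

/-- Keys increase strictly along the boundary of a level. -/
theorem dkey_lt_nxt (h0 : 0 < i) (hi : i + 10 ≤ n) (hc : c ∈ M.out (s.lev i))
    (hg : s.Good i c) (hg' : s.Good i (M.nxt (s.lev i) c)) :
    s.dkey c < s.dkey (M.nxt (s.lev i) c) := by
  have hO := s.lev_subset_O (i := i) (by omega)
  have hx := M.face_nxt hc
  obtain ⟨hd1, hd2⟩ := s.dep_of_good (by omega) hc hg
  obtain ⟨hd3, hd4⟩ := s.le_dep_of_mem (by omega) hc.1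
  have hlt : s.pt (M.face (M.rev c)) ≠ c →
      s.dkey (M.rev c) < s.dkey (M.nxt (s.lev i) c) := fun h =>
    s.dkey_lt_of_idx hx.symm (s.idx_lt_nxt h0 hi hc hg hg' h)
  by_cases hch : s.IsChord c
  · have hK : M.head c ∉ K := by
      intro h
      obtain ⟨j, rfl, h2, h3⟩ := hg h
      exact s.b_tree h2 h3 (by omega) hch
    obtain ⟨hd5, hd6⟩ := s.dep_le_of_head_notMem (by omega) hc hK
    obtain ⟨T, hTO, hT, hT'⟩ := s.exists_region hch (by omega) (by omega)
    have hin : ∀ d, M.tail d ∈ s.lev i → M.head d ∈ s.lev i →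
        (M.tail d ∈ T ↔ M.head d ∈ T) := by
      intro d h1 h2
      by_contra h3
      have h4 := (hT d (Or.inr (hO h1))).mpr h3
      rcases s.fc_ne_zero (by omega) (by omega) h4 with rfl | rfl | ⟨z, h5, h6, h7, h8⟩
      · exact hc.2 h2
      · rw [tail_rev] at h1
        exact hc.2 h1
      · have h9 : M.tail (s.pt z) ∈ s.lev i ∧ M.head (s.pt z) ∈ s.lev i := by
          rcases h7 with rfl | rfl
          · exact ⟨h1, h2⟩
          · rw [tail_rev] at h1; rw [head_rev] at h2
            exact ⟨h2, h1⟩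
        have h10 := s.dep_face_pt h5 h6
        have h11 := (s.le_dep_of_mem (by omega) h9.1).1
        rcases h8 with h8 | h8
        · have h12 := h8.length_le
          rw [s.length_key h6, s.length_key (by omega)] at h12
          have h13 := s.eq_of_key h6 (by omega) (h8.eq_of_length (by
            rw [s.length_key h6, s.length_key (by omega)]; omega))
          subst h13
          exact s.pt_exit (by omega) hc hg h5 h9
        · have h12 := h8.length_le
          rw [s.length_key h6, s.length_key (by omega)] at h12
          have h13 := s.eq_of_key h6 (by omega) (h8.eq_of_length (by
            rw [s.length_key h6, s.length_key (by omega)]; omega))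
          rw [← hx] at h13
          subst h13
          exact s.pt_exit (by omega) (M.nxt_mem_out hc) hg' h5 h9
    have hfar : M.tail (s.b (5 * n : ℕ)) ∉ T := by
      intro h1
      have h2 : M.head (s.b (5 * n : ℕ)) ∉ T := fun h => s.notMem_O (s.head_b _) (hTO h)
      have h3 := (hT (s.b (5 * n : ℕ)) (Or.inr (s.tail_b _))).mpr fun h => h2 (h.mp h1)
      have h4 : s.dep (M.face (s.b (5 * n : ℕ))) = 5 * n := s.dep_y_nat (by omega)
      rcases s.fc_ne_zero (by omega) (by omega) h3 with h5 | h5 | ⟨z, h5, h6, h7, h8⟩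
      · rw [← h5] at hd5
        omega
      · rw [← h5] at hd6
        omega
      · have h9 := s.dep_face_pt h5 h6
        have h10 : s.dep z ≤ i + 1 := by
          rcases h8 with h8 | h8
          all_goals
            have h12 := h8.length_le
            rw [s.length_key h6, s.length_key (by omega)] at h12
            omega
        rcases h7 with h7 | h7
        · rw [h7] at h4
          omega
        · rw [h7, s.face_rev_pt h5 h6] at h4
          omega
    have hnT : M.tail c ∉ T := by
      intro h1
      have h2 := ReachIn.const (fun v => decide (v ∈ T)) (by
        intro d h1 h2
        simpa using hin d h1 h2) (s.conn_lev _ (M.mem_compIn_self _ _) _ hc.1)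
      simp only [decide_eq_decide] at h2
      exact hfar (h2.mpr h1)
    have h1 := (not_congr (hT' c (by omega))).mp hnT
    rw [not_not] at h1
    have h2 : s.dkey c ≤ s.dkey (M.rev c) := not_lt.mp fun h => lt_irrefl _ (h1.mpr h)
    refine lt_of_le_of_lt h2 (hlt fun h => ?_)
    exact (hch.2 _ (by omega) (by omega)).1 h
  · obtain ⟨z, h1, h2, h3⟩ : ∃ z, 0 < s.dep z ∧ s.dep z < 100 * n ∧
        (s.pt z ≠ c → s.pt z = M.rev c) := by
      by_contra! hh
      exact hch ⟨s.not_inK (hO hc.1), fun x h1 h2 => hh x h1 h2⟩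
    have hz := s.dep_face_pt h1 h2
    have hz' := s.face_rev_pt h1 h2
    by_cases h4 : s.pt z = c
    · subst h4
      rw [dkey_eq s (M.nxt _ _), hx, hz', s.key_eq h1 h2]
      exact lt_of_le_of_ne (le_of_prefix (List.prefix_append _ _)) (by simp)
    · have h5 := h3 h4
      have h6 : M.face c = z := by rw [← hz', h5, rev_rev']
      have h7 : s.key (M.face c) = s.dkey (M.rev c) := by rw [h6, s.key_eq h1 h2, h5]
      have h8 := s.idx_lt_nxt h0 hi hc hg hg' (by
        intro h9
        have h10 := s.dep_face_pt (x := M.face (M.rev c)) (by omega) (by omega)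
        rw [h9] at h10
        rw [h5, h6.symm] at hz
        omega)
      rw [dkey_eq s c, h7, dkey_eq s (M.rev c), dkey_eq s (M.nxt _ _), hx]
      have := append_lt_append
        (concat_lt_concat_iff (l := s.key (M.face (M.rev c))).mpr h8) (by
        intro hp
        have := hp.eq_of_length (by simp)
        simp only [List.append_cancel_left_eq, List.cons.injEq, and_true] at this
        omega) [s.idx c] ([] : List ℕ)
      rwa [List.append_nil] at this

/-- The darts leaving a level in boundary order, starting near the root. -/
noncomputable def ct (i t : ℕ) : D := (M.nxt (s.lev i) ^ t) (s.b (-((i : ℤ) + 3)))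

theorem ct_succ (i t : ℕ) : s.ct i (t + 1) = M.nxt (s.lev i) (s.ct i t) := by
  rw [ct, pow_succ', Equiv.Perm.mul_apply, ct]

theorem ct_zero (i : ℕ) : s.ct i 0 = s.b (-((i : ℤ) + 3)) := by simp [ct]

theorem mem_out_of_b (hi : i ≤ n) {j : ℤ} (h : M.tail (s.b j) ∈ s.lev i) :
    s.b j ∈ M.out (s.lev i) :=
  ⟨h, fun h' => s.notMem_O (s.head_b j) (s.lev_subset_O hi h')⟩

theorem b_neg_eq (hi : i + 10 ≤ n) :
    s.b (-((i : ℤ) + 3)) = s.b (M.edg O K - (i + 3) : ℕ) := by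
  have h1 := s.le_edg
  have h2 := s.le_n
  rw [← s.b_add_edg]
  congr 1
  push_cast [show i + 3 ≤ M.edg O K by omega]
  ring

theorem ct_mem (hi : i + 10 ≤ n) (t : ℕ) : s.ct i t ∈ M.out (s.lev i) := by
  have h1 := s.le_edg
  have h2 := s.le_n
  refine M.pow_nxt_mem_out ?_ t
  rw [s.b_neg_eq hi]
  exact s.mem_out_of_b (by omega) (s.tail_b_mem_lev hi (by omega) (by omega))

theorem exists_ct (h0 : 0 < i) (hi : i + 10 ≤ n) (hc : c ∈ M.out (s.lev i)) :
    ∃ t, s.ct i t = c := by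
  obtain ⟨t, -, h⟩ := (s.sameCycle_lev h0 hi (s.ct_mem hi 0) hc).exists_pow_eq'
  rw [ct_zero] at h
  exact ⟨t, h⟩

theorem exists_ct_end (h0 : 0 < i) (hi : i + 10 ≤ n) : ∃ t, s.ct i t = s.b (i + 2 : ℕ) := by
  have h1 := s.le_edg
  have h2 := s.le_n
  exact s.exists_ct h0 hi
    (s.mem_out_of_b (by omega) (s.tail_b_mem_lev hi (by omega) (by omega)))

/-- The index of the last dart considered. -/
noncomputable def ts (i : ℕ) : ℕ := sInf {t | s.ct i t = s.b (i + 2 : ℕ)}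

theorem ct_ts (h0 : 0 < i) (hi : i + 10 ≤ n) : s.ct i (s.ts i) = s.b (i + 2 : ℕ) :=
  Nat.sInf_mem (s := {t | s.ct i t = s.b (i + 2 : ℕ)}) (s.exists_ct_end h0 hi)

theorem ct_ne_of_lt {t : ℕ} (ht : t < s.ts i) : s.ct i t ≠ s.b (i + 2 : ℕ) :=
  fun h => absurd (Nat.sInf_le (s := {t | s.ct i t = s.b (i + 2 : ℕ)}) h) (not_le.mpr ht)

theorem ct_add (h0 : 0 < i) (hi : i + 10 ≤ n) {m : ℕ} (hm : m + 2 * i + 5 ≤ M.edg O K) :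
    s.ct i (s.ts i + m) = s.b (i + 2 + m : ℕ) := by
  induction m with
  | zero => exact s.ct_ts h0 hi
  | succ m ih =>
    rw [← add_assoc, ct_succ, ih (by omega), s.nxt_lev_b hi (by omega) (by omega)]
    rfl

theorem b_nat_inj {a a' : ℕ} (h : a < M.edg O K) (h' : a' < M.edg O K) (hb : s.b a = s.b a') :
    a = a' := by
  have h1 := s.b_eq_iff.mp hb
  obtain ⟨k, hk⟩ := h1
  have h2 : k = 0 := by
    by_contra h2
    rcases lt_or_gt_of_ne h2 with h3 | h3
    · nlinarith
    · nlinarith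
  subst h2
  omega

theorem ct_shift {t t' m : ℕ} (h : s.ct i (t + m) = s.ct i (t' + m)) : s.ct i t = s.ct i t' := by
  rw [ct, ct, add_comm t, add_comm t', pow_add, pow_add, Equiv.Perm.mul_apply,
    Equiv.Perm.mul_apply] at h
  exact (M.nxt (s.lev i) ^ m).injective h

theorem good_ct (h0 : 0 < i) (hi : i + 10 ≤ n) {t : ℕ} (ht : t ≤ s.ts i) :
    s.Good i (s.ct i t) := by
  intro hK
  have hL := s.le_edg
  have hn := s.le_n
  have hc := s.ct_mem hi t
  rcases ht.eq_or_lt with rfl | ht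
  · exact ⟨(i + 2 : ℕ), s.ct_ts h0 hi, by push_cast; omega, by push_cast; omega⟩
  rcases Nat.eq_zero_or_pos t with rfl | ht0
  · exact ⟨_, s.ct_zero i, le_rfl, by omega⟩
  obtain ⟨a, ha, hb⟩ := s.exists_b_nat (s.mem_out_iff.mpr
    ⟨s.lev_subset_O (by omega) hc.1, hK⟩)
  by_cases h1 : a < i + 2
  · exact ⟨a, hb, by omega, by omega⟩
  by_cases h2 : M.edg O K < a + i + 3
  · refine ⟨a - M.edg O K, ?_, by omega, by omega⟩
    rw [← s.b_add_edg, sub_add_cancel, hb]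
  exfalso
  obtain ⟨m, rfl⟩ : ∃ m, a = i + 2 + m := ⟨a - (i + 2), by omega⟩
  rw [← s.ct_add h0 hi (by omega)] at hb
  rcases le_total m t with h3 | h3
  · obtain ⟨r, rfl⟩ := Nat.exists_eq_add_of_le' h3
    exact s.ct_ne_of_lt (t := r) (by omega) ((s.ct_shift hb).trans (s.ct_ts h0 hi))
  · obtain ⟨r, rfl⟩ := Nat.exists_eq_add_of_le' h3
    rw [← zero_add t, ← add_assoc, zero_add] at hb
    have h4 : s.ct i 0 = s.ct i (s.ts i + r) := by
      refine s.ct_shift (m := t) ?_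
      rw [zero_add, hb, add_assoc]
    rw [s.ct_add h0 hi (by omega), ct_zero, s.b_neg_eq hi] at h4
    have := s.b_nat_inj (by omega) (by omega) h4
    omega

theorem exists_ct_of_notMem (h0 : 0 < i) (hi : i + 10 ≤ n) (hc : c ∈ M.out (s.lev i))
    (hK : M.head c ∉ K) : ∃ t, 0 < t ∧ t < s.ts i ∧ s.ct i t = c := by
  have hL := s.le_edg
  have hn := s.le_n
  have hex := s.exists_ct h0 hi hc
  have hmin : ∀ r, r < Nat.find hex → s.ct i r ≠ c := fun r hr => Nat.find_min hex hr
  have ht := Nat.find_spec hex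
  set t := Nat.find hex
  refine ⟨t, ?_, ?_, ht⟩
  · rw [Nat.pos_iff_ne_zero]
    intro h1
    rw [h1, ct_zero] at ht
    exact hK (ht ▸ s.head_b _)
  · by_contra! h1
    obtain ⟨m, hm⟩ := Nat.exists_eq_add_of_le h1
    by_cases h2 : m + 2 * i + 5 ≤ M.edg O K
    · rw [hm, s.ct_add h0 hi h2] at ht
      exact hK (ht ▸ s.head_b _)
    · set q := M.edg O K - 2 * i - 5 with hq
      have h3 := s.ct_add h0 hi (m := q) (by omega)
      rw [show i + 2 + q = M.edg O K - (i + 3) by omega, ← s.b_neg_eq hi, ← ct_zero] at h3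
      obtain ⟨r, rfl⟩ := Nat.exists_eq_add_of_le' (show q ≤ m by omega)
      refine hmin r (by omega) ?_
      rw [← ht, hm, show s.ts i + (r + q) = r + (s.ts i + q) by ring, ct, ct, pow_add,
        Equiv.Perm.mul_apply]
      rw [ct, ct, pow_zero, Equiv.Perm.one_apply] at h3
      rw [h3]

theorem dep_ct (h0 : 0 < i) (hi : i + 10 ≤ n) {t : ℕ} (ht : t ≤ s.ts i) :
    i ≤ s.dep (M.face (s.ct i t)) ∧ s.dep (M.face (s.ct i t)) ≤ i + 3 := by
  have h1 := s.ct_mem hi t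
  exact ⟨(s.le_dep_of_mem (by omega) h1.1).1,
    (s.dep_of_good (by omega) h1 (s.good_ct h0 hi ht)).1⟩

theorem face_rev_ct (hi : i + 10 ≤ n) (t : ℕ) :
    M.face (M.rev (s.ct i t)) = M.face (s.ct i (t + 1)) := by
  rw [ct_succ, M.face_nxt (s.ct_mem hi t)]

theorem dkey_ct (h0 : 0 < i) (hi : i + 10 ≤ n) {t t' : ℕ} (h : t < t') (ht : t' ≤ s.ts i) :
    s.dkey (s.ct i t) < s.dkey (s.ct i t') := by
  induction t', h using Nat.le_induction with
  | base =>
    have := s.dkey_lt_nxt h0 hi (s.ct_mem hi t) (s.good_ct h0 hi (by omega))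
      (by rw [← ct_succ]; exact s.good_ct h0 hi ht)
    rwa [← ct_succ] at this
  | succ t' h ih =>
    have := s.dkey_lt_nxt h0 hi (s.ct_mem hi t') (s.good_ct h0 hi (by omega))
      (by rw [← ct_succ]; exact s.good_ct h0 hi ht)
    rw [← ct_succ] at this
    exact (ih (by omega)).trans this

/-- The potential of the `t`-th face along the boundary of level `i`. -/
noncomputable def px (i t : ℕ) : ℕ := s.psi (M.face (s.ct i t))

theorem px_le (h0 : 0 < i) (hi : i + 10 ≤ n) {t t' : ℕ} (h : t ≤ t') (ht : t' ≤ s.ts i) :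
    s.px i t ≤ s.px i t' + 3 := by
  rcases h.eq_or_lt with rfl | h
  · omega
  · exact s.psi_le_of_dkey (s.dkey_ct h0 hi h ht) (by omega) (s.dep_ct h0 hi (by omega))
      (s.dep_ct h0 hi ht)

theorem px_zero (hi : i + 10 ≤ n) : s.px i 0 + i + 3 ≤ n := by
  have h1 := s.psi_y_neg (l := i + 3) (by omega)
  rw [px, ct_zero]
  change s.psi (s.y _) + i + 3 ≤ n
  push_cast at h1
  omega

theorem px_ts (h0 : 0 < i) (hi : i + 10 ≤ n) : s.px i (s.ts i + 1) = n + i + 3 := by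
  rw [px, ← s.face_rev_ct hi, s.ct_ts h0 hi, face_rev_b, add_assoc, ← s.psi_y (by omega)]
  rfl

theorem px_succ (hi : i + 10 ≤ n) (t : ℕ) :
    s.px i (t + 1) ≤ s.px i t + 1 ∧ s.px i t ≤ s.px i (t + 1) + 1 := by
  have hO := s.lev_subset_O (i := i) (by omega) (s.ct_mem hi t).1
  have h1 := s.psi_lip (s.not_inK hO)
  have h2 := s.psi_lip (d := M.rev (s.ct i t)) (s.not_inK' (by rwa [head_rev]))
  rw [rev_rev'] at h2
  rw [px, px, ← s.face_rev_ct hi]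
  exact ⟨h2, h1⟩

end Setup

end CMap

namespace CMap

open scoped Classical

variable {V D : Type}

namespace Setup

variable {M : CMap V D} [Fintype D] {K O : Set V} {n : ℕ} (s : M.Setup K O n)

include s

variable {i : ℕ} {c d e : D} {x x' : M.Face}

/-- The dart separates faces of potential below `θ` from those at or above `θ`. -/
def Y (θ : ℕ) (d : D) : Prop :=
  ¬ (s.psi (M.face d) < θ ↔ s.psi (M.face (M.rev d)) < θ)

/-- Indicator of a face having potential below `θ`. -/
noncomputable def fl (θ : ℕ) (f : M.Face) : ZMod 2 := if s.psi f < θ then 1 else 0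

variable {θ : ℕ}

theorem Y_rev : s.Y θ (M.rev d) ↔ s.Y θ d := by
  rw [Y, Y, rev_rev', Iff.comm (a := s.psi (M.face d) < θ)]

theorem fl_add_eq_zero {f f' : M.Face} :
    s.fl θ f + s.fl θ f' = 0 ↔ (s.psi f < θ ↔ s.psi f' < θ) := by
  unfold fl
  have h : (1 : ZMod 2) + 1 = 0 := by decide
  split_ifs with h1 h2 h2 <;> simp [h1, h2, h]

theorem Y_iff : s.Y θ d ↔ s.fl θ (M.face d) + s.fl θ (M.face (M.rev d)) ≠ 0 := by
  rw [Y, ne_eq, fl_add_eq_zero]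

theorem psi_of_Y (hO : ¬ (M.tail d ∈ K ∧ M.head d ∈ K)) (h : s.Y θ d) :
    θ ≤ s.psi (M.face d) + 1 ∧ s.psi (M.face d) ≤ θ := by
  have h1 := s.psi_lip hO
  have h2 := s.psi_lip (d := M.rev d) (by rw [tail_rev, head_rev]; exact fun h => hO ⟨h.2, h.1⟩)
  rw [rev_rev'] at h2
  unfold Y at h
  omega

/-- Each vertex is the tail of an even number of separating darts. -/
theorem sum_fl_tail (v : V) :
    ∑ d with M.tail d = v, (s.fl θ (M.face d) + s.fl θ (M.face (M.rev d))) = 0 := by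
  rw [Finset.sum_add_distrib]
  have h : ∑ d with M.tail d = v, s.fl θ (M.face (M.rev d)) =
      ∑ d with M.tail d = v, s.fl θ (M.face d) := by
    refine Finset.sum_bij (fun d _ => M.rot d) ?_ ?_ ?_ ?_
    · intro a ha
      simp only [Finset.mem_filter, Finset.mem_univ, true_and] at ha ⊢
      rw [M.tail_rot, ha]
    · intro a _ b _ h; exact M.rot.injective h
    · intro d hd
      refine ⟨M.rot.symm d, ?_, by simp⟩
      have := M.tail_rot (M.rot.symm d)
      rw [Equiv.apply_symm_apply] at this
      simpa [this] using hd
    · intro d _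
      rw [face_rot]
  rw [h, CharTwo.add_self_eq_zero]

theorem sum_fl_inner (C : Set V) :
    ∑ d with M.tail d ∈ C ∧ M.head d ∈ C,
      (s.fl θ (M.face d) + s.fl θ (M.face (M.rev d))) = 0 := by
  refine Finset.sum_involution (fun d _ => M.rev d) ?_ ?_ ?_ ?_
  · intro d _
    rw [rev_rev', add_comm (s.fl θ (M.face (M.rev d))), CharTwo.add_self_eq_zero]
  · intro d _ h h1
    rw [h1, CharTwo.add_self_eq_zero] at h
    exact h rfl
  · intro d hd
    simp only [Finset.mem_filter, Finset.mem_univ, true_and, tail_rev, head_rev] at hd ⊢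
    exact hd.symm
  · intro d _
    exact rev_rev' M d

theorem sum_fl_exit (C : Set V) :
    ∑ d with M.tail d ∈ C ∧ M.head d ∉ C,
      (s.fl θ (M.face d) + s.fl θ (M.face (M.rev d))) = 0 := by
  have h1 : ∑ d with M.tail d ∈ C, (s.fl θ (M.face d) + s.fl θ (M.face (M.rev d))) = 0 := by
    have h2 : ∀ d ∈ univ.filter (fun d => M.tail d ∈ C),
        M.tail d ∈ (univ.filter fun d => M.tail d ∈ C).image M.tail :=
      fun d hd => Finset.mem_image_of_mem _ hd
    rw [← Finset.sum_fiberwise_of_maps_to h2]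
    refine Finset.sum_eq_zero fun v hv => ?_
    obtain ⟨e, he, rfl⟩ := Finset.mem_image.mp hv
    rw [Finset.filter_filter, ← s.sum_fl_tail (M.tail e)]
    refine Finset.sum_congr ?_ fun _ _ => rfl
    ext d
    simp only [Finset.mem_filter, Finset.mem_univ, true_and] at he ⊢
    exact ⟨fun h => h.2, fun h => ⟨h ▸ he, h⟩⟩
  rw [← Finset.sum_filter_add_sum_filter_not _ (fun d => M.head d ∈ C), Finset.filter_filter,
    Finset.filter_filter, s.sum_fl_inner, zero_add] at h1
  exact h1

/-- The part of a level cut off by the level four steps further. -/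
def ring (i : ℕ) : Set V := {v | v ∈ s.lev i ∧ v ∉ s.lev (i + 4)}

theorem ring_subset_O (hi : i ≤ n) : s.ring i ⊆ O := fun _ h => s.lev_subset_O hi h.1

theorem exists_b_ring (hi : i + 14 ≤ n) (ht : M.tail d ∈ s.ring i) (hK : M.head d ∈ K) :
    ∃ j : ℤ, d = s.b j ∧ -((i : ℤ) + 7) ≤ j ∧ j ≤ i + 6 := by
  have hL := s.le_edg
  obtain ⟨a, ha, rfl⟩ := s.exists_b_nat (s.mem_out_iff.mpr ⟨s.ring_subset_O (by omega) ht, hK⟩)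
  by_cases h1 : a ≤ i + 6
  · exact ⟨a, rfl, by omega, by omega⟩
  by_cases h2 : M.edg O K < a + i + 8
  · refine ⟨a - M.edg O K, ?_, by omega, by omega⟩
    rw [← s.b_add_edg ((a : ℤ) - M.edg O K), sub_add_cancel]
  exact absurd (s.tail_b_mem_lev (i := i + 4) (by omega) (by omega) (by omega)) ht.2

theorem le_of_dep_y {j : ℤ} (h1 : -((i : ℤ) + 7) ≤ j) (h2 : j ≤ i + 7) (hi : i + 14 ≤ n)
    (h : i ≤ s.dep (s.y j)) :
    ((i : ℤ) ≤ j ∧ n + i ≤ s.psi (s.y j)) ∨ (j ≤ -(i : ℤ) ∧ s.psi (s.y j) + i ≤ n) := by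
  rcases le_total 0 j with h3 | h3
  · lift j to ℕ using h3
    rw [s.dep_y_nat (by omega)] at h
    rw [s.psi_y (by omega)]
    omega
  · obtain ⟨m, rfl⟩ : ∃ m : ℕ, j = -m := ⟨j.natAbs, by omega⟩
    rw [s.dep_y_neg (by omega)] at h
    have := s.psi_y_neg (l := m) (by omega)
    omega

theorem not_Y_b (hi : i + 14 ≤ n) (h1 : n < θ + i) (h2 : θ ≤ n + i)
    (ht : M.tail d ∈ s.lev i) (hd : ∃ j : ℤ, d = s.b j ∧ -((i : ℤ) + 7) ≤ j ∧ j ≤ i + 6) :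
    ¬ s.Y θ d := by
  obtain ⟨j, rfl, h3, h4⟩ := hd
  obtain ⟨h5, h6⟩ := s.le_dep_of_mem (by omega) ht
  rw [face_rev_b] at h6
  have h7 := s.le_of_dep_y h3 (by omega) hi h5
  have h8 := s.le_of_dep_y (j := j + 1) (by omega) (by omega) hi h6
  unfold Y
  rw [face_rev_b]
  change ¬ ¬ (s.psi (s.y j) < θ ↔ _)
  omega

/-- Separating darts leaving a level stay in `O`, start in the ring, and are proper darts of the
boundary sequence. -/
theorem ct_of_Y (h0 : 0 < i) (hi : i + 14 ≤ n) (h1 : n < θ + i) (h2 : θ ≤ n + i) {t : ℕ}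
    (ht : t ≤ s.ts i) (hY : s.Y θ (s.ct i t)) :
    t < s.ts i ∧ M.head (s.ct i t) ∉ K ∧ M.tail (s.ct i t) ∈ s.ring i := by
  have hc := s.ct_mem (i := i) (by omega) t
  have hK : M.head (s.ct i t) ∉ K := by
    intro h
    obtain ⟨j, h3, h4, h5⟩ := s.good_ct h0 (by omega) ht h
    exact s.not_Y_b hi h1 h2 hc.1 ⟨j, h3, by omega, by omega⟩ hY
  refine ⟨lt_of_le_of_ne ht fun h => hK ?_, hK, hc.1, fun h => ?_⟩
  · rw [h, s.ct_ts h0 (by omega)]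
    exact s.head_b _
  · have h3 := (s.dep_le_of_head_notMem (by omega) hc hK).1
    have h4 := (s.le_dep_of_mem (i := i + 4) (by omega) h).1
    omega

theorem sum_fl_ct (h0 : 0 < i) (hi : i + 14 ≤ n) (h1 : n < θ + i) (h2 : θ ≤ n + i) :
    ∑ t ∈ Finset.range (s.ts i + 1),
      (s.fl θ (M.face (s.ct i t)) + s.fl θ (M.face (M.rev (s.ct i t)))) = 1 := by
  have h3 : ∀ m, ∑ t ∈ Finset.range m,
      (s.fl θ (M.face (s.ct i t)) + s.fl θ (M.face (M.rev (s.ct i t)))) =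
      s.fl θ (M.face (s.ct i 0)) + s.fl θ (M.face (s.ct i m)) := by
    intro m
    induction m with
    | zero => simp [CharTwo.add_self_eq_zero]
    | succ m ih =>
      have h := CharTwo.add_self_eq_zero (s.fl θ (M.face (s.ct i m)))
      rw [Finset.sum_range_succ, ih, s.face_rev_ct (by omega)]
      linear_combination h
  have h4 := s.px_zero (i := i) (by omega)
  have h5 := s.px_ts h0 (by omega)
  unfold px at h4 h5
  rw [h3, fl, fl, if_pos (by omega), if_neg (by omega), add_zero]

theorem exists_ct_Y (h0 : 0 < i) (hi : i + 14 ≤ n) (h1 : n < θ + i) (h2 : θ ≤ n + i) :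
    ∃ t, t < s.ts i ∧ s.Y θ (s.ct i t) := by
  by_contra! h
  have h3 := s.sum_fl_ct h0 hi h1 h2
  rw [Finset.sum_eq_zero] at h3
  · exact zero_ne_one h3
  · intro t ht
    by_contra h4
    have h5 := s.Y_iff.mpr h4
    exact h t (s.ct_of_Y h0 hi h1 h2 (Nat.lt_succ_iff.mp (Finset.mem_range.mp ht)) h5).1 h5

/-- The vertices of the ring reachable from the inner boundary by separating darts. -/
def cmp (i θ : ℕ) : Set V :=
  {v | ∃ t, t < s.ts i ∧ s.Y θ (s.ct i t) ∧
    Relation.ReflTransGen (fun u w => w ∈ s.ring i ∧ ∃ d, s.Y θ d ∧ M.tail d = u ∧ M.head d = w)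
      (M.tail (s.ct i t)) v}

theorem tail_mem_cmp {t : ℕ} (ht : t < s.ts i) (hY : s.Y θ (s.ct i t)) :
    M.tail (s.ct i t) ∈ s.cmp i θ := ⟨t, ht, hY, .refl⟩

theorem head_mem_cmp (h : M.tail d ∈ s.cmp i θ) (hY : s.Y θ d) (hd : M.head d ∈ s.ring i) :
    M.head d ∈ s.cmp i θ := by
  obtain ⟨t, h1, h2, h3⟩ := h
  exact ⟨t, h1, h2, h3.tail ⟨hd, d, hY, rfl, rfl⟩⟩

theorem cmp_subset (h0 : 0 < i) (hi : i + 14 ≤ n) (h1 : n < θ + i) (h2 : θ ≤ n + i) :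
    s.cmp i θ ⊆ s.ring i := by
  rintro v ⟨t, h3, h4, h5⟩
  induction h5 with
  | refl => exact (s.ct_of_Y h0 hi h1 h2 h3.le h4).2.2
  | tail _ h _ => exact h.1

theorem exists_Y_of_mem_cmp (h0 : 0 < i) (hi : i + 14 ≤ n) (h1 : n < θ + i) (h2 : θ ≤ n + i)
    {v : V} (h : v ∈ s.cmp i θ) :
    ∃ d, M.tail d = v ∧ θ ≤ s.psi (M.face d) + 1 ∧ s.psi (M.face d) ≤ θ := by
  have hv := s.ring_subset_O (by omega) (s.cmp_subset h0 hi h1 h2 h)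
  obtain ⟨t, h3, h4, h5⟩ := h
  cases h5 with
  | refl => exact ⟨_, rfl, s.psi_of_Y (s.not_inK hv) h4⟩
  | tail _ h =>
    obtain ⟨-, d, h6, h7, rfl⟩ := h
    exact ⟨M.rev d, by rw [tail_rev], s.psi_of_Y (s.not_inK (by rwa [tail_rev])) (s.Y_rev.mpr h6)⟩

/-- A separating dart leads from each crossing component to the next level. -/
theorem exists_exit (h0 : 0 < i) (hi : i + 14 ≤ n) (h1 : n < θ + i) (h2 : θ ≤ n + i) :
    ∃ d, M.tail d ∈ s.cmp i θ ∧ M.head d ∈ s.lev (i + 4) ∧ s.Y θ d := by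
  by_contra! hno
  have hsub := s.cmp_subset h0 hi h1 h2
  have h3 := s.sum_fl_exit (θ := θ) (s.cmp i θ)
  refine zero_ne_one (h3.symm.trans ?_)
  rw [← s.sum_fl_ct h0 hi h1 h2]
  symm
  refine Finset.sum_bij_ne_zero (fun t _ _ => s.ct i t) ?_ ?_ ?_ ?_
  · intro t ht hY
    have h4 := s.ct_of_Y h0 hi h1 h2 (Nat.lt_succ_iff.mp (Finset.mem_range.mp ht))
      (s.Y_iff.mpr hY)
    simp only [Finset.mem_filter, Finset.mem_univ, true_and]
    exact ⟨s.tail_mem_cmp h4.1 (s.Y_iff.mpr hY), fun h => (s.ct_mem (by omega) t).2 (hsub h).1⟩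
  · intro t ht _ t' ht' _ h
    rw [Finset.mem_range] at ht ht'
    rcases lt_trichotomy t t' with h4 | h4 | h4
    · exact absurd (s.dkey_ct h0 (by omega) h4 (by omega)) (by rw [h]; exact lt_irrefl _)
    · exact h4
    · exact absurd (s.dkey_ct h0 (by omega) h4 (by omega)) (by rw [h]; exact lt_irrefl _)
  · intro d hd hY
    simp only [Finset.mem_filter, Finset.mem_univ, true_and] at hd
    have hY' := s.Y_iff.mpr hY
    have h4 := hsub hd.1
    have h5 : M.head d ∉ s.ring i := fun h => hd.2 (s.head_mem_cmp hd.1 hY' h)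
    have h6 : M.head d ∉ s.lev i := fun h =>
      h5 ⟨h, fun h' => hno d hd.1 h' hY'⟩
    have h7 : M.head d ∉ K := fun h =>
      s.not_Y_b hi h1 h2 h4.1 (s.exists_b_ring hi h4 h) hY'
    obtain ⟨t, h8, h9, rfl⟩ := s.exists_ct_of_notMem h0 (by omega) ⟨h4.1, h6⟩ h7
    exact ⟨t, Finset.mem_range.mpr (by omega), hY, rfl⟩
  · intro t _ _
    rfl

theorem exists_exit' (h0 : 0 < i) (hi : i + 14 ≤ n) (h1 : n < θ + i) (h2 : θ ≤ n + i) :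
    ∃ d, M.tail d ∈ s.cmp i θ ∧ M.head d ∈ s.cmp (i + 4) θ := by
  obtain ⟨d, h3, h4, h5⟩ := s.exists_exit h0 hi h1 h2
  have h6 := s.cmp_subset h0 hi h1 h2 h3
  obtain ⟨t, -, h7, h8⟩ := s.exists_ct_of_notMem (i := i + 4) (c := M.rev d) (by omega) (by omega)
    ⟨by rwa [tail_rev], by rw [head_rev]; exact h6.2⟩
    (by rw [head_rev]; exact s.notMem_K (s.ring_subset_O (by omega) h6))
  refine ⟨d, h3, ?_⟩
  have h9 := s.tail_mem_cmp h7 (θ := θ) (by rw [h8]; exact s.Y_rev.mpr h5)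
  rwa [h8, tail_rev] at h9

end Setup

end CMap

namespace CMap

open scoped Classical

variable {V D : Type}

namespace Setup

variable {M : CMap V D} [Fintype D] {K O : Set V} {n : ℕ} (s : M.Setup K O n)

include s

variable {i : ℕ} {d : D} {θ : ℕ}

/-- A connected set in the ring joining the tails of two consecutive darts of the boundary
sequence, all of whose vertices are incident with the face between these darts. -/
structure IsSeg (i t : ℕ) (A : Set V) : Prop where
  conn : M.Conn A
  left : M.tail (s.ct i t) ∈ A
  right : M.tail (s.ct i (t + 1)) ∈ A
  sub : A ⊆ s.ring i
  face : ∀ v ∈ A, ∃ d, M.tail d = v ∧ M.face d = M.face (s.ct i (t + 1))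

theorem exists_seg (h0 : 0 < i) (hi : i + 10 ≤ n) {t : ℕ} (ht : t < s.ts i) :
    ∃ A, s.IsSeg i t A := by
  obtain ⟨-, N, hN, hN', hmem⟩ := M.nxt_spec (s.ct_mem hi t)
  set e := M.rev (s.ct i t)
  have hface : ∀ l, M.face ((M.phi ^ l) e) = M.face (s.ct i (t + 1)) := fun l => by
    rw [face_pow, s.face_rev_ct hi]
  refine ⟨{v | ∃ l, 1 ≤ l ∧ l ≤ N ∧ M.tail ((M.phi ^ l) e) = v}, ?_, ?_, ?_, ?_, ?_⟩
  · refine M.conn_of_base (M.tail ((M.phi ^ 1) e)) ?_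
    rintro v ⟨l, h1, h2, rfl⟩
    induction l, h1 using Nat.le_induction with
    | base => exact .refl
    | succ l h1 ih =>
      refine (ih (by omega)).trans ?_
      have h3 : M.tail ((M.phi ^ (l + 1)) e) = M.head ((M.phi ^ l) e) := by
        rw [pow_succ', Equiv.Perm.mul_apply, tail_phi]
      rw [h3]
      exact M.reachIn_dart ⟨l, h1, by omega, rfl⟩ ⟨l + 1, by omega, h2, h3⟩
  · exact ⟨1, le_rfl, hN, by rw [pow_one, tail_phi, head_rev]⟩
  · exact ⟨N, hN, le_rfl, by rw [s.ct_succ, hN']⟩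
  · rintro v ⟨l, h1, h2, rfl⟩
    refine ⟨hmem l h1 h2, fun h => ?_⟩
    by_cases h4 : i + 4 ≤ n
    · have h5 := (s.le_dep_of_mem h4 h).1
      rw [hface] at h5
      have := (s.dep_ct h0 hi (t := t + 1) ht).2
      omega
    · omega
  · rintro v ⟨l, h1, h2, rfl⟩
    exact ⟨_, rfl, hface l⟩

/-- The segment of the ring between two consecutive darts of the boundary sequence. -/
noncomputable def seg (i t : ℕ) : Set V := Classical.epsilon (s.IsSeg i t)

theorem isSeg (h0 : 0 < i) (hi : i + 10 ≤ n) {t : ℕ} (ht : t < s.ts i) :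
    s.IsSeg i t (s.seg i t) := Classical.epsilon_spec (s.exists_seg h0 hi ht)

/-- The running maximum of the potential along the boundary sequence. -/
noncomputable def gm (i t : ℕ) : ℕ := (Finset.range (t + 1)).sup (s.px i)

theorem gm_mono {t t' : ℕ} (h : t ≤ t') : s.gm i t ≤ s.gm i t' :=
  Finset.sup_mono (Finset.range_mono (by omega))

theorem px_le_gm (t : ℕ) : s.px i t ≤ s.gm i t :=
  Finset.le_sup (f := s.px i) (Finset.mem_range.mpr (Nat.lt_succ_self t))

theorem gm_le (h0 : 0 < i) (hi : i + 10 ≤ n) {t t' : ℕ} (h : t ≤ t') (ht : t' ≤ s.ts i) :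
    s.gm i t ≤ s.px i t' + 3 :=
  Finset.sup_le fun _ hb => s.px_le h0 hi (by rw [Finset.mem_range] at hb; omega) ht

theorem gm_succ (hi : i + 10 ≤ n) (t : ℕ) : s.gm i (t + 1) ≤ s.gm i t + 1 := by
  have h1 := s.px_succ hi t
  have h2 := s.px_le_gm (i := i) t
  have h3 : s.gm i (t + 1) = max (s.px i (t + 1)) (s.gm i t) := by
    rw [gm, Finset.range_add_one, Finset.sup_insert]; rfl
  rw [h3]
  omega

theorem gm_zero : s.gm i 0 = s.px i 0 := by simp [gm]

theorem gm_ts (h0 : 0 < i) (hi : i + 10 ≤ n) : n + i + 2 ≤ s.gm i (s.ts i) := by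
  have h1 := s.px_ts h0 hi
  have h2 := s.px_succ hi (s.ts i)
  have h3 := s.px_le_gm (i := i) (s.ts i)
  omega

theorem ts_pos (h0 : 0 < i) (hi : i + 10 ≤ n) : 0 < s.ts i := by
  rcases Nat.eq_zero_or_pos (s.ts i) with h | h
  · have h1 := s.gm_ts h0 hi
    have h2 := s.px_zero hi
    rw [h, gm_zero] at h1
    omega
  · exact h

/-- The part of the boundary sequence with running maximum in `[α, β)`. -/
def wid (i α β : ℕ) : Set V := {v | ∃ t, t < s.ts i ∧ α ≤ s.gm i t ∧ s.gm i t < β ∧ v ∈ s.seg i t}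

theorem conn_wid (h0 : 0 < i) (hi : i + 10 ≤ n) (α β : ℕ) : M.Conn (s.wid i α β) := by
  have h1 : ∀ t t', t ≤ t' → t' < s.ts i → α ≤ s.gm i t → s.gm i t' < β →
      M.ReachIn (s.wid i α β) (M.tail (s.ct i t)) (M.tail (s.ct i t')) := by
    intro t t' h
    induction t', h using Nat.le_induction with
    | base => intro _ _ _; exact .refl
    | succ t' h ih =>
      intro h2 h3 h4
      have h5 := s.gm_mono (i := i) (t := t') (t' := t' + 1) (by omega)
      have h6 := s.gm_mono (i := i) h
      have hs := s.isSeg h0 hi (t := t') (by omega)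
      refine (ih (by omega) h3 (by omega)).trans ?_
      have hsub : s.seg i t' ⊆ s.wid i α β := fun v hv =>
        ⟨t', by omega, by omega, by omega, hv⟩
      exact (hs.conn _ hs.left _ hs.right).mono hsub
  have h2 : ∀ t, t < s.ts i → α ≤ s.gm i t → s.gm i t < β → ∀ v ∈ s.seg i t,
      M.ReachIn (s.wid i α β) (M.tail (s.ct i t)) v := by
    intro t h3 h4 h5 v hv
    have hs := s.isSeg h0 hi h3
    have hsub : s.seg i t ⊆ s.wid i α β := fun w hw => ⟨t, h3, h4, h5, hw⟩
    exact (hs.conn _ hs.left _ hv).mono hsub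
  rintro u ⟨t, ht, hα, hβ, hu⟩ v ⟨t', ht', hα', hβ', hv⟩
  have h3 := h2 t ht hα hβ u hu
  have h4 := h2 t' ht' hα' hβ' v hv
  rcases le_total t t' with h | h
  · exact (h3.symm.trans (h1 t t' h ht' hα hβ')).trans h4
  · exact (h3.symm.trans (h1 t' t h ht hα' hβ).symm).trans h4

theorem wid_subset (h0 : 0 < i) (hi : i + 10 ≤ n) (α β : ℕ) : s.wid i α β ⊆ s.ring i := by
  rintro v ⟨t, ht, -, -, hv⟩
  exact (s.isSeg h0 hi ht).sub hv

theorem tail_mem_wid (h0 : 0 < i) (hi : i + 10 ≤ n) {α β t : ℕ} (ht : t < s.ts i)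
    (hα : α ≤ s.gm i t) (hβ : s.gm i t < β) : M.tail (s.ct i t) ∈ s.wid i α β :=
  ⟨t, ht, hα, hβ, (s.isSeg h0 hi ht).left⟩

theorem psi_of_seg (h0 : 0 < i) (hi : i + 10 ≤ n) {t : ℕ} (ht : t < s.ts i) {v : V}
    (hv : v ∈ s.seg i t) :
    ∃ d, M.tail d = v ∧ s.gm i t ≤ s.psi (M.face d) + 3 ∧ s.psi (M.face d) ≤ s.gm i t + 1 := by
  obtain ⟨d, h1, h2⟩ := (s.isSeg h0 hi ht).face v hv
  refine ⟨d, h1, ?_⟩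
  rw [h2]
  have h3 := s.gm_le h0 hi (t := t) (t' := t + 1) (by omega) ht
  have h4 := s.px_le_gm (i := i) (t + 1)
  have h5 := s.gm_succ hi t
  unfold px at h3 h4
  omega

/-- The potentials of the faces at `v` are all close to `[α, β]`. -/
def Near (v : V) (α β : ℕ) : Prop := ∃ d, M.tail d = v ∧ α ≤ s.psi (M.face d) ∧
  s.psi (M.face d) ≤ β

theorem near_le {v : V} {α β α' β' : ℕ} (h : s.Near v α β)
    (h' : s.Near v α' β') (hv : v ∈ O) : α ≤ β' + 2 := by
  obtain ⟨d, h1, h2, h3⟩ := h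
  obtain ⟨d', h1', h2', h3'⟩ := h'
  subst h1
  have := s.le_add_two (g := s.psi) (fun d hd => s.psi_lip hd) h1'.symm hv
  omega

theorem near_of_wid (h0 : 0 < i) (hi : i + 10 ≤ n) {α β : ℕ} {v : V} (hv : v ∈ s.wid i α β) :
    s.Near v (α - 3) β := by
  obtain ⟨t, ht, hα, hβ, hv⟩ := hv
  obtain ⟨d, h1, h2, h3⟩ := s.psi_of_seg h0 hi ht hv
  exact ⟨d, h1, by omega, by omega⟩

theorem near_of_cmp (h0 : 0 < i) (hi : i + 14 ≤ n) (h1 : n < θ + i) (h2 : θ ≤ n + i) {v : V}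
    (hv : v ∈ s.cmp i θ) : s.Near v (θ - 1) θ := by
  obtain ⟨d, h3, h4, h5⟩ := s.exists_Y_of_mem_cmp h0 hi h1 h2 hv
  exact ⟨d, h3, by omega, h5⟩

theorem gm_of_Y (h0 : 0 < i) (hi : i + 10 ≤ n) {t : ℕ} (ht : t < s.ts i) (hY : s.Y θ (s.ct i t)) :
    θ ≤ s.gm i t + 1 ∧ s.gm i t ≤ θ + 3 := by
  have h1 := s.psi_of_Y (s.not_inK (s.lev_subset_O (by omega) (s.ct_mem hi t).1)) hY
  have h2 := s.gm_le h0 hi (le_refl t) ht.le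
  have h3 := s.px_le_gm (i := i) t
  unfold px at h2 h3
  omega

/-- A stretch of the boundary sequence covering all crossings of `θ`, joined with the crossing
components, is connected. -/
theorem conn_wid_union_cmp (h0 : 0 < i) (hi : i + 14 ≤ n) (h1 : n < θ + i) (h2 : θ ≤ n + i)
    {α β : ℕ} (hα : α + 1 ≤ θ) (hβ : θ + 4 ≤ β) : M.Conn (s.wid i α β ∪ s.cmp i θ) := by
  obtain ⟨t₀, ht₀, hY₀⟩ := s.exists_ct_Y h0 hi h1 h2
  have hw : ∀ t, t < s.ts i → s.Y θ (s.ct i t) → M.tail (s.ct i t) ∈ s.wid i α β := by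
    intro t ht hY
    have := s.gm_of_Y h0 (by omega) ht hY
    exact s.tail_mem_wid h0 (by omega) ht (by omega) (by omega)
  have hc : ∀ u ∈ s.wid i α β, M.ReachIn (s.wid i α β ∪ s.cmp i θ) (M.tail (s.ct i t₀)) u :=
    fun u hu => (s.conn_wid h0 (by omega) α β _ (hw _ ht₀ hY₀) u hu).mono Set.subset_union_left
  refine M.conn_of_base (M.tail (s.ct i t₀)) ?_
  rintro v (hv | ⟨t, ht, hY, hv⟩)
  · exact hc v hv
  · suffices h : v ∈ s.cmp i θ ∧ M.ReachIn (s.wid i α β ∪ s.cmp i θ) (M.tail (s.ct i t₀)) v from h.2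
    induction hv with
    | refl => exact ⟨s.tail_mem_cmp ht hY, hc _ (hw t ht hY)⟩
    | tail _ h ih =>
      obtain ⟨h3, d, h4, rfl, rfl⟩ := h
      have h5 := s.head_mem_cmp ih.1 h4 h3
      exact ⟨h5, ih.2.trans (M.reachIn_dart (Or.inr ih.1) (Or.inr h5))⟩

/-- The potential crossed by column `a` of the grid. -/
def th (_ : M.Setup K O n) (h a : ℕ) : ℕ := 60 * h + 20 * a

/-- The value of the running maximum where column `a` begins. -/
def tau (_ : M.Setup K O n) (h a : ℕ) : ℕ := if a = 0 then 0 else 60 * h + 20 * a - 5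

/-- The stretch of the ring belonging to column `a`. -/
def strip (h i a : ℕ) : Set V := s.wid i (s.tau h a) (s.tau h (a + 1))

/-- The crossing of column `a` with its neighbourhood in the ring. -/
def core (h i a : ℕ) : Set V := s.wid i (s.tau h a) (s.th h a + 4) ∪ s.cmp i (s.th h a)

/-- The stretch of column `a` together with the crossing. -/
def blk (h i a : ℕ) : Set V := s.strip h i a ∪ s.cmp i (s.th h a)

/-- The branch set of column `a` in the ring `i`. -/
noncomputable def brn (h i a : ℕ) : Set V :=
  {v | ∃ t, t < s.ts i ∧ s.Y (s.th h a) (s.ct i t) ∧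
    v ∈ M.compIn (s.blk h i a \ s.strip h i (a + 1)) (M.tail (s.ct i t))}

/-- The range of levels and columns used by the grid. -/
structure Rng (s : M.Setup K O n) (h i a : ℕ) : Prop where
  pos : 0 < h
  eq : n = 100 * h
  ge : 50 * h ≤ i
  le : i + 14 ≤ n
  lt : a < h

section

variable {h a : ℕ} {s} (r : s.Rng h i a)

include r

theorem Rng.i_pos : 0 < i := by have := r.ge; have := r.pos; omega

theorem Rng.le' : i + 10 ≤ n := by have := r.le; omega

theorem Rng.th_gt : n < s.th h a + i := by
  have := r.ge; have := r.eq; have := r.pos; unfold th; omega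

theorem Rng.th_le : s.th h a ≤ n + i := by
  have := r.ge; have := r.eq; have := r.lt; unfold th; omega

theorem Rng.tau_le : s.tau h a + 1 ≤ s.th h a := by
  have := r.pos; unfold tau th; split_ifs <;> omega

theorem tau_succ (s : M.Setup K O n) : s.tau h (a + 1) = s.th h a + 15 := by
  unfold tau th; rw [if_neg (by omega)]; omega

theorem Rng.sub_ring : s.blk h i a ⊆ s.ring i :=
  Set.union_subset (s.wid_subset r.i_pos r.le' _ _)
    (s.cmp_subset r.i_pos r.le r.th_gt r.th_le)

theorem Rng.conn_blk : M.Conn (s.blk h i a) :=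
  s.conn_wid_union_cmp r.i_pos r.le r.th_gt r.th_le r.tau_le (by rw [tau_succ r]; omega)

theorem Rng.conn_core : M.Conn (s.core h i a) :=
  s.conn_wid_union_cmp r.i_pos r.le r.th_gt r.th_le r.tau_le le_rfl

theorem Rng.near_blk {v : V} (hv : v ∈ s.blk h i a) : s.Near v 0 (s.th h a + 15) := by
  rcases hv with hv | hv
  · obtain ⟨d, h1, -, h3⟩ := s.near_of_wid r.i_pos r.le' hv
    exact ⟨d, h1, Nat.zero_le _, h3.trans (tau_succ r s).le⟩
  · obtain ⟨d, h1, -, h3⟩ := s.near_of_cmp r.i_pos r.le r.th_gt r.th_le hv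
    exact ⟨d, h1, Nat.zero_le _, by omega⟩

theorem Rng.near_core {v : V} (hv : v ∈ s.core h i a) : s.Near v 0 (s.th h a + 4) := by
  rcases hv with hv | hv
  · obtain ⟨d, h1, -, h3⟩ := s.near_of_wid r.i_pos r.le' hv
    exact ⟨d, h1, Nat.zero_le _, h3⟩
  · obtain ⟨d, h1, -, h3⟩ := s.near_of_cmp r.i_pos r.le r.th_gt r.th_le hv
    exact ⟨d, h1, Nat.zero_le _, by omega⟩

theorem Rng.near_strip {v : V} (hv : v ∈ s.strip h i (a + 1)) :
    s.Near v (s.th h a + 12) (s.th h (a + 1) + 15) := by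
  obtain ⟨d, h1, h2, h3⟩ := s.near_of_wid r.i_pos r.le' hv
  rw [tau_succ r] at h2
  refine ⟨d, h1, by omega, h3.trans ?_⟩
  unfold tau th
  split_ifs <;> omega

theorem Rng.core_subset : s.core h i a ⊆ s.blk h i a \ s.strip h i (a + 1) := by
  intro v hv
  have h1 : v ∈ s.blk h i a := by
    rcases hv with ⟨t, h1, h2, h3, h4⟩ | hv
    · exact Or.inl ⟨t, h1, h2, by rw [tau_succ r]; omega, h4⟩
    · exact Or.inr hv
  refine ⟨h1, fun h2 => ?_⟩
  have := s.near_le (r.near_strip h2) (r.near_core hv)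
    (s.ring_subset_O (by have := r.le; omega) (r.sub_ring h1))
  omega

theorem Rng.core_subset_brn : s.core h i a ⊆ s.brn h i a := by
  obtain ⟨t, ht, hY⟩ := s.exists_ct_Y r.i_pos r.le r.th_gt r.th_le
  intro v hv
  exact ⟨t, ht, hY, r.conn_core.subset_compIn r.core_subset (Or.inr (s.tail_mem_cmp ht hY))
    (M.mem_compIn_self _ _) hv⟩

theorem Rng.exists_brn_eq : ∃ u ∈ s.core h i a,
    s.brn h i a = M.compIn (s.blk h i a \ s.strip h i (a + 1)) u := by
  obtain ⟨t, ht, hY⟩ := s.exists_ct_Y r.i_pos r.le r.th_gt r.th_le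
  have hu : M.tail (s.ct i t) ∈ s.core h i a := Or.inr (s.tail_mem_cmp ht hY)
  refine ⟨_, hu, Set.Subset.antisymm ?_ fun v hv => ⟨t, ht, hY, hv⟩⟩
  rintro v ⟨t', ht', hY', hv⟩
  have h1 : M.tail (s.ct i t') ∈ s.core h i a := Or.inr (s.tail_mem_cmp ht' hY')
  exact ((r.conn_core _ hu _ h1).mono r.core_subset).trans hv

theorem Rng.brn_subset : s.brn h i a ⊆ s.blk h i a \ s.strip h i (a + 1) := by
  obtain ⟨u, hu, h1⟩ := r.exists_brn_eq
  rw [h1]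
  exact M.compIn_subset (r.core_subset hu)

theorem Rng.conn_brn : M.Conn (s.brn h i a) := by
  obtain ⟨u, hu, h1⟩ := r.exists_brn_eq
  rw [h1]
  exact M.conn_compIn

theorem Rng.head_mem_brn (hd : M.tail d ∈ s.brn h i a)
    (hd' : M.head d ∈ s.blk h i a \ s.strip h i (a + 1)) : M.head d ∈ s.brn h i a := by
  obtain ⟨u, hu, h1⟩ := r.exists_brn_eq
  rw [h1] at hd ⊢
  exact M.head_mem_compIn (r.core_subset hu) hd hd'

theorem Rng.brn_subset_ring : s.brn h i a ⊆ s.ring i :=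
  fun _ hv => r.sub_ring (r.brn_subset hv).1

theorem Rng.brn_subset_O : s.brn h i a ⊆ O :=
  fun _ hv => s.ring_subset_O (by have := r.le; omega) (r.brn_subset_ring hv)

theorem Rng.nonempty_brn : (s.brn h i a).Nonempty := by
  obtain ⟨u, hu, -⟩ := r.exists_brn_eq
  exact ⟨u, r.core_subset_brn hu⟩

theorem Rng.disjoint_of_col_lt {a' : ℕ} (r' : s.Rng h i a') (ha : a < a') :
    Disjoint (s.brn h i a) (s.brn h i a') := by
  rw [Set.disjoint_left]
  intro v hv hv'
  have hO := r.brn_subset_O hv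
  have h1 := r.near_blk (r.brn_subset hv).1
  rcases (r'.brn_subset hv').1 with h2 | h2
  · by_cases h3 : a' = a + 1
    · subst h3
      exact (r.brn_subset hv).2 h2
    · have h4 := s.near_le (s.near_of_wid r.i_pos r.le' h2) h1 hO
      unfold tau th at h4
      rw [if_neg (by omega)] at h4
      omega
  · have h4 := s.near_le (s.near_of_cmp r.i_pos r.le r'.th_gt r'.th_le h2) h1 hO
    unfold th at h4
    omega

theorem Rng.disjoint_of_row_lt {i' a' : ℕ} (r' : s.Rng h i' a') (hi : i + 4 ≤ i') :
    Disjoint (s.brn h i a) (s.brn h i' a') := by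
  rw [Set.disjoint_left]
  intro v hv hv'
  exact (r.brn_subset_ring hv).2 (s.lev_mono hi (r'.brn_subset_ring hv').1)

theorem Rng.exists_dart_row (r' : s.Rng h (i + 4) a) :
    ∃ d, M.tail d ∈ s.brn h i a ∧ M.head d ∈ s.brn h (i + 4) a := by
  obtain ⟨d, h1, h2⟩ := s.exists_exit' r.i_pos r.le r.th_gt r.th_le
  exact ⟨d, r.core_subset_brn (Or.inr h1), r'.core_subset_brn (Or.inr h2)⟩

theorem Rng.exists_dart_col (r' : s.Rng h i (a + 1)) :
    ∃ d, M.tail d ∈ s.brn h i a ∧ M.head d ∈ s.brn h i (a + 1) := by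
  have e1 := r.eq
  have e2 := r.ge
  have e3 := r'.lt
  have hts := s.gm_ts r.i_pos r.le'
  have hex : ∃ t, s.th h a + 15 ≤ s.gm i t := ⟨s.ts i, by unfold th; omega⟩
  obtain ⟨u, hu⟩ : ∃ u, Nat.find hex = u + 1 := by
    refine Nat.exists_eq_succ_of_ne_zero fun h0 => ?_
    have h1 := Nat.find_spec hex
    have h2 := s.px_zero r.le'
    rw [h0, gm_zero] at h1
    unfold th at h1
    omega
  have h1 := Nat.find_spec hex
  have h2 := Nat.find_min hex (m := u) (by omega)
  have h3 := s.gm_succ r.le' u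
  rw [hu] at h1
  have h4 : u + 1 < s.ts i := by
    by_contra! h5
    have := s.gm_mono (i := i) h5
    unfold th at h1 h2
    omega
  have h5 : s.tau h a + 1 ≤ s.th h a := r.tau_le
  have h6 : s.th h (a + 1) = s.th h a + 20 := by unfold th; omega
  have hwB : M.tail (s.ct i (u + 1)) ∈ s.blk h i a :=
    Or.inl ⟨u, by omega, by omega, by rw [tau_succ r]; omega,
      (s.isSeg r.i_pos r.le' (t := u) (by omega)).right⟩
  have hwR : M.tail (s.ct i (u + 1)) ∈ s.strip h i (a + 1) :=
    s.tail_mem_wid r.i_pos r.le' h4 (by rw [tau_succ r]; omega) (by rw [tau_succ r']; omega)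
  obtain ⟨v, hv⟩ := r.nonempty_brn
  obtain ⟨d, h7, h8, h9, h10⟩ := r.conn_blk.exists_dart (r.brn_subset hv).1 hv hwB
    fun h => (r.brn_subset h).2 hwR
  have h11 : M.head d ∈ s.strip h i (a + 1) := by
    by_contra h
    exact h10 (r.head_mem_brn h8 ⟨h9, h⟩)
  refine ⟨d, h8, r'.core_subset_brn (Or.inl ?_)⟩
  obtain ⟨t, ht, hα, hβ, hs⟩ := h11
  refine ⟨t, ht, hα, ?_, hs⟩
  obtain ⟨e, g1, g2, g3⟩ := s.psi_of_seg r.i_pos r.le' ht hs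
  have h12 : s.Near (M.head d) (s.gm i t - 3) (s.gm i t + 1) := ⟨e, g1, by omega, g3⟩
  have h13 := s.near_le h12 (r.near_blk h9) (s.ring_subset_O (by have := r.le; omega) (r.sub_ring h9))
  omega

theorem Rng.start_mem (ha : a = 0) : M.tail (s.ct i 0) ∈ s.brn h i a := by
  have e1 := r.eq
  have e2 := r.ge
  have h1 := s.px_zero r.le'
  refine r.core_subset_brn (Or.inl (s.tail_mem_wid r.i_pos r.le' (s.ts_pos r.i_pos r.le') ?_ ?_))
  · rw [tau, if_pos ha]
    exact Nat.zero_le _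
  · rw [gm_zero]
    unfold th
    omega

end

/-- A grid of connected sets, the first column of which is incident with darts to the root. -/
theorem exists_grid {h : ℕ} (hh : 0 < h) (hn : n = 100 * h) :
    ∃ B : ℕ → ℕ → Set V,
      (∀ a < h, ∀ b < h, M.Conn (B a b) ∧ (B a b).Nonempty ∧ B a b ⊆ O) ∧
      (∀ a < h, ∀ b < h, ∀ a' < h, ∀ b' < h, (a, b) ≠ (a', b') → Disjoint (B a b) (B a' b')) ∧
      (∀ a b, a < h → b + 1 < h → ∃ d, M.tail d ∈ B a b ∧ M.head d ∈ B a (b + 1)) ∧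
      (∀ a b, a + 1 < h → b < h → ∃ d, M.tail d ∈ B a b ∧ M.head d ∈ B (a + 1) b) ∧
      ∀ b < h, ∃ d, M.tail d ∈ B 0 b ∧ M.head d ∈ K := by
  have r : ∀ a < h, ∀ b < h, s.Rng h (50 * h + 4 * b) a := fun a ha b hb =>
    ⟨hh, hn, by omega, by omega, ha⟩
  refine ⟨fun a b => s.brn h (50 * h + 4 * b) a, ?_, ?_, ?_, ?_, ?_⟩
  · exact fun a ha b hb =>
      ⟨(r a ha b hb).conn_brn, (r a ha b hb).nonempty_brn, (r a ha b hb).brn_subset_O⟩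
  · intro a ha b hb a' ha' b' hb' hne
    rcases lt_trichotomy b b' with h1 | rfl | h1
    · exact (r a ha b hb).disjoint_of_row_lt (r a' ha' b' hb') (by omega)
    · rcases lt_trichotomy a a' with h2 | rfl | h2
      · exact (r a ha b hb).disjoint_of_col_lt (r a' ha' b hb) h2
      · exact absurd rfl hne
      · exact ((r a' ha' b hb).disjoint_of_col_lt (r a ha b hb) h2).symm
    · exact ((r a' ha' b' hb').disjoint_of_row_lt (r a ha b hb) (by omega)).symm
  · exact fun a b ha hb => (r a ha b (by omega)).exists_dart_row (r a ha (b + 1) hb)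
  · exact fun a b ha hb => (r a (by omega) b hb).exists_dart_col (r (a + 1) ha b hb)
  · intro b hb
    refine ⟨s.ct _ 0, (r 0 hh b hb).start_mem rfl, ?_⟩
    rw [ct_zero]
    exact s.head_b _

end Setup

end CMap

namespace CMap

open scoped Classical

variable {V D : Type}

section Transfer

variable {G : SimpleGraph V} {M : CMap V D} {ι : D → G.Dart}
  (hfst : ∀ d, (ι d).fst = M.tail d) (hsnd : ∀ d, (ι d).snd = M.head d)

include hfst hsnd

theorem adj_tail_head (d : D) : G.Adj (M.tail d) (M.head d) := by
  rw [← hfst, ← hsnd]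
  exact (ι d).adj

theorem Conn.connected_induce {A : Set V} (hA : M.Conn A) (hne : A.Nonempty) :
    (G.induce A).Connected := by
  have h : ∀ (u : V) (hu : u ∈ A) (v : V), M.ReachIn A u v →
      ∃ hv : v ∈ A, (G.induce A).Reachable ⟨u, hu⟩ ⟨v, hv⟩ := by
    intro u hu v hv
    induction hv with
    | refl => exact ⟨hu, .refl _⟩
    | tail _ h ih =>
      obtain ⟨h1, h2⟩ := ih
      obtain ⟨-, h3, d, rfl, rfl⟩ := h
      refine ⟨h3, h2.trans (SimpleGraph.Adj.reachable ?_)⟩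
      exact adj_tail_head hfst hsnd d
  have : Nonempty A := hne.to_subtype
  refine ⟨fun u v => ?_⟩
  exact (h u.1 u.2 v.1 (hA _ u.2 _ v.2)).2

/-- A grid of connected sets is a grid minor. -/
theorem exists_gridMinor [Fintype V] {h : ℕ} {B : ℕ → ℕ → Set V}
    (hB : ∀ a < h, ∀ b < h, M.Conn (B a b) ∧ (B a b).Nonempty)
    (hdisj : ∀ a < h, ∀ b < h, ∀ a' < h, ∀ b' < h, (a, b) ≠ (a', b') →
      Disjoint (B a b) (B a' b'))
    (hrow : ∀ a b, a < h → b + 1 < h → ∃ d, M.tail d ∈ B a b ∧ M.head d ∈ B a (b + 1))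
    (hcol : ∀ a b, a + 1 < h → b < h → ∃ d, M.tail d ∈ B a b ∧ M.head d ∈ B (a + 1) b) :
    ∃ gm : GridMinor G h, ∀ w v, v ∈ gm.branch w ↔ v ∈ B w.1 w.2 := by
  refine ⟨⟨fun w => (B w.1 w.2).toFinset, ?_, ?_, ?_, ?_⟩, fun w v => Set.mem_toFinset⟩
  · intro w
    rw [Set.toFinset_nonempty]
    exact (hB _ w.1.2 _ w.2.2).2
  · intro w w' hne
    rw [Set.disjoint_toFinset]
    refine hdisj _ w.1.2 _ w.2.2 _ w'.1.2 _ w'.2.2 fun h => hne ?_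
    rw [Prod.mk.injEq] at h
    exact Prod.ext (Fin.ext h.1) (Fin.ext h.2)
  · intro w
    rw [Set.coe_toFinset]
    exact (hB _ w.1.2 _ w.2.2).1.connected_induce hfst hsnd (hB _ w.1.2 _ w.2.2).2
  · have key : ∀ w w' : Fin h × Fin h, ((w.1 = w'.1 ∧ (w.2 : ℕ) + 1 = w'.2) ∨
        (w.2 = w'.2 ∧ (w.1 : ℕ) + 1 = w'.1)) →
        ∃ d, M.tail d ∈ B w.1 w.2 ∧ M.head d ∈ B w'.1 w'.2 := by
      rintro w w' (⟨h1, h2⟩ | ⟨h1, h2⟩)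
      · rw [← h1, ← h2]
        exact hrow _ _ w.1.2 (h2 ▸ w'.2.2)
      · rw [← h1, ← h2]
        exact hcol _ _ (h2 ▸ w'.1.2) w.2.2
    intro w w' hadj
    rw [gridGraph, SimpleGraph.fromRel_adj] at hadj
    rcases hadj.2 with h1 | h1
    · obtain ⟨d, h2, h3⟩ := key _ _ h1
      exact ⟨_, Set.mem_toFinset.mpr h2, _, Set.mem_toFinset.mpr h3, adj_tail_head hfst hsnd d⟩
    · obtain ⟨d, h2, h3⟩ := key _ _ h1
      exact ⟨_, Set.mem_toFinset.mpr h3, _, Set.mem_toFinset.mpr h2,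
        (adj_tail_head hfst hsnd d).symm⟩

/-- Every small cut separating `X` from vertices attached to the root of a disk is paid for. -/
theorem le_cut [Fintype V] [Fintype D] (hι : Function.Injective ι) {K O : Set V} {X S : Finset V}
    {r : ℕ} (hrX : 4 * r ≤ X.card) (hrS : r ≤ S.card)
    (hdisk : ∀ Q ⊆ O, 4 * wt X Q ≤ X.card → M.edg Q K ≤ M.edg Q (O \ Q))
    (hS : ∀ v ∈ S, v ∈ O ∧ ∃ d, M.tail d = v ∧ M.head d ∈ K) (Q : Finset V) :
    r ≤ (X ∩ Q).card + (univ.filter fun d : G.Dart => d.fst ∉ Q ∧ d.snd ∈ Q).card +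
      (S \ Q).card := by
  by_cases hX : r ≤ (X ∩ Q).card
  · omega
  have h1 : wt X (↑Q ∩ O) ≤ (X ∩ Q).card := by
    refine Finset.card_le_card fun x hx => ?_
    have hx := (@Finset.mem_filter _ _ (_) _ _).mp hx
    exact Finset.mem_inter.mpr ⟨hx.1, Finset.mem_coe.mp hx.2.1⟩
  have h2 := hdisk (↑Q ∩ O) Set.inter_subset_right (by omega)
  have h3 : (S ∩ Q).card ≤ M.edg (↑Q ∩ O) K := by
    refine (Finset.card_le_card fun v hv => ?_).trans (Finset.card_image_le (f := M.tail))
    rw [Finset.mem_inter] at hv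
    obtain ⟨h3, d, rfl, h4⟩ := hS v hv.1
    refine Finset.mem_image.mpr ⟨d, ?_, rfl⟩
    simp only [Finset.mem_filter, Finset.mem_univ, true_and]
    exact ⟨⟨hv.2, h3⟩, h4⟩
  have h4 : M.edg (↑Q ∩ O) (O \ (↑Q ∩ O)) ≤
      (univ.filter fun d : G.Dart => d.fst ∉ Q ∧ d.snd ∈ Q).card := by
    refine Finset.card_le_card_of_injOn (fun d => ι (M.rev d)) ?_ ?_
    · intro d hd
      simp only [Finset.coe_filter, Set.mem_ofPred_eq, Finset.mem_univ, true_and] at hd ⊢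
      rw [hfst, hsnd, tail_rev, head_rev]
      exact ⟨fun h => hd.2.2 ⟨h, hd.2.1⟩, hd.1.1⟩
    · intro d _ e _ h
      exact M.rev_injective (hι h)
  have h5 := Finset.card_inter_add_card_sdiff S Q
  omega

end Transfer

theorem card_even_ge (h : ℕ) :
    (h + 1) / 2 ≤ (Finset.univ.filter fun j : Fin h => (j : ℕ) % 2 = 0).card := by
  rw [← Fintype.card_fin ((h + 1) / 2), ← Finset.card_univ]
  refine Finset.card_le_card_of_injOn (fun k => ⟨2 * k.1, by omega⟩) ?_ ?_
  · intro k _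
    simp
  · intro k _ l _ hkl
    have := Fin.mk.inj_iff.mp hkl
    exact Fin.ext (by omega)

/-- A planar-like map of degree at most four in which `X` is nearly well-linked carries a large
grid minor whose interface can be reached from `X`. -/
theorem exists_reachable_grid [Fintype V] [Fintype D] {G : SimpleGraph V}
    (M : CMap V D) (ι : D → G.Dart) (hι : Function.Injective ι)
    (hfst : ∀ d, (ι d).fst = M.tail d) (hsnd : ∀ d, (ι d).snd = M.head d)
    (X : Finset V) {h k : ℕ} (hh : 0 < h) (hM : M.Planarlike (100 * (100 * h)))
    (hdeg : ∀ v, (univ.filter fun d => M.tail d = v).card ≤ 4)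
    (wl : ∀ T : Set V, min (wt X T) (X.card - wt X T) ≤ M.cut T + k)
    (hk : 8 * (20 * (100 * h) + k) + 8 ≤ X.card) :
    ∃ (gm : GridMinor G h) (S : Finset V), IsInterface gm S ∧
      ∃ X' ⊆ X, (h : ℝ) / 8 ≤ (X'.card : ℝ) ∧ Routable G X' S := by
  obtain ⟨K, O, hKO, hm1, hm2, hcut⟩ := M.exists_disk X hdeg wl (by omega) hk
  have hne : 0 < M.edg O K := by omega
  obtain ⟨b0, hb0⟩ := Finset.card_pos.mp hne
  simp only [Finset.mem_filter, Finset.mem_univ, true_and] at hb0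
  let s : M.Setup K O (100 * h) := ⟨hKO, hM, hdeg, hm1, hm2, by omega, b0, hb0.1,
    fun h => Set.disjoint_left.mp hKO.disj hb0.2 h⟩
  obtain ⟨B, hB, hdisj, hrow, hcol, hroot⟩ := s.exists_grid hh rfl
  obtain ⟨gm, hgm⟩ := exists_gridMinor hfst hsnd
    (fun a ha b hb => ⟨(hB a ha b hb).1, (hB a ha b hb).2.1⟩) hdisj hrow hcol
  have : Nonempty D := ⟨b0⟩
  choose! e he1 he2 using hroot
  have hinj : Function.Injective fun j : Fin h => M.tail (e j) := by
    intro j j' hj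
    by_contra hne
    refine Set.disjoint_left.mp (hdisj 0 hh j j.2 0 hh j' j'.2 ?_) (he1 j j.2) ?_
    · simpa [Fin.ext_iff] using hne
    · have : M.tail (e j) = M.tail (e j') := hj
      rw [this]
      exact he1 j' j'.2
  refine ⟨gm, _, ⟨fun j => M.tail (e j), fun j => (hgm _ _).mpr (he1 j j.2), rfl⟩, ?_⟩
  have hcard := card_even_ge h
  obtain ⟨X', hX', hc, hR⟩ := exists_routable X
    (((Finset.univ.filter fun j : Fin h => (j : ℕ) % 2 = 0)).image fun j : Fin h => M.tail (e j))
    ((h + 7) / 8) (le_cut hfst hsnd hι (by omega)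
      (by rw [Finset.card_image_of_injective _ hinj]; omega) hcut (by
        intro v hv
        obtain ⟨j, -, rfl⟩ := Finset.mem_image.mp hv
        exact ⟨(hB 0 hh j j.2).2.2 (he1 j j.2), e j, rfl, he2 j j.2⟩))
  refine ⟨X', hX', ?_, ?_⟩
  · have h1 : h ≤ 8 * X'.card := by omega
    have h2 : (h : ℝ) ≤ 8 * X'.card := by exact_mod_cast h1
    linarith
  · exact hR

/-- The map of a rotation system. -/
def ofRot {G : SimpleGraph V} (rs : RotationSystem G) : CMap V G.Dart where
  tail d := d.fst
  rev d := d.symm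
  rot := rs.rot
  rev_rev d := d.symm_symm
  rev_ne d := d.symm_ne
  tail_rot := rs.tail_fixed
  cyc := rs.vertex_cycle

theorem finrank_ofRot_le [Fintype V] {G : SimpleGraph V} {g : ℕ} (rs : RotationSystem G)
    (hrs : (2 * Nat.card G.ConnectedComponent : ℤ) - 2 * (g : ℤ) ≤
      (Nat.card V : ℤ) - (G.edgeSet.ncard : ℤ) + (rs.numFaces : ℤ)) :
    Module.finrank (ZMod 2) (ofRot rs).closedSpace ≤
      Module.finrank (ZMod 2) (LinearMap.range (ofRot rs).cobMap) + 2 * g := by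
  have h := (ofRot rs).finrank_closedSpace_le (E := G.edgeSet) (C := G.ConnectedComponent)
    (fun d => ⟨d.edge, d.edge_mem⟩) ?_ G.connectedComponentMk ?_
  · have h1 : rs.numFaces = Fintype.card (ofRot rs).Face := Nat.card_eq_fintype_card
    have h2 : G.edgeSet.ncard = Fintype.card G.edgeSet := by
      rw [← Nat.card_coe_set_eq, Nat.card_eq_fintype_card]
    rw [h1, h2, Nat.card_eq_fintype_card, Nat.card_eq_fintype_card] at hrs
    omega
  · intro d e hde
    rcases SimpleGraph.dart_edge_eq_iff d e |>.mp (congrArg Subtype.val hde) with h | h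
    · exact Or.inl h.symm
    · exact Or.inr (by rw [h]; exact (e.symm_symm).symm)
  · intro u v
    rw [SimpleGraph.ConnectedComponent.eq, SimpleGraph.reachable_iff_reflTransGen]
    have hadj : (ofRot rs).Adj = G.Adj := by
      ext u v
      constructor
      · rintro ⟨d, rfl, rfl⟩
        exact d.adj
      · exact fun h => ⟨⟨(u, v), h⟩, rfl, rfl⟩
    rw [hadj]

theorem edgeCut_le [Fintype V] {G : SimpleGraph V} (T : Set V) :
    edgeCut G T ≤ (univ.filter fun d : G.Dart => d.fst ∈ T ∧ d.snd ∉ T).card := by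
  have h : {e ∈ G.edgeSet | ∃ u v, e = s(u, v) ∧ u ∈ T ∧ v ∉ T} ⊆
      ((univ.filter fun d : G.Dart => d.fst ∈ T ∧ d.snd ∉ T).image fun d => d.edge : Finset _) := by
    rintro e ⟨he, u, v, rfl, hu, hv⟩
    rw [Finset.mem_coe, Finset.mem_image]
    exact ⟨⟨(u, v), he⟩, by simp [hu, hv], rfl⟩
  refine (Set.ncard_le_ncard h (Finset.finite_toSet _)).trans ?_
  rw [Set.ncard_coe_finset]
  exact Finset.card_image_le

theorem edgeCut_compl {G : SimpleGraph V} (T : Set V) : edgeCut G Tᶜ = edgeCut G T := by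
  unfold edgeCut
  congr 1
  ext e
  simp only [Set.mem_ofPred_eq, Set.mem_compl_iff, not_not]
  constructor
  · rintro ⟨he, u, v, rfl, hu, hv⟩
    exact ⟨he, v, u, Sym2.eq_swap, hv, hu⟩
  · rintro ⟨he, u, v, rfl, hu, hv⟩
    exact ⟨he, v, u, Sym2.eq_swap, hv, hu⟩

theorem min_wt_le_edgeCut [Fintype V] {G : SimpleGraph V} {X : Finset V}
    (hX : WellLinked G X) (T : Set V) : min (wt X T) (X.card - wt X T) ≤ edgeCut G T := by
  have hw : ∀ T : Set V, 2 * wt X T ≤ X.card → wt X T ≤ edgeCut G T := by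
    intro T hT
    have h1 : T.toFinset ∩ X = X.filter fun x => x ∈ T := by
      ext x
      simp [and_comm]
    have h2 := hX T.toFinset
    rw [h1, Set.coe_toFinset] at h2
    exact h2 hT
  have h1 : wt X T + wt X Tᶜ = X.card := by
    unfold wt
    convert Finset.card_filter_add_card_filter_not _
    infer_instance
  rcases le_total (2 * wt X T) X.card with h | h
  · exact (min_le_left _ _).trans (hw T h)
  · have h2 := hw Tᶜ (by omega)
    rw [edgeCut_compl] at h2
    omega

theorem cut_ofRot_le [Fintype V] {G : SimpleGraph V} (rs : RotationSystem G) {S : Set G.Dart}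
    (hS : ∀ d, (ofRot rs).rev d ∈ S ↔ d ∈ S) (T : Set V) :
    (univ.filter fun d : G.Dart => d.fst ∈ T ∧ d.snd ∉ T).card ≤
      ((ofRot rs).restrict S hS).cut T + (univ.filter fun d => d ∉ S).card := by
  have h1 : (univ.filter fun d : G.Dart => d.fst ∈ T ∧ d.snd ∉ T) ⊆
      ((univ.filter fun d : S => ((ofRot rs).restrict S hS).tail d ∈ T ∧
        ((ofRot rs).restrict S hS).head d ∉ T).image Subtype.val) ∪
      (univ.filter fun d => d ∉ S) := by
    intro d hd
    rw [Finset.mem_union]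
    by_cases h : d ∈ S
    · refine Or.inl (Finset.mem_image.mpr ⟨⟨d, h⟩, ?_, rfl⟩)
      simp only [Finset.mem_filter, Finset.mem_univ, true_and] at hd ⊢
      exact hd
    · exact Or.inr (by simpa using h)
  refine (Finset.card_le_card h1).trans ((Finset.card_union_le _ _).trans ?_)
  exact Nat.add_le_add_right Finset.card_image_le _

end CMap

open scoped Classical in
/-- The theorem for well-linked sets that are large compared to the genus. -/
theorem exists_of_large {V : Type} [Fintype V] {G : SimpleGraph V} {g h : ℕ} (hg : 0 < g) (hG : genusLE G g) (hdeg : ∀ v, G.degree v ≤ 4)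
    {X : Finset V} (hX : WellLinked G X) (hh : 0 < h) (hk : h * (200000 * g) ≤ X.card) :
    ∃ (gm : GridMinor G h) (S : Finset V), IsInterface gm S ∧
      ∃ X' ⊆ X, (h : ℝ) / 8 ≤ (X'.card : ℝ) ∧ Routable G X' S := by
  obtain ⟨rs, hrs⟩ := hG
  obtain ⟨S, hS, hM, hdel⟩ := (CMap.ofRot rs).exists_planarlike_restrict
    (CMap.finrank_ofRot_le rs hrs) (100 * (100 * h))
  refine CMap.exists_reachable_grid ((CMap.ofRot rs).restrict S hS) Subtype.val
    Subtype.val_injective (fun _ => rfl) (fun _ => rfl) X (k := 100 * (100 * h) * (2 * g)) hh hM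
    ?_ ?_ ?_
  · intro v
    refine le_trans ?_ (hdeg v)
    rw [← G.dart_fst_fiber_card_eq_degree]
    refine Finset.card_le_card_of_injOn Subtype.val ?_ Subtype.val_injective.injOn
    intro d hd
    simp only [Finset.coe_filter, Set.mem_ofPred_eq, Finset.mem_univ, true_and] at hd ⊢
    exact hd
  · intro T
    have h1 := CMap.min_wt_le_edgeCut hX T
    have h2 := CMap.edgeCut_le (G := G) T
    have h3 := CMap.cut_ofRot_le rs hS T
    refine (h1.trans h2).trans ?_
    convert h3.trans (Nat.add_le_add_left hdel _)
  · have h1 : h * 1 ≤ h * g := Nat.mul_le_mul_left h hg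
    have h2 : h * (200000 * g) = 200000 * (h * g) := by ring
    have h3 : 100 * (100 * h) * (2 * g) = 20000 * (h * g) := by ring
    omega

open scoped Classical in
/-- A single vertex is a grid minor of side one reached by a trivial path. -/
theorem exists_of_mem {V : Type} (G : SimpleGraph V) {X : Finset V} {x : V}
    (hx : x ∈ X) :
    ∃ (gm : GridMinor G 1) (S : Finset V), IsInterface gm S ∧
      ∃ X' ⊆ X, ((1 : ℕ) : ℝ) / 8 ≤ (X'.card : ℝ) ∧ Routable G X' S := by
  refine ⟨⟨fun _ => {x}, fun _ => ⟨x, by simp⟩, fun w w' h => absurd (Subsingleton.elim w w') h,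
    fun _ => ?_, fun w w' h => absurd (Subsingleton.elim w w') h.ne⟩, _,
    ⟨fun _ => x, fun _ => by simp, rfl⟩, {x}, by simpa using hx, by norm_num, ?_⟩
  · have : Nonempty ((({x} : Finset V) : Set V)) := ⟨⟨x, by simp⟩⟩
    refine ⟨fun u v => ?_⟩
    have hu := u.2
    have hv := v.2
    simp only [Finset.coe_singleton, Set.mem_singleton_iff] at hu hv
    rw [Subtype.ext (hu.trans hv.symm)]
  · refine ⟨id, fun _ _ => .nil, ?_, fun _ _ _ _ h => h, fun _ _ _ _ h => h, fun e => ?_⟩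
    · intro s hs
      rw [Finset.mem_singleton] at hs
      subst hs
      exact Finset.mem_image.mpr ⟨0, by simp, rfl⟩
    · refine (Finset.sum_eq_zero fun a _ => ?_).le.trans zero_le_one
      simp [ecount]

open scoped Classical in
theorem exists_of_empty {V : Type} (G : SimpleGraph V) (X : Finset V) :
    ∃ (gm : GridMinor G 0) (S : Finset V), IsInterface gm S ∧
      ∃ X' ⊆ X, ((0 : ℕ) : ℝ) / 8 ≤ (X'.card : ℝ) ∧ Routable G X' S :=
  ⟨⟨fun w => w.1.elim0, fun w => w.1.elim0, fun w => w.1.elim0, fun w => w.1.elim0,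
    fun w => w.1.elim0⟩, _, ⟨fun j => j.elim0, fun j => j.elim0, rfl⟩, ∅, by simp, by simp,
    id, fun _ _ => .nil, by simp, by simp, by simp, by simp⟩

end ReachGrid

/-- **Reachable grid minors in bounded-genus graphs (Theorem `thm:reachable-grid`).**
There is a constant `c > 0` such that: for every graph `G` of genus `g > 0` with
maximum degree at most `4` and every well-linked set `X` in `G`, the graph `G` contains
an `h × h` grid minor with an interface `S` such that `h ≥ c·|X|/g` and there are at
least `h/8` pairwise edge-disjoint paths in `G` from `X` to `S` (each vertex of `X` and
of `S` being the endpoint of at most one of these paths). -/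
theorem reachable_grid_minor :
    ∃ c : ℝ, 0 < c ∧
      ∀ (V : Type) [Fintype V] [DecidableEq V] (G : SimpleGraph V)
        [DecidableRel G.Adj] (g : ℕ), 0 < g → genusLE G g →
        (∀ v : V, G.degree v ≤ 4) →
        ∀ X : Finset V, WellLinked G X →
        ∃ (h : ℕ) (gm : GridMinor G h) (S : Finset V),
          IsInterface gm S ∧
          c * (X.card : ℝ) / (g : ℝ) ≤ (h : ℝ) ∧
          ∃ X' ⊆ X, (h : ℝ) / 8 ≤ (X'.card : ℝ) ∧ Routable G X' S := by
  refine ⟨1 / 400000, by norm_num, fun V _ _ G _ g hg hG hdeg X hX => ?_⟩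
  obtain rfl : ‹DecidableEq V› = fun a b => Classical.propDecidable (a = b) :=
    Subsingleton.elim _ _
  obtain rfl : ‹DecidableRel G.Adj› = fun a b => Classical.propDecidable (G.Adj a b) :=
    Subsingleton.elim _ _
  have hg' : (0 : ℝ) < g := by exact_mod_cast hg
  have key : ∀ h : ℕ, X.card ≤ 400000 * (h * g) →
      1 / 400000 * (X.card : ℝ) / (g : ℝ) ≤ (h : ℝ) := by
    intro h hX
    have h1 : (X.card : ℝ) ≤ 400000 * (h * g) := by exact_mod_cast hX
    rw [div_le_iff₀ hg']
    linarith
  rcases Nat.eq_zero_or_pos (X.card / (200000 * g)) with h0 | h0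
  · rcases X.eq_empty_or_nonempty with rfl | ⟨x, hx⟩
    · obtain ⟨gm, S, h1, h2⟩ := ReachGrid.exists_of_empty G ∅
      exact ⟨0, gm, S, h1, key 0 (by simp), h2⟩
    · obtain ⟨gm, S, h1, h2⟩ := ReachGrid.exists_of_mem G hx
      refine ⟨1, gm, S, h1, key 1 ?_, h2⟩
      have := (Nat.div_eq_zero_iff_lt (by omega)).mp h0
      omega
  · obtain ⟨gm, S, h1, h2⟩ :=
      ReachGrid.exists_of_large hg hG hdeg hX h0 (Nat.div_mul_le_self _ _)
    refine ⟨_, gm, S, h1, key _ ?_, h2⟩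
    have h3 := Nat.lt_div_mul_add (a := X.card) (b := 200000 * g) (by omega)
    have h4 := Nat.mul_le_mul_right g h0
    have h5 : X.card / (200000 * g) * (200000 * g) = 200000 * (X.card / (200000 * g) * g) := by
      ring
    omega
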